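/- Assume P satisfies power-law ψ-mixing with exponent α > 2. Fix ε > 0 and η with 4/5 < η < 4/3. Then there exist constants C, λ₀ > 0 such that for all 0 < λ < λ₀ one has |γ_λ(2 + ελ^η) − (ελ^η)^{1/2}| ≤ C·(λ^{1−η/4} + λ^{7η/4−1} + λ^{(η/4)·(3α+2)/(α+2)}). -/

import Mathlib

open MeasureTheory Filter

noncomputable section

attribute [local instance] Matrix.normedAddCommGroup Matrix.normedSpace

/-- The shift by `n` on the configuration space `Σ^ℤ`: `(shiftn n ω) i = ω (i + n)`.
`shiftn 1` is the left shift `S`. -/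
def shiftn {A : Type*} (n : ℤ) (ω : ℤ → A) : ℤ → A := fun i => ω (i + n)

/-- A bounded function `g` on `Σ^ℤ` is quasi-local with rate `r` if its variation on the
window `[-m, n]` is bounded by `C(g) · r^(min m n)` for all `m, n ≥ 1`. -/
def QuasiLocal {A : Type*} {E : Type*} [SeminormedAddGroup E] (r : ℝ)
    (g : (ℤ → A) → E) : Prop :=
  ∃ C : ℝ, ∀ m n : ℕ, 1 ≤ m → 1 ≤ n → ∀ ω ω' : ℤ → A,
    (∀ i : ℤ, -(m : ℤ) ≤ i → i ≤ (n : ℤ) → ω i = ω' i) →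
    ‖g ω - g ω'‖ ≤ C * r ^ (min m n)

/-- Power-law ψ-mixing with exponent α: for all `k < l < m < n`, all bounded `g₁` measurable
w.r.t. the coordinates in `[k,l]` and bounded `g₂` measurable w.r.t. the coordinates in `[m,n]`,
`|E(g₁g₂) − E(g₁)E(g₂)| ≤ C·E(|g₁|)·E(|g₂|)·|m−l|^(−α)`. -/
def PowerMixing {A : Type*} [MeasurableSpace A] (P : Measure (ℤ → A)) (α : ℝ) : Prop :=
  ∃ C : ℝ, ∀ k l m n : ℤ, k < l → l < m → m < n →
    ∀ g₁ g₂ : (ℤ → A) → ℝ, Measurable g₁ → Measurable g₂ →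
      (∃ B, ∀ ω, |g₁ ω| ≤ B) → (∃ B, ∀ ω, |g₂ ω| ≤ B) →
      (∀ ω ω', (∀ i : ℤ, k ≤ i → i ≤ l → ω i = ω' i) → g₁ ω = g₁ ω') →
      (∀ ω ω', (∀ i : ℤ, m ≤ i → i ≤ n → ω i = ω' i) → g₂ ω = g₂ ω') →
      |(∫ ω, g₁ ω * g₂ ω ∂P) - (∫ ω, g₁ ω ∂P) * ∫ ω, g₂ ω ∂P| ≤
        C * (∫ ω, |g₁ ω| ∂P) * (∫ ω, |g₂ ω| ∂P) * (|(m : ℝ) - (l : ℝ)|) ^ (-α)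

/-- The transfer matrix `T^E_{λ,ω} = [[E − λV(ω), −1],[1, 0]]`. -/
def transferMat {A : Type*} (lam : ℝ) (V : (ℤ → A) → ℝ) (E : ℂ) (ω : ℤ → A) :
    Matrix (Fin 2) (Fin 2) ℂ :=
  !![E - (lam : ℂ) * (V ω : ℂ), -1; 1, 0]

/-- The product `T^E_{λ,S^Nω} ⋯ T^E_{λ,S²ω} T^E_{λ,Sω}` of transfer matrices. -/
def transferProd {A : Type*} (lam : ℝ) (V : (ℤ → A) → ℝ) (E : ℂ) :
    ℕ → (ℤ → A) → Matrix (Fin 2) (Fin 2) ℂ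
  | 0, _ => 1
  | n + 1, ω => transferMat lam V E (shiftn (n + 1) ω) * transferProd lam V E n ω

/-- `γ` is the Lyapunov exponent at energy `E`:
`γ = lim_{N→∞} (1/N)·E log‖T^E_{λ,S^Nω}⋯T^E_{λ,Sω}‖`. -/
def IsLyapunov {A : Type*} [MeasurableSpace A] (P : Measure (ℤ → A)) (lam : ℝ)
    (V : (ℤ → A) → ℝ) (E : ℂ) (γ : ℝ) : Prop :=
  Tendsto (fun N : ℕ => (N : ℝ)⁻¹ * ∫ ω, Real.log ‖transferProd lam V E N ω‖ ∂P)
    atTop (nhds γ)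

/-- The spectral density `D_V(k) = Σ_{n∈ℤ} e^{ikn} E(V·(V∘S^n))`. -/
def specDensity {A : Type*} [MeasurableSpace A] (P : Measure (ℤ → A))
    (V : (ℤ → A) → ℝ) (k : ℝ) : ℂ :=
  ∑' n : ℤ, Complex.exp (Complex.I * (k : ℂ) * (n : ℂ)) *
    ((∫ ω, V ω * V (shiftn n ω) ∂P : ℝ) : ℂ)

/-- The distance from `k` to the nearest point of `(π/2)·ℤ`. -/
def distHalfPi (k : ℝ) : ℝ := ⨅ j : ℤ, |k - Real.pi / 2 * (j : ℝ)|

/-- `u` solves the second order recursion with energies `e^κ + e^{-κ} - e^κ f n`. -/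
def IsSol (κ : ℝ) (f u : ℕ → ℝ) : Prop :=
  ∀ n, u (n + 2) = (Real.exp κ + Real.exp (-κ) - Real.exp κ * f n) * u (n + 1) - u n

/-- `Z` solves the linearized Riccati recursion driven by `-f`. -/
def IsFilt (κ : ℝ) (f Z : ℕ → ℝ) : Prop :=
  ∀ n, Z (n + 1) = Real.exp (-2 * κ) * Z n - f n

/-- The width of the barrier below the linearized trajectory. -/
def IsBarrier (κ : ℝ) (Z β : ℕ → ℝ) : Prop :=
  ∀ n, β (n + 1) = (1 - κ / 5) * β n + 4 * κ * |Z n|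

theorem IsSol.neg {κ : ℝ} {f u : ℕ → ℝ} (h : IsSol κ f u) : IsSol κ f (fun n => -u n) := by
  intro n
  simp only [h n]
  ring

theorem IsSol.shift {κ : ℝ} {f u : ℕ → ℝ} (h : IsSol κ f u) (s : ℕ) :
    IsSol κ (fun n => f (s + n)) (fun n => u (s + n)) := fun n => h (s + n)

theorem IsFilt.shift {κ : ℝ} {f Z : ℕ → ℝ} (h : IsFilt κ f Z) (s : ℕ) :
    IsFilt κ (fun n => f (s + n)) (fun n => Z (s + n)) := fun n => h (s + n)

theorem exp_mul_exp_neg_two (κ : ℝ) : Real.exp κ * Real.exp (-2 * κ) = Real.exp (-κ) := by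
  rw [← Real.exp_add]; ring_nf

theorem barrier_gain {κ Z β a2 : ℝ} (hκ : 0 < κ) (hκ1 : κ ≤ 1 / 1000) (hZ : |Z| ≤ κ / 100)
    (hβ : 0 ≤ β) (hβ1 : β ≤ 1.72 * κ) (ha : 1 + 2 * κ ≤ a2) :
    1 ≤ (1 + Z - β) * (1 - Z + a2 * ((1 - κ / 5) * β + 4 * κ * |Z|)) := by
  have hW := abs_nonneg Z
  obtain ⟨hZ1, hZ2⟩ := abs_le.1 hZ
  set W := |Z| with hWd
  have hWZ : Z ^ 2 = W ^ 2 := (sq_abs Z).symm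
  have hm1 : -W ≤ Z := neg_abs_le Z
  have hβ' : 0 ≤ (1 - κ / 5) * β + 4 * κ * W := by
    have : 0 ≤ 1 - κ / 5 := by linarith
    positivity
  have h1 : (1 + 2 * κ) * ((1 - κ / 5) * β + 4 * κ * W) ≤ a2 * ((1 - κ / 5) * β + 4 * κ * W) :=
    mul_le_mul_of_nonneg_right ha hβ'
  have hp : 0 ≤ 1 + Z - β := by norm_num at hβ1; nlinarith
  refine le_trans ?_ (mul_le_mul_of_nonneg_left (add_le_add_right h1 (1 - Z)) hp)
  set B := (1 + 2 * κ) * ((1 - κ / 5) * β + 4 * κ * W) with hB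
  have e : (1 + Z - β) * (1 - Z + B) = 1 + (B - β) - W ^ 2 + Z * (B + β) - β * B := by
    rw [← hWZ]; ring
  rw [e]
  norm_num at hβ1
  have hB0 : 0 ≤ B := by positivity
  have hβκ : 0 ≤ β * κ := by positivity
  have hWκ : 0 ≤ W * κ := by positivity
  have hB2 : B ≤ β * (1 + 1.8 * κ) + 4.01 * (W * κ) := by
    norm_num
    rw [hB]
    nlinarith [mul_nonneg hβκ hκ.le, mul_nonneg hWκ hκ.le]
  have hB1 : β * (1.8 * κ - 0.001 * κ) + 4 * (W * κ) ≤ B - β := by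
    norm_num
    rw [hB]
    nlinarith [mul_nonneg hβκ hκ.le, mul_nonneg hWκ hκ.le]
  have hBβ : B + β ≤ 3.5 * κ := by
    norm_num at hB2 ⊢
    nlinarith
  have hZB : -(W * (3.5 * κ)) ≤ Z * (B + β) := by
    have : W * (B + β) ≤ W * (3.5 * κ) := mul_le_mul_of_nonneg_left hBβ hW
    have : -W * (B + β) ≤ Z * (B + β) := mul_le_mul_of_nonneg_right hm1 (by positivity)
    linarith
  have hβB : β * B ≤ 1.73 * (β * κ) + 0.01 * (W * κ) := by
    have h2 : β * B ≤ β * (β * (1 + 1.8 * κ) + 4.01 * (W * κ)) := mul_le_mul_of_nonneg_left hB2 hβ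
    have h3 : β * β ≤ 1.72 * (β * κ) := by norm_num; nlinarith
    have h4 : β * β * κ ≤ 1.72 * (β * κ) * (1 / 1000) := by
      apply mul_le_mul h3 hκ1 hκ.le (by positivity)
    have h5 : β * (W * κ) ≤ (1.72 / 1000) * (W * κ) := by
      apply mul_le_mul_of_nonneg_right _ hWκ
      norm_num; linarith
    norm_num at h2 h3 h4 h5 ⊢
    nlinarith
  have hW2 : W ^ 2 ≤ 0.01 * (W * κ) := by norm_num; nlinarith
  norm_num at hB1 hZB hβB hW2
  nlinarith

theorem barrier_invariant {κ : ℝ} (hκ : 0 < κ) (hκ1 : κ ≤ 1 / 1000) {f u Z β : ℕ → ℝ}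
    (hu : IsSol κ f u) (hZ : IsFilt κ f Z) (hβ : IsBarrier κ Z β) {L : ℕ}
    (good : ∀ n ≤ L, |Z n| ≤ κ / 100) (h0 : 0 ≤ β 0) (h01 : β 0 ≤ 1.72 * κ)
    (hu1 : 0 < u 1) (hu0 : 0 ≤ u 0) (hb : Real.exp κ * u 0 * (1 + Z 0 - β 0) ≤ u 1) :
    ∀ n ≤ L, 0 < u (n + 1) ∧ 0 ≤ u n ∧ 0 ≤ β n ∧ β n ≤ 1.72 * κ ∧
      Real.exp κ * u n * (1 + Z n - β n) ≤ u (n + 1) := by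
  intro n
  induction n with
  | zero => intro _; exact ⟨hu1, hu0, h0, h01, hb⟩
  | succ n ih =>
    intro hn
    obtain ⟨i1, i2, i3, i4, i5⟩ := ih (by omega)
    have g := good n (by omega)
    have g' := good (n + 1) hn
    have hβ' : 0 ≤ β (n + 1) := by
      rw [hβ n]
      have : 0 ≤ 1 - κ / 5 := by linarith
      positivity
    have hβ1' : β (n + 1) ≤ 1.72 * κ := by
      rw [hβ n]
      norm_num at i4 ⊢
      nlinarith [mul_le_mul_of_nonneg_left i4 (by linarith : 0 ≤ 1 - κ / 5),
        mul_le_mul_of_nonneg_left g hκ.le]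
    have ha : 1 + 2 * κ ≤ Real.exp κ * Real.exp κ := by
      rw [← Real.exp_add]
      linarith [Real.add_one_le_exp (κ + κ)]
    have gain := barrier_gain hκ hκ1 g i3 i4 ha
    rw [← hβ n] at gain
    set G := 1 - Z n + Real.exp κ * Real.exp κ * β (n + 1) with hG
    have hGpos : 0 ≤ G := by
      have := (abs_le.1 g).2
      have : 0 ≤ 1 - Z n := by linarith
      positivity
    have key : Real.exp κ * u n ≤ u (n + 1) * G := by
      have h1 := mul_le_mul_of_nonneg_right i5 hGpos
      have h2 : Real.exp κ * u n * 1 ≤ Real.exp κ * u n * ((1 + Z n - β n) * G) :=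
        mul_le_mul_of_nonneg_left gain (by positivity)
      linarith
    have main : Real.exp κ * u (n + 1) * (1 + Z (n + 1) - β (n + 1)) ≤ u (n + 1 + 1) := by
      have e1 := hu n
      have e2 := hZ n
      have e3 := exp_mul_exp_neg_two κ
      have e4 : Real.exp κ * Real.exp (-κ) = 1 := by rw [← Real.exp_add]; simp
      have hpos := Real.exp_pos κ
      have hpos' := Real.exp_pos (-κ)
      have key' : u n ≤ Real.exp (-κ) * (u (n + 1) * G) := by
        have := mul_le_mul_of_nonneg_left key hpos'.le
        calc u n = Real.exp κ * Real.exp (-κ) * u n := by rw [e4, one_mul]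
          _ = Real.exp (-κ) * (Real.exp κ * u n) := by ring
          _ ≤ _ := this
      rw [e1, e2]
      have : Real.exp (-κ) * (u (n + 1) * G) = Real.exp (-κ) * u (n + 1) -
          Real.exp κ * Real.exp (-2 * κ) * Z n * u (n + 1)
          + Real.exp κ * β (n + 1) * u (n + 1) := by
        rw [e3, hG]
        linear_combination (Real.exp κ * u (n + 1) * β (n + 1)) * e4
      nlinarith
    have hpos : 0 < Real.exp κ * u (n + 1) * (1 + Z (n + 1) - β (n + 1)) := by
      have := (abs_le.1 g').1
      have : 0 < 1 + Z (n + 1) - β (n + 1) := by norm_num at hβ1'; linarith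
      positivity
    exact ⟨hpos.trans_le main, i1.le, hβ', hβ1', main⟩

theorem IsBarrier.nonneg {κ : ℝ} (hκ : 0 < κ) (hκ1 : κ ≤ 1 / 1000) {Z β : ℕ → ℝ}
    (hβ : IsBarrier κ Z β) (h0 : 0 ≤ β 0) (n : ℕ) : 0 ≤ β n := by
  induction n with
  | zero => exact h0
  | succ n ih =>
    rw [hβ n]
    have : 0 ≤ 1 - κ / 5 := by linarith
    positivity

theorem IsBarrier.sum_le {κ : ℝ} (hκ : 0 < κ) (hκ1 : κ ≤ 1 / 1000) {Z β : ℕ → ℝ}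
    (hβ : IsBarrier κ Z β) (h0 : 0 ≤ β 0) (n : ℕ) :
    ∑ i ∈ Finset.range n, β i ≤ 5 / κ * β 0 + 20 * ∑ i ∈ Finset.range n, |Z i| := by
  have key : κ / 5 * ∑ i ∈ Finset.range n, β i =
      β 0 - β n + 4 * κ * ∑ i ∈ Finset.range n, |Z i| := by
    induction n with
    | zero => simp
    | succ n ih =>
      rw [Finset.sum_range_succ, Finset.sum_range_succ, mul_add, ih, hβ n]
      ring
  have hn := hβ.nonneg hκ hκ1 h0 n
  have : ∑ i ∈ Finset.range n, β i = 5 / κ * (κ / 5 * ∑ i ∈ Finset.range n, β i) := by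
    field_simp
  rw [this, key]
  have h5 : 0 < 5 / κ := by positivity
  have : 5 / κ * (β 0 - β n + 4 * κ * ∑ i ∈ Finset.range n, |Z i|) =
    5 / κ * β 0 - 5 / κ * β n + 20 * ∑ i ∈ Finset.range n, |Z i| := by field_simp; ring
  rw [this]
  have : 0 ≤ 5 / κ * β n := by positivity
  linarith

theorem IsBarrier.le_end {κ : ℝ} (hκ : 0 < κ) (hκ1 : κ ≤ 1 / 1000) {Z β : ℕ → ℝ}
    (hβ : IsBarrier κ Z β) {L : ℕ} (good : ∀ n ≤ L, |Z n| ≤ κ / 100) :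
    β L ≤ (1 - κ / 5) ^ L * β 0 + κ / 5 := by
  induction L with
  | zero => simp; positivity
  | succ n ih =>
    have i := ih (fun m hm => good m (by omega))
    have g := good n (by omega)
    rw [hβ n, pow_succ]
    have : 0 ≤ 1 - κ / 5 := by linarith
    nlinarith [mul_le_mul_of_nonneg_left i this, mul_le_mul_of_nonneg_left g hκ.le]

theorem log_one_add_ge {s : ℝ} (hs : |s| ≤ 1 / 2) : -(2 * |s|) ≤ Real.log (1 + s) := by
  obtain ⟨h1, h2⟩ := abs_le.1 hs
  have hp : 0 < 1 + s := by linarith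
  have h := Real.one_sub_inv_le_log_of_pos hp
  have : -(2 * |s|) ≤ 1 - (1 + s)⁻¹ := by
    have e : 1 - (1 + s)⁻¹ = s / (1 + s) := by field_simp; ring
    rw [e, le_div_iff₀ hp]
    rcases abs_cases s with ⟨h, _⟩ | ⟨h, _⟩ <;> rw [h] <;> nlinarith
  linarith

/-- Logarithmic growth of a solution staying above the barrier. -/
theorem growth_lower {κ : ℝ} (hκ : 0 < κ) (hκ1 : κ ≤ 1 / 1000) {f u Z β : ℕ → ℝ}
    (hu : IsSol κ f u) (hZ : IsFilt κ f Z) (hβ : IsBarrier κ Z β) {L : ℕ}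
    (good : ∀ n ≤ L, |Z n| ≤ κ / 100) (h0 : 0 ≤ β 0) (h01 : β 0 ≤ 1.72 * κ)
    (hu1 : 0 < u 1) (hu0 : 0 ≤ u 0) (hb : Real.exp κ * u 0 * (1 + Z 0 - β 0) ≤ u 1) :
    Real.log (u 1) + κ * L - 18 - 42 * ∑ i ∈ Finset.range (L + 1), |Z i| ≤
      Real.log (u (L + 1)) := by
  have inv := barrier_invariant hκ hκ1 hu hZ hβ good h0 h01 hu1 hu0 hb
  have key : ∀ m ≤ L, Real.log (u 1) + κ * m -
      2 * ∑ i ∈ Finset.range m, (|Z (i + 1)| + β (i + 1)) ≤ Real.log (u (m + 1)) := by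
    intro m
    induction m with
    | zero => intro _; simp
    | succ m ih =>
      intro hm
      have i := ih (by omega)
      obtain ⟨a1, a2, a3, a4, a5⟩ := inv (m + 1) hm
      obtain ⟨b1, -⟩ := inv m (by omega)
      have g := good (m + 1) hm
      have hs : |Z (m + 1) - β (m + 1)| ≤ |Z (m + 1)| + β (m + 1) := by
        refine (abs_sub _ _).trans ?_
        rw [abs_of_nonneg a3]
      have hs2 : |Z (m + 1) - β (m + 1)| ≤ 1 / 2 := by
        norm_num at a4
        linarith
      have hl := log_one_add_ge hs2
      have hp : 0 < 1 + (Z (m + 1) - β (m + 1)) := by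
        have := (abs_le.1 hs2).1
        linarith
      have : Real.log (Real.exp κ * u (m + 1) * (1 + (Z (m + 1) - β (m + 1)))) ≤
          Real.log (u (m + 1 + 1)) := by
        apply Real.log_le_log (by positivity)
        rw [← add_sub_assoc]; exact a5
      rw [Real.log_mul (by positivity) hp.ne', Real.log_mul (by positivity) b1.ne',
        Real.log_exp] at this
      rw [Finset.sum_range_succ]
      push_cast
      nlinarith
  have k := key L le_rfl
  have s1 : ∑ i ∈ Finset.range L, |Z (i + 1)| ≤ ∑ i ∈ Finset.range (L + 1), |Z i| := by
    rw [Finset.sum_range_succ']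
    linarith [abs_nonneg (Z 0)]
  have s2 : ∑ i ∈ Finset.range L, β (i + 1) ≤ ∑ i ∈ Finset.range (L + 1), β i := by
    rw [Finset.sum_range_succ']
    linarith
  have s3 := hβ.sum_le hκ hκ1 h0 (L + 1)
  have s4 : 5 / κ * β 0 ≤ 8.6 := by
    rw [div_mul_eq_mul_div, div_le_iff₀ hκ]
    norm_num at h01 ⊢
    linarith
  rw [Finset.sum_add_distrib] at k
  norm_num at s4
  linarith

/-- Upper bound for the growth of a solution starting below the linearized trajectory. -/
theorem growth_upper {κ : ℝ} (hκ : 0 < κ) (hκ1 : κ ≤ 1 / 1000) {f u Z β : ℕ → ℝ}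
    (hu : IsSol κ f u) (hZ : IsFilt κ f Z) (hβ : IsBarrier κ Z β) {L : ℕ}
    (good : ∀ n ≤ L, |Z n| ≤ κ / 100) (h0 : 0 ≤ β 0) (h01 : β 0 ≤ 1.72 * κ)
    (hu1 : 0 < u 1) (hu0 : 0 < u 0) (hb : Real.exp κ * u 0 * (1 + Z 0 - β 0) ≤ u 1)
    {b : ℝ} (hbu : u 1 ≤ Real.exp κ * u 0 * (1 + Z 0 + b)) :
    0 < u (L + 1) ∧ u (L + 1) ≤ u 0 * Real.exp (κ * (L + 1) + ∑ i ∈ Finset.range (L + 1), |Z i| +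
      ∑ i ∈ Finset.range (L + 1), Real.exp (-2 * κ) ^ i * b) := by
  have inv := barrier_invariant hκ hκ1 hu hZ hβ good h0 h01 hu1 hu0.le hb
  set q := Real.exp (-2 * κ) with hq
  have hq0 : 0 < q := Real.exp_pos _
  have hpos := Real.exp_pos κ
  have upos : ∀ m ≤ L, 0 < u m := by
    intro m hm
    rcases m with _ | m
    · exact hu0
    · exact (inv m (by omega)).1
  have step : ∀ m ≤ L, u (m + 1) ≤ Real.exp κ * u m * (1 + Z m + q ^ m * b) := by
    intro m
    induction m with
    | zero => intro _; simpa using hbu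
    | succ m ih =>
      intro hm
      have i := ih (by omega)
      have x0 := upos (m + 1) hm
      have z0 := upos m (by omega)
      have e3 := exp_mul_exp_neg_two κ
      have e4 : Real.exp κ * Real.exp (-κ) = 1 := by rw [← Real.exp_add]; simp
      have hpos' := Real.exp_pos (-κ)
      set c := Z m + q ^ m * b with hc
      have h1 : u (m + 1) * (1 - c) ≤ Real.exp κ * u m := by
        by_cases h : 0 ≤ 1 - c
        · have := mul_le_mul_of_nonneg_right i h
          have h2 : 0 ≤ Real.exp κ * u m * c ^ 2 := by positivity
          rw [add_assoc, ← hc] at this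
          nlinarith
        · have : u (m + 1) * (1 - c) ≤ 0 := by nlinarith
          have : 0 ≤ Real.exp κ * u m := by positivity
          linarith
      have h2 : Real.exp (-κ) * (u (m + 1) * (1 - c)) ≤ u m := by
        calc _ ≤ Real.exp (-κ) * (Real.exp κ * u m) := mul_le_mul_of_nonneg_left h1 hpos'.le
          _ = (Real.exp κ * Real.exp (-κ)) * u m := by ring
          _ = u m := by rw [e4, one_mul]
      rw [hu m, hZ m, pow_succ]
      have : Real.exp κ * u (m + 1) * (1 + (q * Z m - f m) + q ^ m * q * b) =
        Real.exp κ * u (m + 1) * (1 - f m) + (Real.exp κ * q) * u (m + 1) * c := by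
        rw [hc]; ring
      rw [← hq, this, e3]
      nlinarith
  have key : ∀ m ≤ L + 1, u m ≤ u 0 * Real.exp (κ * m + ∑ i ∈ Finset.range m, |Z i| +
      ∑ i ∈ Finset.range m, q ^ i * b) := by
    intro m
    induction m with
    | zero => intro _; simp
    | succ m ih =>
      intro hm
      have i := ih (by omega)
      have s := step m (by omega)
      have z0 := upos m (by omega)
      rw [Finset.sum_range_succ, Finset.sum_range_succ]
      have e : κ * ((m + 1 : ℕ) : ℝ) + (∑ i ∈ Finset.range m, |Z i| + |Z m|) +
        (∑ i ∈ Finset.range m, q ^ i * b + q ^ m * b) =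
        (κ * m + ∑ i ∈ Finset.range m, |Z i| + ∑ i ∈ Finset.range m, q ^ i * b) +
        (κ + (|Z m| + q ^ m * b)) := by push_cast; ring
      rw [e, Real.exp_add, ← mul_assoc, Real.exp_add κ]
      have h1 : 1 + Z m + q ^ m * b ≤ Real.exp (|Z m| + q ^ m * b) := by
        have := Real.add_one_le_exp (|Z m| + q ^ m * b)
        linarith [le_abs_self (Z m)]
      calc u (m + 1) ≤ Real.exp κ * u m * (1 + Z m + q ^ m * b) := s
        _ ≤ Real.exp κ * u m * Real.exp (|Z m| + q ^ m * b) :=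
          mul_le_mul_of_nonneg_left h1 (by positivity)
        _ = u m * (Real.exp κ * Real.exp (|Z m| + q ^ m * b)) := by ring
        _ ≤ _ := mul_le_mul_of_nonneg_right i (by positivity)
  refine ⟨(inv L le_rfl).1, ?_⟩
  have := key (L + 1) le_rfl
  push_cast at this
  exact this

/-- The barrier with prescribed initial value. -/
def barrierSeq (κ : ℝ) (Z : ℕ → ℝ) (b : ℝ) : ℕ → ℝ
  | 0 => b
  | n + 1 => (1 - κ / 5) * barrierSeq κ Z b n + 4 * κ * |Z n|

theorem isBarrier_barrierSeq (κ : ℝ) (Z : ℕ → ℝ) (b : ℝ) : IsBarrier κ Z (barrierSeq κ Z b) :=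
  fun _ => rfl

/-- The expanding cone of directions whose Riccati coordinate is at least `-b κ`. -/
def InCone (κ b x z : ℝ) : Prop :=
  Real.exp κ * (1 - b * κ) * z ^ 2 ≤ x * z ∧ ¬(x = 0 ∧ z = 0)

theorem InCone.neg {κ b x z : ℝ} (h : InCone κ b x z) : InCone κ b (-x) (-z) := by
  refine ⟨?_, fun h' => h.2 ⟨by linarith [h'.1], by linarith [h'.2]⟩⟩
  have := h.1
  nlinarith

theorem inCone_of_pos {κ b x z : ℝ} (hx : 0 < x) (hz : 0 ≤ z)
    (h : Real.exp κ * (1 - b * κ) * z ≤ x) : InCone κ b x z := by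
  refine ⟨?_, fun h' => hx.ne' h'.1⟩
  have := mul_le_mul_of_nonneg_right h hz
  nlinarith

theorem InCone.cases {κ b x z : ℝ} (hb : b * κ < 1) (h : InCone κ b x z) :
    (0 < x ∧ 0 ≤ z ∧ Real.exp κ * (1 - b * κ) * z ≤ x) ∨
    (0 < -x ∧ 0 ≤ -z ∧ Real.exp κ * (1 - b * κ) * (-z) ≤ -x) := by
  have hp := Real.exp_pos κ
  have hc : 0 < Real.exp κ * (1 - b * κ) := mul_pos hp (by linarith)
  set c := Real.exp κ * (1 - b * κ)
  obtain ⟨h1, h2⟩ := h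
  change c * z ^ 2 ≤ x * z at h1
  rcases lt_trichotomy z 0 with hz | hz | hz
  · right
    have : c * (-z) ≤ -x := by nlinarith
    exact ⟨by nlinarith [mul_pos hc (neg_pos.2 hz)], by linarith, this⟩
  · subst hz
    rcases lt_trichotomy x 0 with hx | hx | hx
    · right; simp [hx, hx.le]
    · exact absurd ⟨hx, rfl⟩ h2
    · left; simp [hx, hx.le]
  · left
    have : c * z ≤ x := by nlinarith
    exact ⟨by nlinarith [mul_pos hc hz], hz.le, this⟩

theorem cone_end_of_pos {κ : ℝ} (hκ : 0 < κ) (hκ1 : κ ≤ 1 / 1000) {f u Z : ℕ → ℝ}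
    (hu : IsSol κ f u) (hZ : IsFilt κ f Z) {L : ℕ}
    (good : ∀ n ≤ L, |Z n| ≤ κ / 100) (hL : (1 - κ / 5) ^ L ≤ 1 / 2) {b : ℝ} (hb1 : 1 / 2 ≤ b)
    (hb2 : b ≤ 1.7)
    (hu1 : 0 < u 1) (hu0 : 0 ≤ u 0) (hb : Real.exp κ * (1 - b * κ) * u 0 ≤ u 1) :
    0 < u (L + 1) ∧ 0 ≤ u L ∧ Real.exp κ * (1 - 1.5 * κ) * u L ≤ u (L + 1) ∧
    Real.log (u 1) + κ * L - 18 - 42 * ∑ i ∈ Finset.range (L + 1), |Z i| ≤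
      Real.log (u (L + 1)) := by
  have g0 := abs_le.1 (good 0 (by omega))
  norm_num at hb2
  set β := barrierSeq κ Z (b * κ + Z 0) with hβd
  have hβ : IsBarrier κ Z β := isBarrier_barrierSeq _ _ _
  have e0 : β 0 = b * κ + Z 0 := rfl
  have h0 : 0 ≤ β 0 := by rw [e0]; nlinarith [g0.1]
  have h01 : β 0 ≤ 1.72 * κ := by rw [e0]; norm_num; nlinarith [g0.2]
  have hb' : Real.exp κ * u 0 * (1 + Z 0 - β 0) ≤ u 1 := by
    rw [e0]
    calc _ = Real.exp κ * (1 - b * κ) * u 0 := by ring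
      _ ≤ _ := hb
  have inv := barrier_invariant hκ hκ1 hu hZ hβ good h0 h01 hu1 hu0 hb'
  obtain ⟨a1, a2, a3, a4, a5⟩ := inv L le_rfl
  have gr := growth_lower hκ hκ1 hu hZ hβ good h0 h01 hu1 hu0 hb'
  refine ⟨a1, a2, le_trans ?_ a5, gr⟩
  have hend := hβ.le_end hκ hκ1 good
  have gL := (abs_le.1 (good L le_rfl)).1
  have : (1 - κ / 5) ^ L * β 0 ≤ 1 / 2 * (1.72 * κ) := by
    apply mul_le_mul hL h01 h0 (by norm_num)
  have h2 : 1 - 1.5 * κ ≤ 1 + Z L - β L := by norm_num at this ⊢; linarith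
  have hp := Real.exp_pos κ
  calc Real.exp κ * (1 - 1.5 * κ) * u L = Real.exp κ * u L * (1 - 1.5 * κ) := by ring
    _ ≤ _ := mul_le_mul_of_nonneg_left h2 (by positivity)

theorem cone_end {κ : ℝ} (hκ : 0 < κ) (hκ1 : κ ≤ 1 / 1000) {f u Z : ℕ → ℝ}
    (hu : IsSol κ f u) (hZ : IsFilt κ f Z) {L : ℕ}
    (good : ∀ n ≤ L, |Z n| ≤ κ / 100) (hL : (1 - κ / 5) ^ L ≤ 1 / 2) {b : ℝ} (hb1 : 1 / 2 ≤ b)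
    (hb2 : b ≤ 1.7) (hc : InCone κ b (u 1) (u 0)) :
    InCone κ 1.5 (u (L + 1)) (u L) ∧
    Real.log (|u 1| + |u 0|) + κ * L - 20 - 42 * ∑ i ∈ Finset.range (L + 1), |Z i| ≤
      Real.log (|u (L + 1)| + |u L|) := by
  wlog hpos : 0 < u 1 ∧ 0 ≤ u 0 ∧ Real.exp κ * (1 - b * κ) * u 0 ≤ u 1 generalizing u
  · have hbκ : b * κ < 1 := by norm_num at hb2; nlinarith
    rcases hc.cases hbκ with h | h
    · exact absurd h hpos
    · have := this hu.neg hc.neg h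
      simp only [abs_neg] at this
      refine ⟨?_, this.2⟩
      simpa using this.1.neg
  obtain ⟨h1, h0, hb⟩ := hpos
  obtain ⟨a1, a2, a3, a4⟩ := cone_end_of_pos hκ hκ1 hu hZ good hL hb1 hb2 h1 h0 hb
  refine ⟨inCone_of_pos a1 a2 a3, ?_⟩
  rw [abs_of_pos h1, abs_of_nonneg h0, abs_of_pos a1, abs_of_nonneg a2]
  have e1 : Real.log (u (L + 1)) ≤ Real.log (u (L + 1) + u L) :=
    Real.log_le_log a1 (by linarith)
  have e2 : Real.log (u 1 + u 0) ≤ 2 + Real.log (u 1) := by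
    have hexp : 1 ≤ Real.exp κ := Real.one_le_exp hκ.le
    have h9 : 0.99 ≤ 1 - b * κ := by norm_num at hb2 ⊢; nlinarith
    have h8 : 0.99 * u 0 ≤ u 1 := by
      refine le_trans (mul_le_mul_of_nonneg_right ?_ h0) hb
      nlinarith
    have : u 1 + u 0 ≤ Real.exp 2 * u 1 := by
      have := Real.add_one_le_exp (2 : ℝ)
      norm_num at h8
      nlinarith
    calc Real.log (u 1 + u 0) ≤ Real.log (Real.exp 2 * u 1) :=
          Real.log_le_log (by linarith) this
      _ = _ := by rw [Real.log_mul (by positivity) h1.ne', Real.log_exp]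
  linarith

/-- The solution of `u (n+2) = e n * u (n+1) - u n` with `u 0 = z`, `u 1 = x`. -/
def solSeq (e : ℕ → ℝ) (x z : ℝ) : ℕ → ℝ
  | 0 => z
  | 1 => x
  | n + 2 => e n * solSeq e x z (n + 1) - solSeq e x z n

/-- The energy sequence attached to the noise `f`. -/
def energy (κ : ℝ) (f : ℕ → ℝ) (n : ℕ) : ℝ :=
  Real.exp κ + Real.exp (-κ) - Real.exp κ * f n

theorem isSol_solSeq (κ : ℝ) (f : ℕ → ℝ) (x z : ℝ) : IsSol κ f (solSeq (energy κ f) x z) :=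
  fun _ => rfl

theorem IsSol.ext {κ : ℝ} {f u v : ℕ → ℝ} (hu : IsSol κ f u) (hv : IsSol κ f v)
    (h0 : u 0 = v 0) (h1 : u 1 = v 1) (n : ℕ) : u n = v n := by
  have : u n = v n ∧ u (n + 1) = v (n + 1) := by
    induction n with
    | zero => exact ⟨h0, h1⟩
    | succ n ih => exact ⟨ih.2, by rw [hu n, hv n, ih.1, ih.2]⟩
  exact this.1

theorem exp_neg_two_le {κ : ℝ} (hκ : 0 < κ) (hκ1 : κ ≤ 1 / 1000) :
    Real.exp (-2 * κ) ≤ 1 - κ := by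
  have h : 1 + 2 * κ ≤ Real.exp (2 * κ) := by linarith [Real.add_one_le_exp (2 * κ)]
  have e : Real.exp (-2 * κ) * Real.exp (2 * κ) = 1 := by rw [← Real.exp_add]; simp
  have hp := Real.exp_pos (-2 * κ)
  have : Real.exp (-2 * κ) * (1 + 2 * κ) ≤ 1 := by
    exact (mul_le_mul_of_nonneg_left h hp.le).trans_eq e
  nlinarith

theorem sum_exp_le {κ : ℝ} (hκ : 0 < κ) (hκ1 : κ ≤ 1 / 1000) (n : ℕ) :
    ∑ i ∈ Finset.range n, Real.exp (-2 * κ) ^ i * κ ≤ 1 := by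
  have hq := exp_neg_two_le hκ hκ1
  have hp := Real.exp_pos (-2 * κ)
  set q := Real.exp (-2 * κ)
  have h := geom_sum_mul_neg q n
  have h0 : 0 ≤ ∑ i ∈ Finset.range n, q ^ i := Finset.sum_nonneg fun i _ => by positivity
  have hqn : 0 ≤ q ^ n := by positivity
  rw [← Finset.sum_mul]
  calc _ ≤ (∑ i ∈ Finset.range n, q ^ i) * (1 - q) :=
        mul_le_mul_of_nonneg_left (by linarith) h0
    _ ≤ 1 := by rw [h]; linarith

/-- On a good block every solution grows at most at rate `κ`, up to a factor `C / κ`. -/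
theorem block_upper {κ : ℝ} (hκ : 0 < κ) (hκ1 : κ ≤ 1 / 1000) {f u Z : ℕ → ℝ}
    (hu : IsSol κ f u) (hZ : IsFilt κ f Z) (hZ0 : Z 0 = 0) {L : ℕ}
    (good : ∀ n ≤ L, |Z n| ≤ κ / 100) (hL : (1 - κ / 5) ^ L ≤ 1 / 2) :
    |u (L + 1)| + |u L| ≤ (|u 1| + |u 0|) / κ *
      Real.exp (κ * L + ∑ i ∈ Finset.range (L + 1), |Z i| + 5) := by
  have hexp : 1 ≤ Real.exp κ := Real.one_le_exp hκ.le
  have hp := Real.exp_pos κ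
  set S := ∑ i ∈ Finset.range (L + 1), |Z i| with hS
  set v : ℝ → ℕ → ℝ := fun b => solSeq (energy κ f) (Real.exp κ * (1 + b)) 1 with hv
  have bound : ∀ b, 0 ≤ b → b ≤ κ → |v b (L + 1)| + |v b L| ≤
      3 * Real.exp (κ * (L + 1) + S + 1) := by
    intro b hb hb1
    have hsol : IsSol κ f (v b) := isSol_solSeq _ _ _ _
    have h0 : v b 0 = 1 := rfl
    have h1 : v b 1 = Real.exp κ * (1 + b) := rfl
    have hβ : IsBarrier κ Z (barrierSeq κ Z 0) := isBarrier_barrierSeq _ _ _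
    have hβ0 : barrierSeq κ Z 0 0 = 0 := rfl
    have up := growth_upper hκ hκ1 hsol hZ hβ good (by rw [hβ0]) (by rw [hβ0]; positivity)
      (by rw [h1]; positivity) (by rw [h0]; norm_num)
      (by rw [h0, h1, hZ0, hβ0]; nlinarith) (b := b) (by rw [h0, h1, hZ0]; nlinarith)
    have lo := cone_end_of_pos hκ hκ1 hsol hZ good hL (b := 1.5) (by norm_num) (by norm_num)
      (by rw [h1]; positivity) (by rw [h0]; norm_num) (by
        rw [h0, h1, mul_one]
        apply mul_le_mul_of_nonneg_left _ hp.le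
        norm_num; linarith)
    obtain ⟨a1, a2, a3, -⟩ := lo
    have hle : v b L ≤ 2 * v b (L + 1) := by
      have h9 : 1 / 2 ≤ Real.exp κ * (1 - 1.5 * κ) := by norm_num; nlinarith
      nlinarith
    rw [abs_of_pos a1, abs_of_nonneg a2]
    have hsum : ∑ i ∈ Finset.range (L + 1), Real.exp (-2 * κ) ^ i * b ≤ 1 := by
      refine le_trans (Finset.sum_le_sum fun i _ => ?_) (sum_exp_le hκ hκ1 (L + 1))
      exact mul_le_mul_of_nonneg_left hb1 (by positivity)
    have : v b (L + 1) ≤ Real.exp (κ * (L + 1) + S + 1) := by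
      refine up.2.trans ?_
      rw [h0, one_mul]
      exact Real.exp_le_exp.2 (by linarith)
    linarith
  set c2 := (u 1 - Real.exp κ * u 0) / (Real.exp κ * κ) with hc2
  set c1 := u 0 - c2 with hc1
  have lin : ∀ n, u n = c1 * v 0 n + c2 * v κ n := by
    apply hu.ext
    · intro n
      have e1 : v 0 (n + 2) = _ := isSol_solSeq κ f _ _ n
      have e2 : v κ (n + 2) = _ := isSol_solSeq κ f _ _ n
      simp only [e1, e2]
      ring
    · change u 0 = c1 * 1 + c2 * 1
      rw [hc1]; ring
    · change u 1 = c1 * (Real.exp κ * (1 + 0)) + c2 * (Real.exp κ * (1 + κ))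
      have : c2 * (Real.exp κ * κ) = u 1 - Real.exp κ * u 0 := by
        rw [hc2]; field_simp
      rw [hc1]
      linear_combination -this
  have s0 : 0 ≤ (|u 1| + |u 0|) / κ := by positivity
  have hc2b : |c2| ≤ (|u 1| + |u 0|) / κ := by
    rw [hc2, abs_div, abs_of_pos (by positivity : 0 < Real.exp κ * κ), div_le_div_iff₀
      (by positivity) hκ]
    have : |u 1 - Real.exp κ * u 0| ≤ |u 1| + Real.exp κ * |u 0| := by
      refine (abs_sub _ _).trans ?_
      rw [abs_mul, abs_of_pos hp]
    have h3 : |u 1| ≤ Real.exp κ * |u 1| := le_mul_of_one_le_left (abs_nonneg _) hexp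
    nlinarith
  have hc1b : |c1| ≤ 2 * ((|u 1| + |u 0|) / κ) := by
    have : |c1| ≤ |u 0| + |c2| := abs_sub _ _
    have h3 : |u 0| ≤ (|u 1| + |u 0|) / κ := by
      rw [le_div_iff₀ hκ]
      nlinarith [abs_nonneg (u 1), abs_nonneg (u 0)]
    linarith
  have b0 := bound 0 le_rfl hκ.le
  have b1 := bound κ hκ.le le_rfl
  have t : ∀ n, |u n| ≤ |c1| * |v 0 n| + |c2| * |v κ n| := by
    intro n
    rw [lin n]
    refine (abs_add_le _ _).trans ?_
    rw [abs_mul, abs_mul]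
  set E := Real.exp (κ * (L + 1) + S + 1) with hE
  have hE0 : 0 < E := Real.exp_pos _
  set R := (|u 1| + |u 0|) / κ with hR
  have h9 : |u (L + 1)| + |u L| ≤ 9 * R * E := by
    have t1 := t (L + 1)
    have t2 := t L
    have m1 : |c1| * (|v 0 (L + 1)| + |v 0 L|) ≤ 2 * R * (3 * E) :=
      mul_le_mul hc1b b0 (by positivity) (by positivity)
    have m2 : |c2| * (|v κ (L + 1)| + |v κ L|) ≤ R * (3 * E) :=
      mul_le_mul hc2b b1 (by positivity) (by positivity)
    linarith
  refine h9.trans ?_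
  have : κ * L + S + 5 = (κ * (L + 1) + S + 1) + (4 - κ) := by ring
  rw [this, Real.exp_add, ← hE]
  have : 9 ≤ Real.exp (4 - κ) := by
    have h1 : Real.exp (3 : ℝ) ≤ Real.exp (4 - κ) := Real.exp_le_exp.2 (by linarith)
    have h2 : Real.exp (3 : ℝ) = Real.exp 1 ^ 3 := by rw [← Real.exp_nat_mul]; norm_num
    have h3 := Real.exp_one_gt_d9
    have h4 : (2.7 : ℝ) ^ 3 ≤ Real.exp 1 ^ 3 := by gcongr; linarith
    norm_num at h4
    linarith
  calc 9 * R * E = R * E * 9 := by ring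
    _ ≤ R * E * Real.exp (4 - κ) := by gcongr
    _ = _ := by ring

theorem IsSol.ne_zero {κ : ℝ} {f u : ℕ → ℝ} (hu : IsSol κ f u)
    (h : ¬(u 1 = 0 ∧ u 0 = 0)) (n : ℕ) : ¬(u (n + 1) = 0 ∧ u n = 0) := by
  induction n with
  | zero => exact h
  | succ n ih =>
    rintro ⟨h1, h2⟩
    apply ih
    refine ⟨h2, ?_⟩
    have := hu n
    rw [h1, h2] at this
    linarith

/-- The Riccati coordinate. -/
def ric (κ : ℝ) (u : ℕ → ℝ) (n : ℕ) : ℝ := u (n + 1) / (Real.exp κ * u n) - 1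

/-- A solution that fails to enter the expanding cone by the end of a good block stays in
the contracting direction during the first half of the block. -/
theorem ric_of_not_inCone {κ : ℝ} (hκ : 0 < κ) (hκ1 : κ ≤ 1 / 1000) {f u Z : ℕ → ℝ}
    (hu : IsSol κ f u) (hne : ¬(u 1 = 0 ∧ u 0 = 0)) (hZ : IsFilt κ f Z) {L M : ℕ}
    (good : ∀ n ≤ L, |Z n| ≤ κ / 100) (hM : M ≤ L) (hL : (1 - κ / 5) ^ (L - M) ≤ 1 / 2)
    (hend : ¬InCone κ 1.5 (u (L + 1)) (u L)) :
    ∀ n, n + 1 ≤ M → u n ≠ 0 ∧ u (n + 1) ≠ 0 ∧ -1 < ric κ u n ∧ ric κ u n < -(1.7 * κ) ∧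
      ric κ u (n + 1) = Real.exp (-2 * κ) * ric κ u n / (1 + ric κ u n) - f n := by
  have hp := Real.exp_pos κ
  have hp' := Real.exp_pos (-κ)
  have hexp : 1 ≤ Real.exp κ := Real.one_le_exp hκ.le
  have nc : ∀ n ≤ M, ¬InCone κ 1.7 (u (n + 1)) (u n) := by
    intro n hn hc
    apply hend
    have hLn : (1 - κ / 5) ^ (L - n) ≤ 1 / 2 :=
      (pow_le_pow_of_le_one (by linarith) (by linarith) (by omega)).trans hL
    have := (cone_end (b := 1.7) hκ hκ1 (hu.shift n) (hZ.shift n) (L := L - n)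
      (fun m hm => good (n + m) (by omega)) hLn (by norm_num) le_rfl hc).1
    have e : n + (L - n) = L := by omega
    have e' : n + (L - n + 1) = L + 1 := by omega
    simpa only [e, e'] using this
  intro n hn
  have n1 := nc n (by omega)
  have n2 := nc (n + 1) hn
  have z1 := hu.ne_zero hne n
  have z2 := hu.ne_zero hne (n + 1)
  have l1 : u (n + 1) * u n < Real.exp κ * (1 - 1.7 * κ) * u n ^ 2 := by
    by_contra h; exact n1 ⟨not_lt.1 h, z1⟩
  have l2 : u (n + 1 + 1) * u (n + 1) < Real.exp κ * (1 - 1.7 * κ) * u (n + 1) ^ 2 := by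
    by_contra h; exact n2 ⟨not_lt.1 h, z2⟩
  have k1 : u n ≠ 0 := by rintro h; simp [h] at l1
  have k2 : u (n + 1) ≠ 0 := by rintro h; simp [h] at l2
  have hun := hu n
  have hf : |f n| ≤ κ / 50 := by
    have e : f n = Real.exp (-2 * κ) * Z n - Z (n + 1) := by rw [hZ n]; ring
    have g1 := good n (by omega)
    have g2 := good (n + 1) (by omega)
    have q1 : Real.exp (-2 * κ) ≤ 1 := Real.exp_le_one_iff.2 (by linarith)
    have q0 := Real.exp_pos (-2 * κ)
    rw [e]
    refine (abs_sub _ _).trans ?_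
    rw [abs_mul, abs_of_pos q0]
    nlinarith [abs_nonneg (Z n)]
  have hpos : 0 < u (n + 1) * u n := by
    by_contra hneg
    rw [not_lt] at hneg
    have : u (n + 1 + 1) * u (n + 1) = (Real.exp κ + Real.exp (-κ) - Real.exp κ * f n) *
      u (n + 1) ^ 2 - u (n + 1) * u n := by
      rw [show n + 1 + 1 = n + 2 from rfl, hun]; ring
    rw [this] at l2
    have hsq : 0 ≤ u (n + 1) ^ 2 := sq_nonneg _
    have : 0 ≤ Real.exp κ * (1.7 * κ - f n) := by
      have := le_abs_self (f n)
      apply mul_nonneg hp.le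
      norm_num; linarith
    nlinarith [mul_nonneg this hsq, mul_nonneg hp'.le hsq]
  have hsqn : 0 < u n ^ 2 := by positivity
  have er : 1 + ric κ u n = u (n + 1) / (Real.exp κ * u n) := by rw [ric]; ring
  have er2 : 1 + ric κ u n = u (n + 1) * u n / (Real.exp κ * u n ^ 2) := by
    rw [er]; field_simp
  have rpos : 0 < 1 + ric κ u n := by rw [er2]; positivity
  refine ⟨k1, k2, by linarith, ?_, ?_⟩
  · have : 1 + ric κ u n < 1 - 1.7 * κ := by
      rw [er2, div_lt_iff₀ (by positivity)]
      calc _ < _ := l1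
        _ = _ := by ring
    linarith
  · have : Real.exp (-2 * κ) * ric κ u n / (1 + ric κ u n) =
      Real.exp (-2 * κ) - Real.exp (-2 * κ) / (1 + ric κ u n) := by
      field_simp; ring
    rw [this, er]
    have e5 : Real.exp (-2 * κ) / (u (n + 1) / (Real.exp κ * u n)) =
      Real.exp (-κ) * u n / u (n + 1) := by
      rw [← exp_mul_exp_neg_two κ]; field_simp
    have e6 : Real.exp (-2 * κ) = Real.exp (-κ) / Real.exp κ := by
      rw [← exp_mul_exp_neg_two κ]; field_simp
    have e7 : Real.exp (-κ) = 1 / Real.exp κ := by rw [Real.exp_neg]; simp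
    rw [e5, e6, ric, show n + 1 + 1 = n + 2 from rfl, hun, e7]
    field_simp
    ring

/-- A trajectory staying in the contracting region cannot drop far below the fixed point. -/
theorem ric_ge {κ : ℝ} (hκ : 0 < κ) (hκ1 : κ ≤ 1 / 1000) {f y Z : ℕ → ℝ}
    (hZ : IsFilt κ f Z) {h : ℕ} (good : ∀ n ≤ 2 * h, |Z n| ≤ κ / 100)
    (hy : ∀ n ≤ 2 * h, -1 < y n ∧ y n < -(1.7 * κ))
    (hrec : ∀ n < 2 * h, y (n + 1) = Real.exp (-2 * κ) * y n / (1 + y n) - f n)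
    (hexp : 1.1 < (1 + 0.3 * κ) ^ h * (2.4 * κ)) :
    ∀ n ≤ h, -(2.5 * κ) ≤ y n := by
  intro n hn
  by_contra hlt
  rw [not_le] at hlt
  have q1 := Real.add_one_le_exp (-2 * κ)
  have q2 := exp_neg_two_le hκ hκ1
  have claim : ∀ k ≤ h, (1 + 0.3 * κ) ^ k * (2.4 * κ) ≤ Z (n + k) - y (n + k) := by
    intro k
    induction k with
    | zero =>
      intro _
      have := (abs_le.1 (good n (by omega))).1
      norm_num at hlt ⊢
      linarith
    | succ k ih =>
      intro hk
      have i := ih (by omega)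
      have g := abs_le.1 (good (n + k) (by omega))
      have hyk := hy (n + k) (by omega)
      have hr := hrec (n + k) (by omega)
      have hz := hZ (n + k)
      rw [show n + (k + 1) = n + k + 1 from rfl, hr, hz]
      set Y := -y (n + k) with hY
      have ey : y (n + k) = -Y := by rw [hY]; ring
      rw [ey] at i hyk ⊢
      set q := Real.exp (-2 * κ)
      set D := Z (n + k) - -Y with hD
      have h1 : (1 : ℝ) ≤ (1 + 0.3 * κ) ^ k := one_le_pow₀ (by norm_num; linarith)
      have hD0 : 2.4 * κ ≤ D := le_trans (by norm_num; nlinarith) i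
      have hY1 : Y < 1 := by linarith [hyk.1]
      have hY0 : 0.99 * D ≤ Y := by norm_num at hD0 ⊢; linarith [g.2]
      have hYp : 2.38 * κ ≤ Y := by norm_num at hD0 ⊢; linarith [g.2]
      have hYpos : 0 < Y := by norm_num at hYp; linarith
      have hfrac : Y + Y ^ 2 ≤ Y / (1 - Y) := by
        rw [le_div_iff₀ (by linarith)]
        nlinarith [pow_pos hYpos 3]
      have h2 : q * -Y / (1 + -Y) = -(q * (Y / (1 - Y))) := by
        rw [← sub_eq_add_neg]; ring
      rw [h2]
      have h3 : q * (Z (n + k) + (Y + Y ^ 2)) ≤ q * (Z (n + k) + Y / (1 - Y)) := by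
        apply mul_le_mul_of_nonneg_left _ (Real.exp_pos _).le
        linarith
      have h4 : (1 + 0.3 * κ) * D ≤ q * (Z (n + k) + (Y + Y ^ 2)) := by
        have hDpos : 0 < D := by norm_num at hD0; linarith
        have a1 : (1 + 2.35 * κ) * D ≤ Z (n + k) + (Y + Y ^ 2) := by
          have : 2.38 * κ * (0.99 * D) ≤ Y * Y :=
            mul_le_mul hYp hY0 (by positivity) hYpos.le
          norm_num at this ⊢
          nlinarith [mul_pos hκ hDpos]
        have a2 : (1 - 2 * κ) * ((1 + 2.35 * κ) * D) ≤ q * (Z (n + k) + (Y + Y ^ 2)) := by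
          apply mul_le_mul (by linarith) a1 (by positivity) (Real.exp_pos _).le
        refine le_trans ?_ a2
        norm_num
        nlinarith [mul_pos hκ hDpos, mul_nonneg (mul_pos hκ hDpos).le (sub_nonneg.2 hκ1)]
      rw [pow_succ]
      have h5 : (1 + 0.3 * κ) * ((1 + 0.3 * κ) ^ k * (2.4 * κ)) ≤ (1 + 0.3 * κ) * D :=
        mul_le_mul_of_nonneg_left i (by positivity)
      linarith
  have c := claim h le_rfl
  have g := abs_le.1 (good (n + h) (by omega))
  have hyk := hy (n + h) (by omega)
  norm_num at c hexp
  linarith [g.2, hyk.1]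

/-- Truncation to the interval `[-3κ, -3κ/2]`. -/
def clip (κ z : ℝ) : ℝ := max (-(3 * κ)) (min (-(1.5 * κ)) z)

/-- The inverse of the unperturbed Riccati map. -/
def psi (κ z : ℝ) : ℝ := z / (Real.exp (-2 * κ) - z)

/-- The backward Riccati iteration, which selects the contracting direction. -/
def yb (κ : ℝ) : ℕ → (ℕ → ℝ) → ℝ
  | 0, _ => -(2 * κ)
  | k + 1, f => psi κ (clip κ (yb κ k (fun n => f (n + 1)) + f 0))

theorem clip_mem {κ : ℝ} (hκ : 0 < κ) (z : ℝ) : -(3 * κ) ≤ clip κ z ∧ clip κ z ≤ -(1.5 * κ) := by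
  refine ⟨le_max_left _ _, max_le (by norm_num; linarith) (min_le_left _ _)⟩

theorem clip_of_mem {κ z : ℝ} (h1 : -(3 * κ) ≤ z) (h2 : z ≤ -(1.5 * κ)) : clip κ z = z := by
  rw [clip, min_eq_right h2, max_eq_right h1]

theorem clip_lip (κ z z' : ℝ) : |clip κ z - clip κ z'| ≤ |z - z'| := by
  have h1 := abs_max_sub_max_le_max (-(3 * κ)) (min (-(1.5 * κ)) z) (-(3 * κ))
    (min (-(1.5 * κ)) z')
  have h2 := abs_min_sub_min_le_max (-(1.5 * κ)) z (-(1.5 * κ)) z'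
  simp only [sub_self, abs_zero] at h1 h2
  exact h1.trans (max_le (abs_nonneg _) (h2.trans (max_le (abs_nonneg _) le_rfl)))

theorem psi_sub {κ z z' : ℝ} (hz : z < Real.exp (-2 * κ)) (hz' : z' < Real.exp (-2 * κ)) :
    psi κ z - psi κ z' = Real.exp (-2 * κ) /
      ((Real.exp (-2 * κ) - z) * (Real.exp (-2 * κ) - z')) * (z - z') := by
  have h1 : Real.exp (-2 * κ) - z ≠ 0 := by linarith
  have h2 : Real.exp (-2 * κ) - z' ≠ 0 := by linarith
  rw [psi, psi]
  generalize Real.exp (-2 * κ) = q at *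
  field_simp
  ring

theorem psi_slope {κ z z' : ℝ} (hκ : 0 < κ) (hκ1 : κ ≤ 1 / 1000)
    (h1 : -(3 * κ) ≤ z) (h2 : z ≤ -(1.5 * κ)) (h1' : -(3 * κ) ≤ z') (h2' : z' ≤ -(1.5 * κ)) :
    1 - 10 * κ ≤ Real.exp (-2 * κ) / ((Real.exp (-2 * κ) - z) * (Real.exp (-2 * κ) - z')) ∧
    Real.exp (-2 * κ) / ((Real.exp (-2 * κ) - z) * (Real.exp (-2 * κ) - z')) ≤ 1 - κ / 2 := by
  have q1 := Real.add_one_le_exp (-2 * κ)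
  have q2 := exp_neg_two_le hκ hκ1
  set q := Real.exp (-2 * κ)
  norm_num at h2 h2'
  have a1 : q + 3 / 2 * κ ≤ q - z := by linarith
  have a1' : q + 3 / 2 * κ ≤ q - z' := by linarith
  have a2 : q - z ≤ 1 + 2 * κ := by linarith
  have a2' : q - z' ≤ 1 + 2 * κ := by linarith
  have hq : 0.99 ≤ q := by norm_num; linarith
  norm_num at hq
  have p0 : 0 < (q - z) * (q - z') := by apply mul_pos <;> linarith
  have p1 : (q + 3 / 2 * κ) * (q + 3 / 2 * κ) ≤ (q - z) * (q - z') :=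
    mul_le_mul a1 a1' (by linarith) (by linarith)
  have p2 : (q - z) * (q - z') ≤ (1 + 2 * κ) * (1 + 2 * κ) :=
    mul_le_mul a2 a2' (by linarith) (by linarith)
  constructor
  · rw [le_div_iff₀ p0]
    have : (1 - 10 * κ) * ((q - z) * (q - z')) ≤ (1 - 10 * κ) * ((1 + 2 * κ) * (1 + 2 * κ)) :=
      mul_le_mul_of_nonneg_left p2 (by linarith)
    nlinarith [pow_pos hκ 2, pow_pos hκ 3]
  · rw [div_le_iff₀ p0]
    have h3 : (1 - κ / 2) * ((q + 3 / 2 * κ) * (q + 3 / 2 * κ)) ≤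
        (1 - κ / 2) * ((q - z) * (q - z')) := mul_le_mul_of_nonneg_left p1 (by linarith)
    have h4 : q * (1 + κ) ≤ (q + 3 / 2 * κ) * (q + 3 / 2 * κ) := by nlinarith
    have h5 : (1 - κ / 2) * (q * (1 + κ)) ≤
        (1 - κ / 2) * ((q + 3 / 2 * κ) * (q + 3 / 2 * κ)) :=
      mul_le_mul_of_nonneg_left h4 (by linarith)
    nlinarith [mul_nonneg hκ.le (by linarith : 0 ≤ 1 - κ)]

theorem psi_lip {κ z z' : ℝ} (hκ : 0 < κ) (hκ1 : κ ≤ 1 / 1000)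
    (h1 : -(3 * κ) ≤ z) (h2 : z ≤ -(1.5 * κ)) (h1' : -(3 * κ) ≤ z') (h2' : z' ≤ -(1.5 * κ)) :
    |psi κ z - psi κ z'| ≤ (1 - κ / 2) * |z - z'| := by
  have hq := Real.exp_pos (-2 * κ)
  rw [psi_sub (by norm_num at h2; linarith) (by norm_num at h2'; linarith), abs_mul]
  have s := psi_slope hκ hκ1 h1 h2 h1' h2'
  rw [abs_of_nonneg (by linarith [s.1])]
  exact mul_le_mul_of_nonneg_right s.2 (abs_nonneg _)

theorem chi_lip {κ z z' : ℝ} (hκ : 0 < κ) (hκ1 : κ ≤ 1 / 1000)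
    (h1 : -(3 * κ) ≤ z) (h2 : z ≤ -(1.5 * κ)) (h1' : -(3 * κ) ≤ z') (h2' : z' ≤ -(1.5 * κ)) :
    |(psi κ z - z) - (psi κ z' - z')| ≤ 10 * κ * |z - z'| := by
  have hq := Real.exp_pos (-2 * κ)
  have e : (psi κ z - z) - (psi κ z' - z') = (psi κ z - psi κ z') - (z - z') := by ring
  rw [e, psi_sub (by norm_num at h2; linarith) (by norm_num at h2'; linarith)]
  have s := psi_slope hκ hκ1 h1 h2 h1' h2'
  rw [← sub_one_mul, abs_mul]
  apply mul_le_mul_of_nonneg_right _ (abs_nonneg _)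
  rw [abs_le]
  constructor <;> linarith [s.1, s.2]

theorem chi_bound {κ z : ℝ} (hκ : 0 < κ) (hκ1 : κ ≤ 1 / 1000)
    (h1 : -(3 * κ) ≤ z) (h2 : z ≤ -(1.5 * κ)) : |psi κ z - z| ≤ 10 * κ ^ 2 := by
  have q1 := Real.add_one_le_exp (-2 * κ)
  have q2 := exp_neg_two_le hκ hκ1
  rw [psi]
  set q := Real.exp (-2 * κ)
  norm_num at h2
  have hp : 0.99 ≤ q - z := by norm_num; linarith
  norm_num at hp
  have e : z / (q - z) - z = z * (1 - q + z) / (q - z) := by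
    have : q - z ≠ 0 := by linarith
    field_simp
    ring
  rw [e, abs_div, abs_of_pos (by linarith : 0 < q - z), div_le_iff₀ (by linarith), abs_mul]
  have a1 : |z| ≤ 3 * κ := abs_le.2 ⟨by linarith, by linarith⟩
  have a2 : |1 - q + z| ≤ 3 * κ := abs_le.2 ⟨by linarith, by linarith⟩
  have := mul_le_mul a1 a2 (abs_nonneg _) (by linarith)
  nlinarith

theorem yb_lip {κ : ℝ} (hκ : 0 < κ) (hκ1 : κ ≤ 1 / 1000) (k : ℕ) (f f' : ℕ → ℝ) :
    |yb κ k f - yb κ k f'| ≤ ∑ j ∈ Finset.range k, |f j - f' j| := by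
  induction k generalizing f f' with
  | zero => simp [yb]
  | succ k ih =>
    have i := ih (fun n => f (n + 1)) (fun n => f' (n + 1))
    rw [Finset.sum_range_succ']
    simp only [yb]
    set Y := yb κ k fun n => f (n + 1)
    set Y' := yb κ k fun n => f' (n + 1)
    obtain ⟨a1, a2⟩ := clip_mem hκ (Y + f 0)
    obtain ⟨b1, b2⟩ := clip_mem hκ (Y' + f' 0)
    have h := psi_lip hκ hκ1 a1 a2 b1 b2
    have c := clip_lip κ (Y + f 0) (Y' + f' 0)
    have t : |Y + f 0 - (Y' + f' 0)| ≤ |Y - Y'| + |f 0 - f' 0| := by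
      rw [show Y + f 0 - (Y' + f' 0) = (Y - Y') + (f 0 - f' 0) by ring]
      exact abs_add_le _ _
    have : (1 - κ / 2) * |clip κ (Y + f 0) - clip κ (Y' + f' 0)| ≤
        1 * |clip κ (Y + f 0) - clip κ (Y' + f' 0)| :=
      mul_le_mul_of_nonneg_right (by linarith) (abs_nonneg _)
    linarith

theorem yb_mem {κ : ℝ} (hκ : 0 < κ) (hκ1 : κ ≤ 1 / 1000) (k : ℕ) (f : ℕ → ℝ) :
    -(3 * κ) ≤ yb κ k f ∧ yb κ k f ≤ 0 := by
  rcases k with _ | k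
  · simp only [yb]; constructor <;> linarith
  · simp only [yb]
    obtain ⟨a1, a2⟩ := clip_mem hκ (yb κ k (fun n => f (n + 1)) + f 0)
    set c := clip κ (yb κ k (fun n => f (n + 1)) + f 0)
    have hc := chi_bound hκ hκ1 a1 a2
    have q1 := Real.add_one_le_exp (-2 * κ)
    rw [psi]
    norm_num at a2
    have hq := Real.exp_pos (-2 * κ)
    constructor
    · rw [le_div_iff₀ (by linarith)]
      nlinarith
    · exact div_nonpos_of_nonpos_of_nonneg (by linarith) (by linarith)

theorem yb_tail {κ : ℝ} (hκ : 0 < κ) (hκ1 : κ ≤ 1 / 1000) (k n : ℕ) (f : ℕ → ℝ) :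
    |yb κ k f - yb κ (k + n) f| ≤ (1 - κ / 2) ^ k * (3 * κ) := by
  induction k generalizing f with
  | zero =>
    obtain ⟨a1, a2⟩ := yb_mem hκ hκ1 (0 + n) f
    simp only [yb, pow_zero, one_mul]
    rw [abs_le]; constructor <;> linarith
  | succ k ih =>
    have i := ih (fun n => f (n + 1))
    rw [show k + 1 + n = k + n + 1 by omega]
    simp only [yb]
    set Y := yb κ k fun n => f (n + 1)
    set Y' := yb κ (k + n) fun n => f (n + 1)
    obtain ⟨a1, a2⟩ := clip_mem hκ (Y + f 0)
    obtain ⟨b1, b2⟩ := clip_mem hκ (Y' + f 0)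
    have h := psi_lip hκ hκ1 a1 a2 b1 b2
    have c := clip_lip κ (Y + f 0) (Y' + f 0)
    rw [add_sub_add_right_eq_sub] at c
    have hk : 0 ≤ 1 - κ / 2 := by linarith
    calc _ ≤ _ := h
      _ ≤ (1 - κ / 2) * ((1 - κ / 2) ^ k * (3 * κ)) :=
        mul_le_mul_of_nonneg_left (c.trans i) hk
      _ = _ := by ring

/-- A trapped trajectory starts close to the backward iteration. -/
theorem yb_trapped {κ : ℝ} (hκ : 0 < κ) (hκ1 : κ ≤ 1 / 1000) (k : ℕ) (f y : ℕ → ℝ)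
    (hy : ∀ n ≤ k, -(2.5 * κ) ≤ y n ∧ y n ≤ -(1.7 * κ)) (hf : ∀ n < k, |f n| ≤ κ / 10)
    (hrec : ∀ n < k, y (n + 1) = Real.exp (-2 * κ) * y n / (1 + y n) - f n) :
    |y 0 - yb κ k f| ≤ (1 - κ / 2) ^ k * κ := by
  induction k generalizing f y with
  | zero =>
    have := hy 0 le_rfl
    norm_num at this
    simp only [yb, pow_zero, one_mul]
    rw [abs_le]; constructor <;> linarith [this.1, this.2]
  | succ k ih =>
    have i := ih (fun n => f (n + 1)) (fun n => y (n + 1)) (fun n hn => hy (n + 1) (by omega))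
      (fun n hn => hf (n + 1) (by omega)) (fun n hn => hrec (n + 1) (by omega))
    simp only [zero_add] at i
    have h0 := hy 0 (by omega)
    have h1 := hy 1 (by omega)
    have hf0 := abs_le.1 (hf 0 (by omega))
    have hr := hrec 0 (by omega)
    rw [zero_add] at hr
    norm_num at h0 h1
    have m1 : -(3 * κ) ≤ y 1 + f 0 := by linarith [h1.1, hf0.1]
    have m2 : y 1 + f 0 ≤ -(1.5 * κ) := by norm_num; linarith [h1.2, hf0.2]
    have e : y 0 = psi κ (clip κ (y 1 + f 0)) := by
      rw [clip_of_mem m1 m2, psi, hr, sub_add_cancel]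
      have p : 0 < 1 + y 0 := by linarith [h0.1]
      have hq := Real.exp_pos (-2 * κ)
      have : Real.exp (-2 * κ) - Real.exp (-2 * κ) * y 0 / (1 + y 0) =
        Real.exp (-2 * κ) / (1 + y 0) := by field_simp; ring
      rw [this]
      field_simp
    simp only [yb]
    rw [e]
    set Y' := yb κ k fun n => f (n + 1)
    obtain ⟨a1, a2⟩ := clip_mem hκ (y 1 + f 0)
    obtain ⟨b1, b2⟩ := clip_mem hκ (Y' + f 0)
    have h := psi_lip hκ hκ1 a1 a2 b1 b2
    have c := clip_lip κ (y 1 + f 0) (Y' + f 0)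
    rw [add_sub_add_right_eq_sub] at c
    have hk : 0 ≤ 1 - κ / 2 := by linarith
    calc _ ≤ _ := h
      _ ≤ (1 - κ / 2) * ((1 - κ / 2) ^ k * κ) :=
        mul_le_mul_of_nonneg_left (c.trans i) hk
      _ = _ := by ring

theorem yb_expand {κ φ e d : ℝ} (hκ : 0 < κ) (hκ1 : κ ≤ 1 / 1000) (k : ℕ)
    (hd1 : -(2.7 * κ) ≤ d) (hd2 : d ≤ -(1.6 * κ)) (hφ : 0 ≤ φ) (n : ℕ) (f : ℕ → ℝ)
    (hf : ∀ n, |f n| ≤ φ)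
    (hw : |yb κ k (fun j => f (n + j)) - d| ≤ e) (he : e + n * (φ + 10 * κ ^ 2) ≤ κ / 20) :
    |yb κ (n + k) f - d| ≤ e + n * (φ + 10 * κ ^ 2) ∧
    |yb κ (n + k) f - yb κ k (fun j => f (n + j)) - ∑ j ∈ Finset.range n, f j
      - n * (psi κ d - d)| ≤ n * (10 * κ * (e + n * (φ + 10 * κ ^ 2))) := by
  induction n generalizing f with
  | zero =>
    simp only [zero_add, CharP.cast_eq_zero, zero_mul, add_zero] at hw he ⊢
    exact ⟨hw, by simp⟩
  | succ n ih =>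
    push_cast at he ⊢
    have e0 : (fun j => f (n + 1 + j)) = fun j => (fun i => f (i + 1)) (n + j) := by
      funext j; congr 1; omega
    rw [e0] at hw ⊢
    have hφκ : 0 ≤ φ + 10 * κ ^ 2 := by positivity
    obtain ⟨i1, i2⟩ := ih (fun i => f (i + 1)) (fun i => hf (i + 1)) hw (by nlinarith)
    set w := yb κ k fun j => (fun i => f (i + 1)) (n + j)
    rw [show n + 1 + k = n + k + 1 by omega, Finset.sum_range_succ']
    simp only [yb]
    set Y := yb κ (n + k) fun n => f (n + 1)
    set t := e + n * (φ + 10 * κ ^ 2) with ht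
    have f0 := hf 0
    have hz : |Y + f 0 - d| ≤ t + φ := by
      rw [show Y + f 0 - d = (Y - d) + f 0 by ring]
      exact (abs_add_le _ _).trans (add_le_add i1 f0)
    have htφ : t + φ ≤ κ / 20 := by nlinarith
    obtain ⟨z1, z2⟩ := abs_le.1 (hz.trans htφ)
    norm_num at hd1 hd2
    have m1 : -(3 * κ) ≤ Y + f 0 := by linarith
    have m2 : Y + f 0 ≤ -(1.5 * κ) := by norm_num; linarith
    rw [clip_of_mem m1 m2]
    have c1 := chi_bound hκ hκ1 m1 m2
    have c2 := chi_lip hκ hκ1 m1 m2 (z' := d) (by linarith) (by norm_num; linarith)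
    have et : e + (n + 1) * (φ + 10 * κ ^ 2) = t + φ + 10 * κ ^ 2 := by rw [ht]; ring
    rw [et]
    constructor
    · rw [show psi κ (Y + f 0) - d = (psi κ (Y + f 0) - (Y + f 0)) + (Y + f 0 - d) by ring]
      refine (abs_add_le _ _).trans ?_
      linarith
    · have ee : psi κ (Y + f 0) - w - (∑ j ∈ Finset.range n, f (j + 1) + f 0) -
        (n + 1) * (psi κ d - d) = (Y - w - ∑ j ∈ Finset.range n, f (j + 1) -
          n * (psi κ d - d)) + ((psi κ (Y + f 0) - (Y + f 0)) - (psi κ d - d)) := by ring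
      rw [ee]
      refine (abs_add_le _ _).trans ?_
      have h1 : (n : ℝ) * (10 * κ * t) ≤ n * (10 * κ * (t + φ + 10 * κ ^ 2)) := by
        gcongr; linarith
      have h2 : 10 * κ * |Y + f 0 - d| ≤ 10 * κ * (t + φ + 10 * κ ^ 2) := by
        gcongr; nlinarith
      linarith

/-- If the backward iterations at two times agree up to a small error, then the noise collected
in between is determined up to a small error. -/
theorem sum_noise_of_yb {κ φ e d : ℝ} (hκ : 0 < κ) (hκ1 : κ ≤ 1 / 1000) (k n : ℕ)
    (hd1 : -(2.7 * κ) ≤ d) (hd2 : d ≤ -(1.6 * κ)) (hφ : 0 ≤ φ) (f : ℕ → ℝ)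
    (hf : ∀ n, |f n| ≤ φ) (hk : (1 - κ / 2) ^ k * (3 * κ) ≤ e)
    (h1 : |yb κ (n + k) f - d| ≤ e) (h2 : |yb κ (n + k) (fun j => f (n + j)) - d| ≤ e)
    (he : 2 * e + n * (φ + 10 * κ ^ 2) ≤ κ / 20) :
    |∑ j ∈ Finset.range n, f j + n * (psi κ d - d)| ≤
      3 * e + n * (10 * κ * (2 * e + n * (φ + 10 * κ ^ 2))) := by
  have t := yb_tail hκ hκ1 k n (fun j => f (n + j))
  rw [Nat.add_comm k n] at t
  have hw : |yb κ k (fun j => f (n + j)) - d| ≤ 2 * e := by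
    rw [← sub_add_sub_cancel _ (yb κ (n + k) (fun j => f (n + j))) d]
    refine (abs_add_le _ _).trans ?_
    linarith
  have := (yb_expand hκ hκ1 k hd1 hd2 hφ n f hf hw he).2
  set s := ∑ j ∈ Finset.range n, f j + n * (psi κ d - d) with hs
  have es : s = (yb κ (n + k) f - d) - (yb κ k (fun j => f (n + j)) - d) -
    (yb κ (n + k) f - yb κ k (fun j => f (n + j)) - ∑ j ∈ Finset.range n, f j
      - n * (psi κ d - d)) := by rw [hs]; ring
  rw [es]
  refine (abs_sub _ _).trans ?_
  have : |(yb κ (n + k) f - d) - (yb κ k (fun j => f (n + j)) - d)| ≤ e + 2 * e :=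
    (abs_sub _ _).trans (add_le_add h1 hw)
  linarith

/-- A norm on states adapted to transfer matrices near the band edge. -/
def edgeNorm (σ x z : ℝ) : ℝ := |x| + |x - z| / σ

theorem edgeNorm_forward {σ ρ s e x z : ℝ} (hσ : 0 < σ) (h1 : 1 + σ ≤ ρ)
    (hs : s * (1 + 1 / σ) ≤ ρ - 1) (he : |e - 2| ≤ s) :
    edgeNorm σ (e * x - z) x ≤ ρ * edgeNorm σ x z := by
  have hs0 : 0 ≤ s := (abs_nonneg _).trans he
  have a1 : |e * x - z| ≤ |x| + |x - z| + s * |x| := by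
    rw [show e * x - z = x + (x - z) + (e - 2) * x by ring]
    refine (abs_add_three _ _ _).trans ?_
    rw [abs_mul (e - 2)]
    gcongr
  have a2 : |e * x - z - x| ≤ |x - z| + s * |x| := by
    rw [show e * x - z - x = (x - z) + (e - 2) * x by ring]
    refine (abs_add_le _ _).trans ?_
    rw [abs_mul (e - 2)]
    gcongr
  have a3 : |e * x - z - x| / σ ≤ (|x - z| + s * |x|) / σ := by gcongr
  rw [edgeNorm, edgeNorm]
  have hx := abs_nonneg x
  have hd : 0 ≤ |x - z| / σ := by positivity
  have e1 : (|x - z| + s * |x|) / σ = |x - z| / σ + s * (1 / σ) * |x| := by field_simp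
  have e2 : |x - z| = σ * (|x - z| / σ) := by field_simp
  rw [e1] at a3
  set d := |x - z| / σ
  rw [e2] at a1
  nlinarith

theorem edgeNorm_backward {σ ρ s e x z : ℝ} (hσ : 0 < σ) (h1 : 1 + 2 * σ ≤ ρ)
    (hs : s * (1 + 1 / σ) ≤ ρ - 1) (hs1 : s ≤ σ) (he : |e - 2| ≤ s) :
    edgeNorm σ x z ≤ ρ * edgeNorm σ (e * x - z) x := by
  have hs0 : 0 ≤ s := (abs_nonneg _).trans he
  rw [edgeNorm, edgeNorm]
  set X := e * x - z with hX
  have a1 : |x| ≤ |X| + |X - x| := by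
    have := abs_sub X (X - x)
    rwa [sub_sub_cancel] at this
  have a2 : |x - z| ≤ |X - x| + s * |x| := by
    rw [show x - z = (X - x) + (2 - e) * x by rw [hX]; ring]
    refine (abs_add_le _ _).trans ?_
    rw [abs_mul (2 - e), abs_sub_comm 2 e]
    gcongr
  have a3 : |x - z| / σ ≤ (|X - x| + s * |x|) / σ := by gcongr
  have e1 : (|X - x| + s * |x|) / σ = |X - x| / σ + s * (1 / σ) * |x| := by field_simp
  have e2 : |X - x| = σ * (|X - x| / σ) := by field_simp
  rw [e1] at a3
  have hd : 0 ≤ |X - x| / σ := by positivity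
  set d := |X - x| / σ
  rw [e2] at a1
  have hX0 := abs_nonneg X
  have hsσ : s * (1 / σ) * |x| ≤ s * (1 / σ) * (|X| + σ * d) := by gcongr
  have hsσ' : s * (1 / σ) * (|X| + σ * d) = s * (1 / σ) * |X| + s * d := by field_simp
  nlinarith [mul_nonneg hs0 hX0, mul_nonneg hs0 hd]

theorem edgeNorm_add {σ : ℝ} (hσ : 0 < σ) (x z x' z' : ℝ) :
    edgeNorm σ (x + x') (z + z') ≤ edgeNorm σ x z + edgeNorm σ x' z' := by
  rw [edgeNorm, edgeNorm, edgeNorm]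
  have h1 := abs_add_le x x'
  have h2 : |x + x' - (z + z')| / σ ≤ (|x - z| + |x' - z'|) / σ := by
    gcongr
    rw [show x + x' - (z + z') = (x - z) + (x' - z') by ring]
    exact abs_add_le _ _
  rw [add_div] at h2
  linarith

/-- Perturbing the energies by exponentially decaying amounts changes the final state by a small
amount relative to its size. -/
theorem state_close {σ ρ s θ D r : ℝ} (hσ : 0 < σ) (h1 : 1 + 2 * σ ≤ ρ)
    (hs : s * (1 + 1 / σ) ≤ ρ - 1) (hs1 : s ≤ σ) (hr : 0 < r) (hD : 0 ≤ D)
    (hθ : ρ ^ 2 * r = θ) (hθ1 : θ < 1) {e e' u u' : ℕ → ℝ}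
    (hu : ∀ n, u (n + 2) = e n * u (n + 1) - u n)
    (hu' : ∀ n, u' (n + 2) = e' n * u' (n + 1) - u' n) (h0 : u 0 = u' 0) (h01 : u 1 = u' 1)
    (he : ∀ n, |e n - 2| ≤ s) (he' : ∀ n, |e' n - 2| ≤ s) {S : ℕ}
    (hee : ∀ n < S, |e n - e' n| ≤ D * r ^ (S - n)) :
    edgeNorm σ (u (S + 1) - u' (S + 1)) (u S - u' S) ≤
      (1 + 1 / σ) * D / (1 - θ) * edgeNorm σ (u (S + 1)) (u S) := by
  have hρ : 0 < ρ := by linarith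
  have hρ1 : 1 ≤ ρ := by linarith
  have hθ0 : 0 < θ := by rw [← hθ]; positivity
  set N := edgeNorm σ (u (S + 1)) (u S) with hN
  have hN0 : 0 ≤ N := by rw [hN, edgeNorm]; positivity
  have back : ∀ j ≤ S, edgeNorm σ (u (S - j + 1)) (u (S - j)) ≤ ρ ^ j * N := by
    intro j
    induction j with
    | zero => intro _; simp [hN]
    | succ j ih =>
      intro hj
      have i := ih (by omega)
      have b := edgeNorm_backward (x := u (S - (j + 1) + 1)) (z := u (S - (j + 1)))
        hσ h1 hs hs1 (he (S - (j + 1)))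
      rw [← hu, show S - (j + 1) + 2 = S - j + 1 by omega,
        show S - (j + 1) + 1 = S - j by omega] at b
      rw [show S - (j + 1) + 1 = S - j by omega, pow_succ]
      refine b.trans ?_
      calc _ ≤ ρ * (ρ ^ j * N) := mul_le_mul_of_nonneg_left i hρ.le
        _ = _ := by ring
  have key : ∀ n ≤ S, ρ ^ (S - n) * edgeNorm σ (u (n + 1) - u' (n + 1)) (u n - u' n) ≤
      (1 + 1 / σ) * D * N * ∑ j ∈ Finset.range n, θ ^ (S - j) := by
    intro n
    induction n with
    | zero => intro _; simp [h0, h01, edgeNorm]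
    | succ n ih =>
      intro hn
      have i := ih (by omega)
      have b := back (S - n) (by omega)
      rw [show S - (S - n) = n by omega] at b
      have f := edgeNorm_forward (x := u (n + 1) - u' (n + 1)) (z := u n - u' n) hσ
        (by linarith : 1 + σ ≤ ρ) hs (he' n)
      have hx : |u (n + 1)| ≤ ρ ^ (S - n) * N := by
        refine le_trans ?_ b
        rw [edgeNorm]
        have : 0 ≤ |u (n + 1) - u n| / σ := by positivity
        linarith
      have hd : edgeNorm σ (u (n + 1 + 1) - u' (n + 1 + 1)) (u (n + 1) - u' (n + 1)) ≤
          ρ * edgeNorm σ (u (n + 1) - u' (n + 1)) (u n - u' n) +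
          (1 + 1 / σ) * (D * r ^ (S - n) * (ρ ^ (S - n) * N)) := by
        have ex : u (n + 1 + 1) - u' (n + 1 + 1) =
            (e' n * (u (n + 1) - u' (n + 1)) - (u n - u' n)) + (e n - e' n) * u (n + 1) := by
          rw [show n + 1 + 1 = n + 2 from rfl, hu n, hu' n]; ring
        have ez : u (n + 1) - u' (n + 1) = (u (n + 1) - u' (n + 1)) + 0 := by ring
        rw [ex]
        nth_rewrite 2 [ez]
        refine (edgeNorm_add hσ _ _ _ _).trans (add_le_add f ?_)
        rw [edgeNorm, sub_zero, abs_mul]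
        have : |e n - e' n| * |u (n + 1)| ≤ D * r ^ (S - n) * (ρ ^ (S - n) * N) :=
          mul_le_mul (hee n (by omega)) hx (abs_nonneg _) (by positivity)
        calc _ = (1 + 1 / σ) * (|e n - e' n| * |u (n + 1)|) := by ring
          _ ≤ _ := mul_le_mul_of_nonneg_left this (by positivity)
      have e3 : ρ ^ (S - n) = ρ ^ (S - (n + 1)) * ρ := by
        rw [← pow_succ]; congr 1; omega
      have hmono : ρ ^ (S - (n + 1)) ≤ ρ ^ (S - n) := pow_le_pow_right₀ hρ1 (by omega)
      rw [Finset.sum_range_succ, mul_add]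
      have e4 : θ ^ (S - n) = ρ ^ (S - n) * ρ ^ (S - n) * r ^ (S - n) := by
        rw [← hθ, mul_pow, ← pow_mul, mul_comm 2, pow_mul, sq]
      calc _ ≤ ρ ^ (S - (n + 1)) * (ρ * edgeNorm σ (u (n + 1) - u' (n + 1)) (u n - u' n) +
          (1 + 1 / σ) * (D * r ^ (S - n) * (ρ ^ (S - n) * N))) :=
            mul_le_mul_of_nonneg_left hd (by positivity)
        _ = ρ ^ (S - n) * edgeNorm σ (u (n + 1) - u' (n + 1)) (u n - u' n) +
          ρ ^ (S - (n + 1)) * ((1 + 1 / σ) * (D * r ^ (S - n) * (ρ ^ (S - n) * N))) := by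
            rw [e3]; ring
        _ ≤ _ := by
          refine add_le_add i ?_
          rw [e4]
          calc _ ≤ ρ ^ (S - n) * ((1 + 1 / σ) * (D * r ^ (S - n) * (ρ ^ (S - n) * N))) :=
                mul_le_mul_of_nonneg_right hmono (by positivity)
            _ = _ := by ring
  have k := key S le_rfl
  rw [Nat.sub_self, pow_zero, one_mul] at k
  refine k.trans ?_
  have hsum : ∑ j ∈ Finset.range S, θ ^ (S - j) ≤ 1 / (1 - θ) := by
    have : ∑ j ∈ Finset.range S, θ ^ (S - j) ≤ ∑ j ∈ Finset.range (S + 1), θ ^ j := by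
      rw [← Finset.sum_range_reflect (fun j => θ ^ j) (S + 1), Finset.sum_range_succ]
      simp only [Nat.add_sub_cancel]
      have : 0 ≤ θ ^ (S - S) := by positivity
      linarith
    refine this.trans ?_
    rw [le_div_iff₀ (by linarith), geom_sum_mul_neg]
    have : 0 ≤ θ ^ (S + 1) := by positivity
    linarith
  calc _ ≤ (1 + 1 / σ) * D * N * (1 / (1 - θ)) :=
        mul_le_mul_of_nonneg_left hsum (by positivity)
    _ = _ := by ring

/-- The Riccati coordinate is stable under perturbations of the state. -/
theorem ric_close {κ σ E : ℝ} (hκ : 0 < κ) (hκ1 : κ ≤ 1 / 1000) (hσ : 0 < σ) (hE : 0 ≤ E)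
    {u u' : ℕ → ℝ} {S : ℕ} (h0 : u S ≠ 0) (hy1 : -(3 * κ) ≤ ric κ u S) (hy2 : ric κ u S ≤ 0)
    (hc : edgeNorm σ (u (S + 1) - u' (S + 1)) (u S - u' S) ≤ E * edgeNorm σ (u (S + 1)) (u S))
    (hE1 : 2 * (3 + 2 * σ) * (2 + 1 / σ) * E ≤ 1) :
    u' S ≠ 0 ∧ |ric κ u S - ric κ u' S| ≤ 2 * (3 + 2 * σ) * (2 + 1 / σ) * E := by
  have hp := Real.exp_pos κ
  have hexp : 1 ≤ Real.exp κ := Real.one_le_exp hκ.le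
  have hexp2 : Real.exp κ ≤ 2 := by
    have : Real.exp κ ≤ Real.exp (1 / 2) := Real.exp_le_exp.2 (by linarith)
    have h2 : Real.exp (1 / 2) ^ 2 = Real.exp 1 := by rw [← Real.exp_nat_mul]; norm_num
    nlinarith [Real.exp_one_lt_d9, Real.exp_pos (1 / 2 : ℝ)]
  set x := u (S + 1) with hx
  set z := u S with hz
  set x' := u' (S + 1) with hx'
  set z' := u' S with hz'
  have er : x = Real.exp κ * z * (1 + ric κ u S) := by
    rw [ric, ← hx, ← hz]; field_simp; ring
  have hzpos : 0 < |z| := abs_pos.2 h0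
  have hxle : |x| ≤ 2 * |z| := by
    rw [er, abs_mul, abs_mul, abs_of_pos hp, abs_of_nonneg (by linarith : 0 ≤ 1 + ric κ u S)]
    have : Real.exp κ * |z| * (1 + ric κ u S) ≤ Real.exp κ * |z| * 1 := by gcongr; linarith
    nlinarith
  have hxz : |x - z| ≤ |z| := by
    have : x - z = z * (Real.exp κ * (1 + ric κ u S) - 1) := by
      nth_rewrite 1 [er]; ring
    rw [this, abs_mul]
    refine mul_le_of_le_one_right hzpos.le (abs_le.2 ⟨?_, ?_⟩) <;> nlinarith
  have hN : edgeNorm σ x z ≤ (2 + 1 / σ) * |z| := by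
    rw [edgeNorm]
    have : |x - z| / σ ≤ |z| / σ := by gcongr
    calc _ ≤ 2 * |z| + |z| / σ := add_le_add hxle this
      _ = _ := by ring
  set F := (2 + 1 / σ) * E with hF
  have hF0 : 0 ≤ F := by positivity
  have hcF : edgeNorm σ (x - x') (z - z') ≤ F * |z| := by
    refine hc.trans ?_
    calc _ ≤ E * ((2 + 1 / σ) * |z|) := mul_le_mul_of_nonneg_left hN hE
      _ = _ := by rw [hF]; ring
  rw [edgeNorm] at hcF
  have d1 : |x - x'| ≤ F * |z| := by
    have : 0 ≤ |x - x' - (z - z')| / σ := by positivity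
    linarith
  have d2 : |x - x' - (z - z')| ≤ σ * (F * |z|) := by
    have : |x - x' - (z - z')| / σ ≤ F * |z| := by linarith [abs_nonneg (x - x')]
    rw [div_le_iff₀ hσ] at this
    linarith
  have d3 : |z - z'| ≤ (1 + σ) * (F * |z|) := by
    have := abs_sub (x - x') (x - x' - (z - z'))
    rw [sub_sub_cancel] at this
    linarith
  have hE1' : 2 * (3 + 2 * σ) * F ≤ 1 := by rw [hF]; linarith
  have hz2 : |z| / 2 ≤ |z'| := by
    have := abs_sub_abs_le_abs_sub z z'
    have : (1 + σ) * (F * |z|) ≤ |z| / 2 := by nlinarith [mul_nonneg hF0 hzpos.le]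
    linarith
  have hz'0 : z' ≠ 0 := by
    intro h
    rw [h, abs_zero] at hz2
    linarith
  refine ⟨hz'0, ?_⟩
  have e1 : ric κ u S - ric κ u' S = ((x - x') * z' - x' * (z - z')) / (Real.exp κ * z * z') := by
    rw [ric, ric, ← hx, ← hz, ← hx', ← hz']
    field_simp
    ring
  have e2 : (x - x') * z' - x' * (z - z') = (x - x') * z - x * (z - z') := by ring
  rw [e1, e2, abs_div, div_le_iff₀ (by positivity)]
  have n1 : |(x - x') * z - x * (z - z')| ≤ (3 + 2 * σ) * F * |z| * |z| := by
    refine (abs_sub _ _).trans ?_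
    rw [abs_mul, abs_mul]
    have m1 : |x - x'| * |z| ≤ F * |z| * |z| := by gcongr
    have m2 : |x| * |z - z'| ≤ 2 * |z| * ((1 + σ) * (F * |z|)) := by gcongr
    linarith
  refine n1.trans ?_
  rw [abs_mul, abs_mul, abs_of_pos hp]
  have m3 : (3 + 2 * σ) * F * |z| * |z| ≤ (3 + 2 * σ) * F * |z| * (2 * |z'|) := by
    gcongr; linarith
  have m4 : 2 * (3 + 2 * σ) * F * (1 * |z| * |z'|) ≤
      2 * (3 + 2 * σ) * F * (Real.exp κ * |z| * |z'|) := by gcongr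
  rw [hF] at m3 m4 ⊢
  linarith

/-- Standing assumptions on the random potential, with explicit constants. -/
structure PotHyp {A : Type*} [MeasurableSpace A] (P : Measure (ℤ → A)) (V : (ℤ → A) → ℝ)
    (r α B Cv Cm : ℝ) : Prop where
  r0 : 0 < r
  r1 : r < 1
  hα : 2 < α
  B0 : 0 < B
  Cv0 : 0 < Cv
  Cm0 : 0 < Cm
  inv : MeasurePreserving (shiftn 1) P P
  meas : Measurable V
  bdd : ∀ ω, |V ω| ≤ B
  ql : ∀ m n : ℕ, ∀ ω ω' : ℤ → A, (∀ i : ℤ, -(m : ℤ) ≤ i → i ≤ (n : ℤ) → ω i = ω' i) →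
    |V ω - V ω'| ≤ Cv * r ^ (min m n)
  cent : ∫ ω, V ω ∂P = 0
  mix : ∀ k l m n : ℤ, k ≤ l → l < m → m ≤ n →
    ∀ g₁ g₂ : (ℤ → A) → ℝ, Measurable g₁ → Measurable g₂ →
      (∃ B, ∀ ω, |g₁ ω| ≤ B) → (∃ B, ∀ ω, |g₂ ω| ≤ B) →
      (∀ ω ω', (∀ i : ℤ, k ≤ i → i ≤ l → ω i = ω' i) → g₁ ω = g₁ ω') →
      (∀ ω ω', (∀ i : ℤ, m ≤ i → i ≤ n → ω i = ω' i) → g₂ ω = g₂ ω') →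
      |(∫ ω, g₁ ω * g₂ ω ∂P) - (∫ ω, g₁ ω ∂P) * ∫ ω, g₂ ω ∂P| ≤
        Cm * (∫ ω, |g₁ ω| ∂P) * (∫ ω, |g₂ ω| ∂P) * ((m : ℝ) - (l : ℝ)) ^ (-α)

theorem exists_potHyp {A : Type*} [MeasurableSpace A] {P : Measure (ℤ → A)}
    (hinv : MeasurePreserving (shiftn 1) P P)
    {r : ℝ} (hr : 0 < r) (hr1 : r < 1)
    {V : (ℤ → A) → ℝ} (hVmeas : Measurable V) (hVbdd : ∃ B, ∀ ω, |V ω| ≤ B)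
    (hVql : QuasiLocal r V) (hVcent : ∫ ω, V ω ∂P = 0)
    {α : ℝ} (hα : 2 < α) (hmix : PowerMixing P α) :
    ∃ B Cv Cm, PotHyp P V r α B Cv Cm := by
  obtain ⟨B, hB⟩ := hVbdd
  obtain ⟨C, hC⟩ := hVql
  obtain ⟨D, hD⟩ := hmix
  have hB' : ∀ ω, |V ω| ≤ |B| + 1 := fun ω => by linarith [hB ω, le_abs_self B]
  refine ⟨|B| + 1, |C| + 2 * (|B| + 1), |D| + 1, hr, hr1, hα, by positivity, by positivity,
    by positivity, hinv, hVmeas, hB', ?_, hVcent, ?_⟩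
  · intro m n ω ω' h
    have hB0 := abs_nonneg B
    have hC0 := abs_nonneg C
    by_cases hmn : 1 ≤ m ∧ 1 ≤ n
    · have := hC m n hmn.1 hmn.2 ω ω' h
      rw [Real.norm_eq_abs] at this
      refine this.trans (mul_le_mul_of_nonneg_right ?_ (by positivity))
      linarith [le_abs_self C]
    · have : min m n = 0 := by omega
      rw [this, pow_zero, mul_one]
      refine (abs_sub _ _).trans ?_
      linarith [hB' ω, hB' ω']
  · intro k l m n hkl hlm hmn g₁ g₂ m₁ m₂ b₁ b₂ l₁ l₂
    have := hD (k - 1) l m (n + 1) (by omega) hlm (by omega) g₁ g₂ m₁ m₂ b₁ b₂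
      (fun ω ω' h => l₁ ω ω' fun i h1 h2 => h i (by omega) h2)
      (fun ω ω' h => l₂ ω ω' fun i h1 h2 => h i h1 (by omega))
    have hpos : (0 : ℝ) < (m : ℝ) - l := by
      have : (l : ℝ) < m := by exact_mod_cast hlm
      linarith
    rw [abs_of_pos hpos] at this
    refine this.trans ?_
    have i1 : 0 ≤ ∫ ω, |g₁ ω| ∂P := integral_nonneg fun _ => abs_nonneg _
    have i2 : 0 ≤ ∫ ω, |g₂ ω| ∂P := integral_nonneg fun _ => abs_nonneg _
    have i3 : 0 ≤ ((m : ℝ) - l) ^ (-α) := by positivity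
    gcongr
    linarith [le_abs_self D]

theorem integrable_of_bdd {Ω : Type*} [MeasurableSpace Ω] {P : Measure Ω} [IsFiniteMeasure P]
    {f : Ω → ℝ} (hf : Measurable f) {B : ℝ} (hB : ∀ ω, |f ω| ≤ B) : Integrable f P :=
  Integrable.of_bound hf.aestronglyMeasurable B (ae_of_all _ hB)

/-- Replace the coordinates outside `[l, h]` by a fixed symbol. -/
def trunc {A : Type*} (a : A) (l h : ℤ) (ω : ℤ → A) : ℤ → A :=
  fun i => if l ≤ i ∧ i ≤ h then ω i else a

section Basic

variable {A : Type*} [MeasurableSpace A]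

theorem measurable_trunc (a : A) (l h : ℤ) : Measurable (trunc a l h) := by
  refine measurable_pi_lambda _ fun i => ?_
  by_cases hi : l ≤ i ∧ i ≤ h
  · simpa only [trunc, hi, and_self, if_true] using measurable_pi_apply i
  · simpa only [trunc, hi, if_false] using measurable_const

theorem measurable_shiftn (n : ℤ) : Measurable (shiftn n : (ℤ → A) → ℤ → A) :=
  measurable_pi_lambda _ fun i => measurable_pi_apply (i + n)

theorem trunc_congr (a : A) {l h : ℤ} {ω ω' : ℤ → A}
    (hω : ∀ i : ℤ, l ≤ i → i ≤ h → ω i = ω' i) : trunc a l h ω = trunc a l h ω' := by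
  funext i
  by_cases hi : l ≤ i ∧ i ≤ h
  · simp only [trunc, hi, and_self, if_true]; exact hω i hi.1 hi.2
  · simp only [trunc, hi, if_false]

theorem shiftn_add (m n : ℤ) (ω : ℤ → A) : shiftn m (shiftn n ω) = shiftn (m + n) ω := by
  funext i; simp only [shiftn]; congr 1; ring

theorem measurePreserving_shiftn {P : Measure (ℤ → A)} (h : MeasurePreserving (shiftn 1) P P)
    (n : ℕ) : MeasurePreserving (shiftn (n : ℤ)) P P := by
  induction n with
  | zero =>
    have : (shiftn ((0 : ℕ) : ℤ) : (ℤ → A) → ℤ → A) = id := by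
      funext ω i; simp [shiftn]
    rw [this]; exact MeasurePreserving.id P
  | succ n ih =>
    have : (shiftn ((n + 1 : ℕ) : ℤ) : (ℤ → A) → ℤ → A) = shiftn 1 ∘ shiftn (n : ℤ) := by
      funext ω
      rw [Function.comp_apply, shiftn_add]
      push_cast
      rw [add_comm]
    rw [this]
    exact h.comp ih

theorem integral_shiftn {P : Measure (ℤ → A)} (h : MeasurePreserving (shiftn 1) P P)
    (n : ℕ) {g : (ℤ → A) → ℝ} (hg : Measurable g) :
    ∫ ω, g (shiftn (n : ℤ) ω) ∂P = ∫ ω, g ω ∂P := by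
  have hp := measurePreserving_shiftn h n
  rw [← integral_map (φ := shiftn (n : ℤ)) (f := g) (μ := P) hp.measurable.aemeasurable
    hg.aestronglyMeasurable, hp.map_eq]

/-- A function depends only on the coordinates in `[k, l]`. -/
def LocalOn (k l : ℤ) {E : Type*} (g : (ℤ → A) → E) : Prop :=
  ∀ ω ω', (∀ i : ℤ, k ≤ i → i ≤ l → ω i = ω' i) → g ω = g ω'

theorem localOn_trunc (a : A) (l h : ℤ) {E : Type*} (g : (ℤ → A) → E) :
    LocalOn l h (fun ω => g (trunc a l h ω)) := fun ω ω' hω => by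
  simp only [trunc_congr a hω]

theorem LocalOn.mono {k l k' l' : ℤ} (hk : k' ≤ k) (hl : l ≤ l') {E : Type*}
    {g : (ℤ → A) → E} (h : LocalOn k l g) : LocalOn k' l' g :=
  fun ω ω' hω => h ω ω' fun i h1 h2 => hω i (by omega) (by omega)

variable {P : Measure (ℤ → A)} {V : (ℤ → A) → ℝ} {r α B Cv Cm : ℝ}

namespace PotHyp

theorem neg (H : PotHyp P V r α B Cv Cm) : PotHyp P (fun ω => -V ω) r α B Cv Cm where
  r0 := H.r0
  r1 := H.r1
  hα := H.hα
  B0 := H.B0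
  Cv0 := H.Cv0
  Cm0 := H.Cm0
  inv := H.inv
  meas := H.meas.neg
  bdd := fun ω => by rw [abs_neg]; exact H.bdd ω
  ql := fun m n ω ω' h => by
    rw [neg_sub_neg, abs_sub_comm]; exact H.ql m n ω ω' h
  cent := by rw [integral_neg, H.cent, neg_zero]
  mix := H.mix

theorem measV (H : PotHyp P V r α B Cv Cm) (n : ℤ) : Measurable fun ω => V (shiftn n ω) :=
  H.meas.comp (measurable_shiftn n)

theorem measVt (H : PotHyp P V r α B Cv Cm) (a : A) (n l h : ℤ) :
    Measurable fun ω => V (shiftn n (trunc a l h ω)) :=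
  (H.measV n).comp (measurable_trunc a l h)

theorem trunc_close (H : PotHyp P V r α B Cv Cm) (a : A) {n l h : ℤ} {w : ℕ}
    (hl : l ≤ n - w) (hh : n + w ≤ h) (ω : ℤ → A) :
    |V (shiftn n ω) - V (shiftn n (trunc a l h ω))| ≤ Cv * r ^ w := by
  have := H.ql w w (shiftn n ω) (shiftn n (trunc a l h ω)) (fun i h1 h2 => by
    have hi : l ≤ i + n ∧ i + n ≤ h := by omega
    simp only [shiftn, trunc, hi, and_self, if_true])
  rwa [min_self] at this

theorem integral_V (H : PotHyp P V r α B Cv Cm) (n : ℕ) :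
    ∫ ω, V (shiftn (n : ℤ) ω) ∂P = 0 := by
  rw [integral_shiftn H.inv n H.meas, H.cent]

theorem exists_pow_le (H : PotHyp P V r α B Cv Cm) :
    ∃ Cr > 0, ∀ w : ℕ, r ^ w ≤ Cr * ((w : ℝ) + 1) ^ (-α) := by
  have h := tendsto_pow_const_mul_const_pow_of_abs_lt_one ⌈α⌉₊ (r := r)
    (by rw [abs_of_pos H.r0]; exact H.r1)
  obtain ⟨M, hM⟩ := h.bddAbove_range
  have hM' : ∀ n : ℕ, (n : ℝ) ^ ⌈α⌉₊ * r ^ n ≤ M := fun n => hM ⟨n, rfl⟩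
  have hr := H.r0
  refine ⟨(|M| + 1) / r, by positivity, fun w => ?_⟩
  have h1 := hM' (w + 1)
  push_cast at h1
  have hw : (0 : ℝ) < (w : ℝ) + 1 := by positivity
  have h2 : ((w : ℝ) + 1) ^ α ≤ ((w : ℝ) + 1) ^ ⌈α⌉₊ := by
    rw [← Real.rpow_natCast]
    exact Real.rpow_le_rpow_of_exponent_le (by linarith) (Nat.le_ceil α)
  rw [Real.rpow_neg hw.le, ← div_eq_mul_inv, le_div_iff₀ (by positivity), le_div_iff₀ hr]
  have h3 : ((w : ℝ) + 1) ^ α * r ^ (w + 1) ≤ ((w : ℝ) + 1) ^ ⌈α⌉₊ * r ^ (w + 1) := by gcongr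
  calc r ^ w * ((w : ℝ) + 1) ^ α * r = ((w : ℝ) + 1) ^ α * r ^ (w + 1) := by ring
    _ ≤ M := h3.trans h1
    _ ≤ |M| + 1 := by linarith [le_abs_self M]

end PotHyp

end Basic

section Covariance

variable {A : Type*} [MeasurableSpace A]
variable {P : Measure (ℤ → A)} [IsProbabilityMeasure P] {V : (ℤ → A) → ℝ} {r α B Cv Cm : ℝ}

theorem nonempty_alphabet (P : Measure (ℤ → A)) [IsProbabilityMeasure P] : Nonempty A :=
  (nonempty_of_isProbabilityMeasure P).map fun ω => ω 0

theorem abs_integral_mul_le {f g : (ℤ → A) → ℝ} (hf : Measurable f) {Bf : ℝ}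
    (hBf : ∀ ω, |f ω| ≤ Bf) {c : ℝ} (hc : ∀ ω, |g ω| ≤ c) :
    |∫ ω, f ω * g ω ∂P| ≤ (∫ ω, |f ω| ∂P) * c := by
  refine abs_integral_le_integral_abs.trans ?_
  rw [← integral_mul_const]
  have hB0 : ∀ ω, 0 ≤ Bf := fun ω => (abs_nonneg _).trans (hBf ω)
  refine integral_mono_of_nonneg (ae_of_all _ fun ω => abs_nonneg _)
    ((integrable_of_bdd (B := Bf) hf.abs fun ω => by rw [abs_abs]; exact hBf ω).mul_const c)
    (ae_of_all _ fun ω => ?_)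
  simp only [abs_mul]
  exact mul_le_mul_of_nonneg_left (hc ω) (abs_nonneg _)

theorem rpow_neg_le_of_half {x y K s : ℝ} (hs : 0 ≤ s) (hy : 0 < y) (hK : 0 < K)
    (h : y / K ≤ x) : x ^ (-s) ≤ K ^ s * y ^ (-s) := by
  have h0 : 0 < y / K := by positivity
  calc x ^ (-s) ≤ (y / K) ^ (-s) := Real.rpow_le_rpow_of_nonpos h0 h (by linarith)
    _ = K ^ s * y ^ (-s) := by
      rw [Real.div_rpow hy.le hK.le, Real.rpow_neg hK.le, Real.rpow_neg hy.le]
      field_simp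

namespace PotHyp

theorem exists_cov_local (H : PotHyp P V r α B Cv Cm) :
    ∃ C > 0, ∀ (k l : ℤ) (g : (ℤ → A) → ℝ), k ≤ l → Measurable g → (∃ b, ∀ ω, |g ω| ≤ b) →
      LocalOn k l g → ∀ n D : ℕ, 1 ≤ D → (l + D ≤ n ∨ (n : ℤ) + D ≤ k) →
      |∫ ω, g ω * V (shiftn (n : ℤ) ω) ∂P| ≤ C * (∫ ω, |g ω| ∂P) * (D : ℝ) ^ (-α) := by
  obtain ⟨Cr, hCr, hr⟩ := H.exists_pow_le
  obtain ⟨a⟩ := nonempty_alphabet P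
  have hv := H.Cv0
  have hm := H.Cm0
  have hB0 := H.B0
  have hα0 : 0 ≤ α := by linarith [H.hα]
  refine ⟨2 ^ α * (2 * Cv * Cr + Cm * B), by positivity, ?_⟩
  intro k l g hkl hg ⟨b, hb⟩ hloc n D hD hn
  set w := (D - 1) / 2 with hw
  have hDr : (1 : ℝ) ≤ D := by exact_mod_cast hD
  have hwD : (D : ℝ) / 2 ≤ (w : ℝ) + 1 := by
    have : D ≤ 2 * (w + 1) := by omega
    have : (D : ℝ) ≤ 2 * ((w : ℝ) + 1) := by exact_mod_cast this
    linarith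
  set W : (ℤ → A) → ℝ := fun ω => V (shiftn (n : ℤ) (trunc a (n - w) (n + w) ω)) with hW
  have hWm : Measurable W := H.measVt a n _ _
  have hVm := H.measV (n : ℤ)
  have hcl : ∀ ω, |V (shiftn (n : ℤ) ω) - W ω| ≤ Cv * r ^ w :=
    fun ω => H.trunc_close a le_rfl le_rfl ω
  have hWl : LocalOn ((n : ℤ) - w) (n + w) W := localOn_trunc a _ _ fun ω => V (shiftn (n : ℤ) ω)
  have hWB : ∀ ω, |W ω| ≤ B := fun ω => H.bdd _
  have hg0 : 0 ≤ ∫ ω, |g ω| ∂P := integral_nonneg fun _ => abs_nonneg _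
  have hVi : Integrable (fun ω => V (shiftn (n : ℤ) ω)) P := integrable_of_bdd hVm fun ω => H.bdd _
  have hWi : Integrable W P := integrable_of_bdd hWm hWB
  have hgW : Integrable (fun ω => g ω * W ω) P :=
    integrable_of_bdd (B := b * B) (hg.mul hWm) fun ω => by
      rw [abs_mul]; exact mul_le_mul (hb ω) (hWB ω) (abs_nonneg _) ((abs_nonneg _).trans (hb ω))
  have hgV : Integrable (fun ω => g ω * V (shiftn (n : ℤ) ω)) P :=
    integrable_of_bdd (B := b * B) (hg.mul hVm) fun ω => by
      rw [abs_mul]; exact mul_le_mul (hb ω) (H.bdd _) (abs_nonneg _) ((abs_nonneg _).trans (hb ω))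
  have hpw : r ^ w ≤ Cr * (2 ^ α * (D : ℝ) ^ (-α)) :=
    (hr w).trans (mul_le_mul_of_nonneg_left
      (rpow_neg_le_of_half hα0 (by linarith) two_pos hwD) hCr.le)
  have e1 : |∫ ω, g ω * (V (shiftn (n : ℤ) ω) - W ω) ∂P| ≤ (∫ ω, |g ω| ∂P) * (Cv * r ^ w) :=
    abs_integral_mul_le hg hb hcl
  have e2 : |∫ ω, W ω ∂P| ≤ Cv * r ^ w := by
    have := abs_integral_mul_le (P := P) (f := fun _ => (1 : ℝ)) (g := fun ω =>
      V (shiftn (n : ℤ) ω) - W ω) measurable_const (Bf := 1) (fun ω => by simp) hcl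
    simp only [one_mul, abs_one, integral_const, probReal_univ, smul_eq_mul] at this
    rwa [integral_sub hVi hWi, H.integral_V, zero_sub, abs_neg] at this
  have hmix : |(∫ ω, g ω * W ω ∂P) - (∫ ω, g ω ∂P) * ∫ ω, W ω ∂P| ≤
      Cm * (∫ ω, |g ω| ∂P) * B * (2 ^ α * (D : ℝ) ^ (-α)) := by
    have hWa : ∫ ω, |W ω| ∂P ≤ B := by
      have := integral_mono (μ := P) hWi.abs (integrable_const B) hWB
      simpa using this
    have hWa0 : 0 ≤ ∫ ω, |W ω| ∂P := integral_nonneg fun _ => abs_nonneg _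
    have hgap : ∀ z : ℤ, (D : ℤ) ≤ z + w → (z : ℝ) ^ (-α) ≤ 2 ^ α * (D : ℝ) ^ (-α) := by
      intro z hz
      refine rpow_neg_le_of_half hα0 (by linarith) two_pos ?_
      have : (D : ℤ) ≤ 2 * z := by omega
      have : (D : ℝ) ≤ 2 * (z : ℝ) := by exact_mod_cast this
      linarith
    have hD0 : (0:ℝ) ≤ 2 ^ α * (D : ℝ) ^ (-α) := by positivity
    rcases hn with hn | hn
    · have := H.mix k l (n - w) (n + w) hkl (by omega) (by omega) g W hg hWm ⟨b, hb⟩ ⟨B, hWB⟩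
        hloc hWl
      refine this.trans ?_
      have hz := hgap ((n - w : ℤ) - l) (by omega)
      push_cast at hz ⊢
      have : 0 ≤ Cm * ∫ ω, |g ω| ∂P := by positivity
      refine (mul_le_mul_of_nonneg_left hz (by positivity)).trans ?_
      gcongr
    · have := H.mix (n - w) (n + w) k l (by omega) (by omega) hkl W g hWm hg ⟨B, hWB⟩ ⟨b, hb⟩
        hWl hloc
      simp only [mul_comm (W _) (g _)] at this
      rw [mul_comm (∫ ω, W ω ∂P)] at this
      refine this.trans ?_
      have hz := hgap (k - (n + w : ℤ)) (by omega)
      push_cast at hz ⊢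
      have : 0 ≤ Cm * ∫ ω, |g ω| ∂P := by positivity
      refine (mul_le_mul_of_nonneg_left hz (by positivity)).trans ?_
      have := mul_le_mul_of_nonneg_left hWa this
      refine mul_le_mul_of_nonneg_right ?_ hD0
      linarith
  have e3 : |∫ ω, g ω ∂P| ≤ ∫ ω, |g ω| ∂P := abs_integral_le_integral_abs
  have split : ∫ ω, g ω * V (shiftn (n : ℤ) ω) ∂P = (∫ ω, g ω * (V (shiftn (n : ℤ) ω) - W ω) ∂P)
      + ((∫ ω, g ω * W ω ∂P) - (∫ ω, g ω ∂P) * ∫ ω, W ω ∂P)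
      + (∫ ω, g ω ∂P) * ∫ ω, W ω ∂P := by
    simp only [mul_sub]
    rw [integral_sub hgV hgW]; ring
  rw [split]
  refine (abs_add_three _ _ _).trans ?_
  rw [abs_mul]
  have e4 : |∫ ω, g ω ∂P| * |∫ ω, W ω ∂P| ≤ (∫ ω, |g ω| ∂P) * (Cv * r ^ w) :=
    mul_le_mul e3 e2 (abs_nonneg _) hg0
  have e5 : (∫ ω, |g ω| ∂P) * (Cv * r ^ w) ≤
      (∫ ω, |g ω| ∂P) * (Cv * (Cr * (2 ^ α * (D : ℝ) ^ (-α)))) := by gcongr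
  linarith

theorem exists_cov (H : PotHyp P V r α B Cv Cm) :
    ∃ C > 0, ∀ i j : ℕ, |∫ ω, V (shiftn (i : ℤ) ω) * V (shiftn (j : ℤ) ω) ∂P| ≤
      C * (1 + |(j : ℝ) - i|) ^ (-α) := by
  obtain ⟨Cr, hCr, hr⟩ := H.exists_pow_le
  obtain ⟨C, hC, hcov⟩ := H.exists_cov_local
  obtain ⟨a⟩ := nonempty_alphabet P
  have hv := H.Cv0
  have hB0 := H.B0
  have hα0 : 0 ≤ α := by linarith [H.hα]
  set K := B * B + 4 ^ α * (Cv * Cr * B + C * B) with hK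
  have hlt : ∀ i j : ℕ, i < j → |∫ ω, V (shiftn (i : ℤ) ω) * V (shiftn (j : ℤ) ω) ∂P| ≤
      K * (1 + |(j : ℝ) - i|) ^ (-α) := by
    intro i j hij
    obtain ⟨D, rfl⟩ := Nat.exists_eq_add_of_lt hij
    set w := (D + 1) / 2 with hw
    have habs : (1 + |((i + D + 1 : ℕ) : ℝ) - i|) = D + 2 := by
      push_cast
      rw [abs_of_nonneg (by linarith [(Nat.cast_nonneg D : (0:ℝ) ≤ D)])]
      ring
    rw [habs]
    have h2 : (0 : ℝ) < (D : ℝ) + 2 := by positivity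
    have hb1 : ((w : ℝ) + 1) ^ (-α) ≤ 4 ^ α * ((D : ℝ) + 2) ^ (-α) := by
      refine rpow_neg_le_of_half hα0 h2 (by norm_num) ?_
      have : D + 2 ≤ 4 * (w + 1) := by omega
      have : (D : ℝ) + 2 ≤ 4 * ((w : ℝ) + 1) := by exact_mod_cast this
      linarith
    have hb2 : (((D + 1 - w : ℕ)) : ℝ) ^ (-α) ≤ 4 ^ α * ((D : ℝ) + 2) ^ (-α) := by
      refine rpow_neg_le_of_half hα0 h2 (by norm_num) ?_
      have : D + 2 ≤ 4 * (D + 1 - w) := by omega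
      have : (D : ℝ) + 2 ≤ 4 * ((D + 1 - w : ℕ) : ℝ) := by exact_mod_cast this
      linarith
    set W : (ℤ → A) → ℝ := fun ω => V (shiftn (i : ℤ) (trunc a (i - w) (i + w) ω)) with hW
    have hWm : Measurable W := H.measVt a i _ _
    have hVi := H.measV (i : ℤ)
    have hVj := H.measV ((i + D + 1 : ℕ) : ℤ)
    have hcl : ∀ ω, |V (shiftn (i : ℤ) ω) - W ω| ≤ Cv * r ^ w :=
      fun ω => H.trunc_close a le_rfl le_rfl ω
    have hWB : ∀ ω, |W ω| ≤ B := fun ω => H.bdd _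
    have e1 : |∫ ω, (V (shiftn (i : ℤ) ω) - W ω) * V (shiftn ((i + D + 1 : ℕ) : ℤ) ω) ∂P| ≤
        Cv * r ^ w * B := by
      refine (abs_integral_mul_le (hVi.sub hWm) hcl fun ω => H.bdd _).trans ?_
      refine mul_le_mul_of_nonneg_right ?_ hB0.le
      have := integral_mono (μ := P) (integrable_of_bdd (hVi.sub hWm) hcl).abs
        (integrable_const _) hcl
      simpa using this
    have e2 := hcov (i - w) (i + w) W (by omega) hWm ⟨B, hWB⟩
      (localOn_trunc a _ _ fun ω => V (shiftn (i : ℤ) ω)) (i + D + 1) (D + 1 - w) (by omega)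
      (Or.inl (by omega))
    have hWa : ∫ ω, |W ω| ∂P ≤ B := by
      have := integral_mono (μ := P) (integrable_of_bdd hWm hWB).abs (integrable_const B) hWB
      simpa using this
    have i1 : Integrable (fun ω => (V (shiftn (i : ℤ) ω) - W ω) *
        V (shiftn ((i + D + 1 : ℕ) : ℤ) ω)) P :=
      integrable_of_bdd (B := Cv * r ^ w * B) ((hVi.sub hWm).mul hVj) fun ω => by
        rw [abs_mul]; exact mul_le_mul (hcl ω) (H.bdd _) (abs_nonneg _)
          ((abs_nonneg _).trans (hcl ω))
    have i2 : Integrable (fun ω => W ω * V (shiftn ((i + D + 1 : ℕ) : ℤ) ω)) P :=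
      integrable_of_bdd (B := B * B) (hWm.mul hVj) fun ω => by
        rw [abs_mul]; exact mul_le_mul (hWB ω) (H.bdd _) (abs_nonneg _)
          ((abs_nonneg _).trans (hWB ω))
    have split : ∫ ω, V (shiftn (i : ℤ) ω) * V (shiftn ((i + D + 1 : ℕ) : ℤ) ω) ∂P =
        (∫ ω, (V (shiftn (i : ℤ) ω) - W ω) * V (shiftn ((i + D + 1 : ℕ) : ℤ) ω) ∂P) +
        ∫ ω, W ω * V (shiftn ((i + D + 1 : ℕ) : ℤ) ω) ∂P := by
      rw [← integral_add i1 i2]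
      congr 1; funext ω; ring
    rw [split]
    refine (abs_add_le _ _).trans ?_
    have e3 : Cv * r ^ w * B ≤ Cv * (Cr * (4 ^ α * ((D : ℝ) + 2) ^ (-α))) * B := by
      have := (hr w).trans (mul_le_mul_of_nonneg_left hb1 hCr.le)
      gcongr
    have e4 : C * (∫ ω, |W ω| ∂P) * (((D + 1 - w : ℕ)) : ℝ) ^ (-α) ≤
        C * B * (4 ^ α * ((D : ℝ) + 2) ^ (-α)) := by gcongr
    have e5 : 0 ≤ B * B * ((D : ℝ) + 2) ^ (-α) := by positivity
    rw [hK]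
    linarith
  refine ⟨K, by positivity, fun i j => ?_⟩
  rcases lt_trichotomy i j with h | h | h
  · exact hlt i j h
  · subst h
    have h1 : |∫ ω, V (shiftn (i : ℤ) ω) * V (shiftn (i : ℤ) ω) ∂P| ≤ B * B := by
      refine (abs_integral_mul_le (H.measV i) (fun ω => H.bdd _)
        fun ω => H.bdd _).trans ?_
      refine mul_le_mul_of_nonneg_right ?_ hB0.le
      have := integral_mono (μ := P) (integrable_of_bdd (H.measV (i : ℤ)) fun ω => H.bdd _).abs
        (integrable_const B) fun ω => H.bdd _
      simpa using this
    simp only [sub_self, abs_zero, add_zero, Real.one_rpow, mul_one]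
    have : 0 ≤ 4 ^ α * (Cv * Cr * B + C * B) := by positivity
    linarith
  · have := hlt j i h
    simp only [mul_comm (V (shiftn (j : ℤ) _))] at this
    rwa [abs_sub_comm] at this

end PotHyp

theorem summable_int_rpow {α : ℝ} (hα : 1 < α) :
    Summable fun d : ℤ => (1 + |(d : ℝ)|) ^ (-α) := by
  have h : Summable fun n : ℕ => ((n : ℝ) + 1) ^ (-α) := by
    have := (summable_nat_add_iff 1).2 (Real.summable_nat_rpow.2 (by linarith : -α < -1))
    simpa using this
  refine Summable.of_nat_of_neg ?_ ?_ <;>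
  · refine h.congr fun n => ?_
    simp [add_comm]

namespace PotHyp

theorem exists_var (H : PotHyp P V r α B Cv Cm) :
    ∃ C > 0, ∀ (s : Finset ℕ) (w : ℕ → ℝ),
      ∫ ω, (∑ j ∈ s, w j * V (shiftn (j : ℤ) ω)) ^ 2 ∂P ≤ C * ∑ j ∈ s, w j ^ 2 := by
  obtain ⟨C, hC, hcov⟩ := H.exists_cov
  have hsum := summable_int_rpow (α := α) (by linarith [H.hα])
  set ρ : ℤ → ℝ := fun d => (1 + |(d : ℝ)|) ^ (-α) with hρ
  have hρ0 : ∀ d, 0 ≤ ρ d := fun d => by positivity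
  have hsymm : ∀ d, ρ (-d) = ρ d := fun d => by simp [hρ]
  have hρ00 : 0 < ∑' d, ρ d := hsum.tsum_pos hρ0 0 (by simp [hρ])
  refine ⟨C * ∑' d, ρ d, by positivity, fun s w => ?_⟩
  have row : ∀ i : ℕ, ∑ j ∈ s, ρ ((j : ℤ) - i) ≤ ∑' d, ρ d := by
    intro i
    have inj : Function.Injective fun j : ℕ => (j : ℤ) - i := fun a b h => by
      simp only at h; omega
    exact ((hsum.comp_injective inj).sum_le_tsum s fun j _ => hρ0 _).trans
      (tsum_comp_le_tsum_of_inj hsum hρ0 inj)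
  have hfin : ∀ i j : ℕ, Integrable (fun ω => w i * V (shiftn (i : ℤ) ω) *
      (w j * V (shiftn (j : ℤ) ω))) P := fun i j =>
    integrable_of_bdd (B := |w i| * B * (|w j| * B))
      (((H.measV i).const_mul _).mul ((H.measV j).const_mul _)) fun ω => by
        rw [abs_mul, abs_mul, abs_mul]
        have := H.B0
        have h1 := H.bdd (shiftn (i : ℤ) ω)
        have h2 := H.bdd (shiftn (j : ℤ) ω)
        gcongr
  have e1 : ∫ ω, (∑ j ∈ s, w j * V (shiftn (j : ℤ) ω)) ^ 2 ∂P =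
      ∑ i ∈ s, ∑ j ∈ s, w i * w j * ∫ ω, V (shiftn (i : ℤ) ω) * V (shiftn (j : ℤ) ω) ∂P := by
    simp only [sq, Finset.sum_mul_sum]
    rw [integral_finsetSum _ fun i _ => integrable_finsetSum _ fun j _ => hfin i j]
    refine Finset.sum_congr rfl fun i _ => ?_
    rw [integral_finsetSum _ fun j _ => hfin i j]
    refine Finset.sum_congr rfl fun j _ => ?_
    rw [← integral_const_mul]
    congr 1; funext ω; ring
  have e2 : ∀ i ∈ s, ∀ j ∈ s, w i * w j * ∫ ω, V (shiftn (i : ℤ) ω) * V (shiftn (j : ℤ) ω) ∂P ≤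
      C / 2 * (w i ^ 2 * ρ (j - i)) + C / 2 * (w j ^ 2 * ρ (i - j)) := by
    intro i _ j _
    have h1 : |∫ ω, V (shiftn (i : ℤ) ω) * V (shiftn (j : ℤ) ω) ∂P| ≤ C * ρ (j - i) := by
      have := hcov i j
      simpa only [hρ, Int.cast_sub, Int.cast_natCast] using this
    have h2 : ρ ((i : ℤ) - j) = ρ (j - i) := by rw [← hsymm]; congr 1; ring
    rw [h2]
    have h3 : |w i * w j| ≤ (w i ^ 2 + w j ^ 2) / 2 := by
      rw [abs_mul]
      nlinarith [sq_nonneg (|w i| - |w j|), sq_abs (w i), sq_abs (w j)]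
    calc w i * w j * ∫ ω, V (shiftn (i : ℤ) ω) * V (shiftn (j : ℤ) ω) ∂P
        ≤ |w i * w j| * |∫ ω, V (shiftn (i : ℤ) ω) * V (shiftn (j : ℤ) ω) ∂P| := by
          rw [← abs_mul]; exact le_abs_self _
      _ ≤ (w i ^ 2 + w j ^ 2) / 2 * (C * ρ (j - i)) := by
          refine mul_le_mul h3 h1 (abs_nonneg _) (by positivity)
      _ = _ := by ring
  rw [e1]
  calc _ ≤ ∑ i ∈ s, ∑ j ∈ s, (C / 2 * (w i ^ 2 * ρ (j - i)) + C / 2 * (w j ^ 2 * ρ (i - j))) :=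
        Finset.sum_le_sum fun i hi => Finset.sum_le_sum fun j hj => e2 i hi j hj
    _ = C * ∑ i ∈ s, w i ^ 2 * ∑ j ∈ s, ρ (j - i) := by
        simp only [Finset.sum_add_distrib]
        rw [Finset.sum_comm (f := fun i j : ℕ => C / 2 * (w j ^ 2 * ρ (i - j)))]
        rw [← Finset.sum_add_distrib, Finset.mul_sum]
        refine Finset.sum_congr rfl fun i _ => ?_
        rw [Finset.mul_sum, Finset.mul_sum, ← Finset.sum_add_distrib]
        refine Finset.sum_congr rfl fun j _ => ?_
        ring
    _ ≤ C * ∑ i ∈ s, w i ^ 2 * ∑' d, ρ d := by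
        gcongr with i _
        exact row i
    _ = _ := by rw [← Finset.sum_mul]; ring

end PotHyp

end Covariance

section ExpMoment

variable {A : Type*} [MeasurableSpace A]
variable {P : Measure (ℤ → A)} [IsProbabilityMeasure P] {V : (ℤ → A) → ℝ} {r α B Cv Cm : ℝ}

namespace PotHyp

theorem integral_prod_le (H : PotHyp P V r α B Cv Cm)
    {Φ : ℕ → (ℤ → A) → ℝ} {lo hi : ℕ → ℤ} {G : ℝ} (hG : 0 < G) (hlh : ∀ i, lo i ≤ hi i)
    (hgap : ∀ i, (hi i : ℝ) + G ≤ lo (i + 1)) (hm : ∀ i, Measurable (Φ i))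
    (h0 : ∀ i ω, 0 ≤ Φ i ω) {b : ℝ} (hb : ∀ i ω, Φ i ω ≤ b)
    (hloc : ∀ i, LocalOn (lo i) (hi i) (Φ i)) {e : ℕ → ℝ} (he : ∀ i, ∫ ω, Φ i ω ∂P ≤ e i)
    (K : ℕ) :
    ∫ ω, ∏ i ∈ Finset.range K, Φ i ω ∂P ≤
      ∏ i ∈ Finset.range K, ((1 + Cm * G ^ (-α)) * e i) := by
  have hcm := H.Cm0
  have hq : 0 ≤ Cm * G ^ (-α) := by positivity
  have he0 : ∀ i, 0 ≤ e i := fun i => (integral_nonneg fun ω => h0 i ω).trans (he i)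
  have hlt : ∀ i, hi i < lo (i + 1) := fun i => by
    have : (hi i : ℝ) < lo (i + 1) := by linarith [hgap i]
    exact_mod_cast this
  have hlo : Monotone lo := monotone_nat_of_le_succ fun i => (hlh i).trans (hlt i).le
  have hhi : Monotone hi := monotone_nat_of_le_succ fun i => (hlt i).le.trans (hlh _)
  have hb' : ∀ i ω, |Φ i ω| ≤ b := fun i ω => by rw [abs_of_nonneg (h0 i ω)]; exact hb i ω
  induction K with
  | zero => simp
  | succ K ih =>
    rw [Finset.prod_range_succ]
    simp only [Finset.prod_range_succ _ K]
    set Y : (ℤ → A) → ℝ := fun ω => ∏ i ∈ Finset.range K, Φ i ω with hY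
    have hY0 : ∀ ω, 0 ≤ Y ω := fun ω => Finset.prod_nonneg fun i _ => h0 i ω
    have hYm : Measurable Y := Finset.measurable_prod _ fun i _ => hm i
    have hYb : ∀ ω, |Y ω| ≤ b ^ K := fun ω => by
      rw [abs_of_nonneg (hY0 ω)]
      refine (Finset.prod_le_prod (fun i _ => h0 i ω) fun i _ => hb i ω).trans ?_
      simp
    have hYi : 0 ≤ ∫ ω, Y ω ∂P := integral_nonneg hY0
    have hΦi : 0 ≤ ∫ ω, Φ K ω ∂P := integral_nonneg (h0 K)
    have key : ∫ ω, Y ω * Φ K ω ∂P ≤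
        (∫ ω, Y ω ∂P) * ((1 + Cm * G ^ (-α)) * ∫ ω, Φ K ω ∂P) := by
      rcases Nat.eq_zero_or_pos K with hK | hK
      · subst hK
        simp only [hY, Finset.range_zero, Finset.prod_empty, one_mul, integral_const,
          probReal_univ, smul_eq_mul, mul_one]
        nlinarith
      · have hYl : LocalOn (lo 0) (hi (K - 1)) Y := fun ω ω' h => by
          refine Finset.prod_congr rfl fun i hiK => ?_
          have : i < K := Finset.mem_range.1 hiK
          exact (hloc i).mono (hlo (Nat.zero_le i)) (hhi (by omega)) ω ω' h
        have hK1 : K - 1 + 1 = K := by omega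
        have hg := hgap (K - 1)
        have hl := hlt (K - 1)
        rw [hK1] at hg hl
        have := H.mix (lo 0) (hi (K - 1)) (lo K) (hi K)
          ((hlh 0).trans (hhi (Nat.zero_le _))) hl (hlh K) Y (Φ K) hYm (hm K) ⟨_, hYb⟩ ⟨_, hb' K⟩
          hYl (hloc K)
        simp only [abs_of_nonneg (hY0 _), abs_of_nonneg (h0 K _)] at this
        have h1 := (abs_le.1 this).2
        have h2 : ((lo K : ℝ) - hi (K - 1)) ^ (-α) ≤ G ^ (-α) :=
          Real.rpow_le_rpow_of_nonpos hG (by linarith) (by linarith [H.hα])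
        have h3 := mul_le_mul_of_nonneg_left h2
          (by positivity : 0 ≤ Cm * (∫ ω, Y ω ∂P) * ∫ ω, Φ K ω ∂P)
        linarith
    refine key.trans ?_
    have := he K
    have : 0 ≤ ∏ i ∈ Finset.range K, ((1 + Cm * G ^ (-α)) * e i) := hYi.trans ih
    gcongr

theorem exists_exp_moment_blocks (H : PotHyp P V r α B Cv Cm) :
    ∃ C > 0, ∀ (g : ℕ), 1 ≤ g → ∀ (s : ℕ) (w : ℕ → ℝ), (∀ j, |w j| ≤ 1) → ∀ τ : ℝ,
      |τ| * g * (B + 1) ≤ 1 → ∀ N : ℕ, N ≤ 2 * g ^ 2 →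
      ∫ ω, Real.exp (τ * ∑ i ∈ Finset.range N, ∑ j ∈ Finset.range g,
        w (s + 2 * i * g + j) * V (shiftn ((s + 2 * i * g + j : ℕ) : ℤ) ω)) ∂P ≤
      C * Real.exp (C * τ ^ 2 * ∑ i ∈ Finset.range N, ∑ j ∈ Finset.range g,
        w (s + 2 * i * g + j) ^ 2) := by
  obtain ⟨Cr, hCr, hr⟩ := H.exists_pow_le
  obtain ⟨C₀, hC₀, hvar⟩ := H.exists_var
  obtain ⟨a⟩ := nonempty_alphabet P
  have hv := H.Cv0
  have hm := H.Cm0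
  have hB0 := H.B0
  have hα := H.hα
  set K₁ : ℝ := Real.exp (4 * Cv * Cr * 4 ^ α + 2 * Cm * 2 ^ α) with hK₁
  refine ⟨K₁ + C₀, by positivity, ?_⟩
  intro g hg s w hw τ hτ N hN
  have hgr : (1 : ℝ) ≤ g := by exact_mod_cast hg
  have hg0 : (0 : ℝ) < g := by linarith
  set m := g / 4 with hmg
  set q : ℝ := Cv * r ^ m with hq
  have hq0 : 0 ≤ q := by have := H.r0; positivity
  set lo : ℕ → ℤ := fun i => (s + 2 * i * g : ℕ) - (m : ℤ) with hlo
  set hi : ℕ → ℤ := fun i => (s + 2 * i * g + g : ℕ) - 1 + (m : ℤ) with hhi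
  set X : ℕ → (ℤ → A) → ℝ := fun i ω => ∑ j ∈ Finset.range g,
        w (s + 2 * i * g + j) * V (shiftn ((s + 2 * i * g + j : ℕ) : ℤ) ω) with hX
  set Φ : ℕ → (ℤ → A) → ℝ := fun i ω => Real.exp (τ * X i (trunc a (lo i) (hi i) ω)) with hΦ
  set σ : ℕ → ℝ := fun i => ∑ j ∈ Finset.range g, w (s + 2 * i * g + j) ^ 2 with hσ
  have hτB : |τ| * g * B ≤ 1 := by nlinarith [abs_nonneg τ, mul_nonneg (abs_nonneg τ) hg0.le]
  have hτ1 : |τ| * g ≤ 1 := by nlinarith [abs_nonneg τ, mul_nonneg (abs_nonneg τ) hg0.le]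
  have hXm : ∀ i, Measurable (X i) := fun i =>
    Finset.measurable_sum _ fun j _ => (H.measV _).const_mul _
  have hXb : ∀ i ω, |τ * X i ω| ≤ 1 := fun i ω => by
    rw [abs_mul]
    have : |X i ω| ≤ g * B := by
      refine (Finset.abs_sum_le_sum_abs _ _).trans ?_
      have : ∀ j ∈ Finset.range g, |w (s + 2 * i * g + j) *
          V (shiftn ((s + 2 * i * g + j : ℕ) : ℤ) ω)| ≤ B := fun j _ => by
        rw [abs_mul]
        have h1 := hw (s + 2 * i * g + j)
        have h2 := H.bdd (shiftn ((s + 2 * i * g + j : ℕ) : ℤ) ω)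
        calc _ ≤ 1 * B := mul_le_mul h1 h2 (abs_nonneg _) zero_le_one
          _ = B := one_mul B
      refine (Finset.sum_le_sum this).trans ?_
      simp
    calc _ ≤ |τ| * (g * B) := by gcongr
      _ ≤ 1 := by linarith
  have hXcl : ∀ i ω, |τ * X i ω - τ * X i (trunc a (lo i) (hi i) ω)| ≤ q := fun i ω => by
    rw [← mul_sub, abs_mul]
    have : |X i ω - X i (trunc a (lo i) (hi i) ω)| ≤ g * q := by
      rw [hX]
      simp only
      rw [← Finset.sum_sub_distrib]
      refine (Finset.abs_sum_le_sum_abs _ _).trans ?_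
      have : ∀ j ∈ Finset.range g, |w (s + 2 * i * g + j) *
          V (shiftn ((s + 2 * i * g + j : ℕ) : ℤ) ω) - w (s + 2 * i * g + j) *
          V (shiftn ((s + 2 * i * g + j : ℕ) : ℤ) (trunc a (lo i) (hi i) ω))| ≤ q := fun j hj => by
        rw [← mul_sub, abs_mul]
        have hjg := Finset.mem_range.1 hj
        have h1 := hw (s + 2 * i * g + j)
        have h2 := H.trunc_close a (n := ((s + 2 * i * g + j : ℕ) : ℤ)) (l := lo i) (h := hi i)
          (w := m) (by simp only [hlo]; push_cast; omega) (by simp only [hhi]; push_cast; omega) ω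
        calc _ ≤ 1 * q := mul_le_mul h1 h2 (abs_nonneg _) zero_le_one
          _ = q := one_mul q
      refine (Finset.sum_le_sum this).trans ?_
      simp
    calc _ ≤ |τ| * (g * q) := by gcongr
      _ = |τ| * g * q := by ring
      _ ≤ 1 * q := by gcongr
      _ = q := one_mul q
  have hXi : ∀ i, Integrable (X i) P := fun i =>
    integrable_finsetSum _ fun j _ =>
      (integrable_of_bdd (H.measV _) fun ω => H.bdd _).const_mul _
  have hXE : ∀ i, ∫ ω, X i ω ∂P = 0 := fun i => by
    rw [hX]
    simp only
    rw [integral_finsetSum _ fun j _ =>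
      (integrable_of_bdd (H.measV _) fun ω => H.bdd _).const_mul _]
    refine Finset.sum_eq_zero fun j _ => ?_
    rw [integral_const_mul, H.integral_V, mul_zero]
  have hX2 : ∀ i, ∫ ω, X i ω ^ 2 ∂P ≤ C₀ * σ i := fun i => by
    have h := hvar ((Finset.range g).map (addLeftEmbedding (s + 2 * i * g))) w
    simpa only [Finset.sum_map, addLeftEmbedding_apply] using h
  have hexpm : ∀ i, Measurable fun ω => Real.exp (τ * X i ω) := fun i =>
    ((hXm i).const_mul τ).exp
  have hexpi : ∀ i, Integrable (fun ω => Real.exp (τ * X i ω)) P := fun i =>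
    integrable_of_bdd (B := Real.exp 1) (hexpm i) fun ω => by
      rw [abs_of_pos (Real.exp_pos _)]
      exact Real.exp_le_exp.2 ((le_abs_self _).trans (hXb i ω))
  have hX2i : ∀ i, Integrable (fun ω => (τ * X i ω) ^ 2) P := fun i =>
    integrable_of_bdd (B := 1) (((hXm i).const_mul τ).pow_const 2) fun ω => by
      rw [abs_pow]; exact pow_le_one₀ (abs_nonneg _) (hXb i ω)
  have hE : ∀ i, ∫ ω, Real.exp (τ * X i ω) ∂P ≤ Real.exp (C₀ * τ ^ 2 * σ i) := fun i => by
    have h1 : ∫ ω, Real.exp (τ * X i ω) ∂P ≤ ∫ ω, (1 + τ * X i ω + (τ * X i ω) ^ 2) ∂P := by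
      refine integral_mono (hexpi i)
        (((integrable_const 1).add ((hXi i).const_mul τ)).add (hX2i i)) fun ω => ?_
      have := Real.abs_exp_sub_one_sub_id_le (hXb i ω)
      simp only
      linarith [(abs_le.1 this).2]
    have h2 : ∫ ω, (1 + τ * X i ω + (τ * X i ω) ^ 2) ∂P = 1 + τ ^ 2 * ∫ ω, X i ω ^ 2 ∂P := by
      rw [integral_add (f := fun ω => 1 + τ * X i ω)
        ((integrable_const 1).add ((hXi i).const_mul τ)) (hX2i i),
        integral_add (integrable_const 1) ((hXi i).const_mul τ), integral_const_mul, hXE]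
      simp only [mul_pow]
      rw [integral_const_mul]
      simp
    have h3 := mul_le_mul_of_nonneg_left (hX2 i) (sq_nonneg τ)
    have h4 := Real.add_one_le_exp (C₀ * τ ^ 2 * σ i)
    linarith
  have hΦE : ∀ i, ∫ ω, Φ i ω ∂P ≤ Real.exp q * Real.exp (C₀ * τ ^ 2 * σ i) := fun i => by
    refine le_trans ?_ (mul_le_mul_of_nonneg_left (hE i) (Real.exp_pos q).le)
    rw [← integral_const_mul]
    refine integral_mono_of_nonneg (ae_of_all _ fun ω => (Real.exp_pos _).le)
      ((hexpi i).const_mul _) (ae_of_all _ fun ω => ?_)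
    simp only [hΦ]
    rw [← Real.exp_add]
    refine Real.exp_le_exp.2 ?_
    linarith [(abs_le.1 (hXcl i ω)).1]
  have hprod := H.integral_prod_le (Φ := Φ) (lo := lo) (hi := hi) (G := (g : ℝ) / 2)
    (by linarith) (fun i => by simp only [hlo, hhi]; push_cast; omega)
    (fun i => by
      have : 2 * hi i + g ≤ 2 * lo (i + 1) := by
        simp only [hlo, hhi]; push_cast
        have : (2 * ((i : ℤ) + 1) * g) = 2 * i * g + 2 * g := by ring
        rw [this]; omega
      have : 2 * (hi i : ℝ) + g ≤ 2 * lo (i + 1) := by exact_mod_cast this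
      linarith)
    (fun i => (hexpm i).comp (measurable_trunc a _ _)) (fun i ω => (Real.exp_pos _).le)
    (b := Real.exp 1) (fun i ω => Real.exp_le_exp.2 ((le_abs_self _).trans (hXb i _)))
    (fun i => localOn_trunc a _ _ fun ω => Real.exp (τ * X i ω)) hΦE N
  have hgα : (g : ℝ) ^ 2 * (g : ℝ) ^ (-α) ≤ 1 := by
    rw [← Real.rpow_natCast, ← Real.rpow_add hg0]
    exact Real.rpow_le_one_of_one_le_of_nonpos hgr (by push_cast; linarith)
  have hNr : (N : ℝ) ≤ 2 * (g : ℝ) ^ 2 := by exact_mod_cast hN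
  have hNg : (N : ℝ) * (g : ℝ) ^ (-α) ≤ 2 := by
    have : 0 ≤ (g : ℝ) ^ (-α) := by positivity
    nlinarith
  have hqle : (N : ℝ) * q ≤ 2 * Cv * Cr * 4 ^ α := by
    have h1 : ((m : ℝ) + 1) ^ (-α) ≤ 4 ^ α * (g : ℝ) ^ (-α) := by
      refine rpow_neg_le_of_half (by linarith) hg0 (by norm_num) ?_
      have : g ≤ 4 * (m + 1) := by omega
      have : (g : ℝ) ≤ 4 * ((m : ℝ) + 1) := by exact_mod_cast this
      linarith
    have h2 : q ≤ Cv * (Cr * (4 ^ α * (g : ℝ) ^ (-α))) :=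
      mul_le_mul_of_nonneg_left ((hr m).trans (mul_le_mul_of_nonneg_left h1 hCr.le)) hv.le
    have h3 := mul_le_mul_of_nonneg_left h2 (Nat.cast_nonneg N : (0 : ℝ) ≤ N)
    have h4 := mul_le_mul_of_nonneg_left hNg (by positivity : 0 ≤ Cv * Cr * 4 ^ α)
    linarith
  have hGle : (N : ℝ) * (Cm * ((g : ℝ) / 2) ^ (-α)) ≤ 2 * Cm * 2 ^ α := by
    have h1 : ((g : ℝ) / 2) ^ (-α) ≤ 2 ^ α * (g : ℝ) ^ (-α) :=
      rpow_neg_le_of_half (by linarith) hg0 two_pos le_rfl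
    have h3 := mul_le_mul_of_nonneg_left h1 (by positivity : (0 : ℝ) ≤ N * Cm)
    have h4 := mul_le_mul_of_nonneg_left hNg (by positivity : 0 ≤ Cm * 2 ^ α)
    linarith
  have step1 : ∫ ω, Real.exp (τ * ∑ i ∈ Finset.range N, X i ω) ∂P ≤
      Real.exp (N * q) * ∫ ω, ∏ i ∈ Finset.range N, Φ i ω ∂P := by
    rw [← integral_const_mul]
    have hΦm : Measurable fun ω => ∏ i ∈ Finset.range N, Φ i ω :=
      Finset.measurable_prod _ fun i _ => (hexpm i).comp (measurable_trunc a _ _)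
    refine integral_mono_of_nonneg (ae_of_all _ fun ω => (Real.exp_pos _).le)
      ((integrable_of_bdd (B := Real.exp 1 ^ N) hΦm fun ω => ?_).const_mul _)
      (ae_of_all _ fun ω => ?_)
    · rw [Finset.abs_prod]
      refine (Finset.prod_le_prod (fun i _ => abs_nonneg _) (g := fun _ => Real.exp 1)
        fun i _ => ?_).trans (by simp)
      rw [abs_of_pos (Real.exp_pos _)]
      exact Real.exp_le_exp.2 ((le_abs_self _).trans (hXb i _))
    · simp only [hΦ]
      rw [← Real.exp_sum, ← Real.exp_add]
      refine Real.exp_le_exp.2 ?_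
      have : ∑ i ∈ Finset.range N, τ * X i ω ≤
          ∑ i ∈ Finset.range N, (q + τ * X i (trunc a (lo i) (hi i) ω)) :=
        Finset.sum_le_sum fun i _ => by linarith [(abs_le.1 (hXcl i ω)).2]
      rw [Finset.mul_sum]
      refine this.trans ?_
      rw [Finset.sum_add_distrib]
      simp
  have step2 : ∏ i ∈ Finset.range N, ((1 + Cm * ((g : ℝ) / 2) ^ (-α)) *
      (Real.exp q * Real.exp (C₀ * τ ^ 2 * σ i))) ≤
      Real.exp (N * (Cm * ((g : ℝ) / 2) ^ (-α)) + N * q + C₀ * τ ^ 2 * ∑ i ∈ Finset.range N, σ i) := by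
    calc _ ≤ ∏ i ∈ Finset.range N, Real.exp (Cm * ((g : ℝ) / 2) ^ (-α) + q + C₀ * τ ^ 2 * σ i) := by
          refine Finset.prod_le_prod ?_ fun i _ => ?_
          · intro i _; positivity
          rw [Real.exp_add, Real.exp_add, mul_assoc (Real.exp _)]
          refine mul_le_mul_of_nonneg_right ?_ (by positivity)
          linarith [Real.add_one_le_exp (Cm * ((g : ℝ) / 2) ^ (-α))]
      _ = _ := by
          rw [← Real.exp_sum]
          congr 1
          rw [Finset.sum_add_distrib, Finset.mul_sum]
          simp
  refine step1.trans ((mul_le_mul_of_nonneg_left (hprod.trans step2) (Real.exp_pos _).le).trans ?_)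
  rw [← Real.exp_add]
  have hσ0 : 0 ≤ τ ^ 2 * ∑ i ∈ Finset.range N, σ i :=
    mul_nonneg (sq_nonneg _) (Finset.sum_nonneg fun i _ => Finset.sum_nonneg fun j _ => sq_nonneg _)
  have hK0 : 0 < K₁ := Real.exp_pos _
  calc _ ≤ Real.exp ((4 * Cv * Cr * 4 ^ α + 2 * Cm * 2 ^ α) +
        (K₁ + C₀) * τ ^ 2 * ∑ i ∈ Finset.range N, σ i) := by
        refine Real.exp_le_exp.2 ?_
        nlinarith [mul_nonneg hK0.le hσ0]
    _ = K₁ * Real.exp ((K₁ + C₀) * τ ^ 2 * ∑ i ∈ Finset.range N, σ i) := by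
        rw [Real.exp_add]
    _ ≤ _ := by gcongr; linarith

end PotHyp

theorem sum_range_two_mul_blocks (N g : ℕ) (F : ℕ → ℝ) :
    ∑ j ∈ Finset.range (2 * N * g), F j =
      (∑ i ∈ Finset.range N, ∑ j ∈ Finset.range g, F (0 + 2 * i * g + j)) +
      ∑ i ∈ Finset.range N, ∑ j ∈ Finset.range g, F (g + 2 * i * g + j) := by
  induction N with
  | zero => simp
  | succ N ih =>
    rw [Finset.sum_range_succ _ N, Finset.sum_range_succ _ N,
      show 2 * (N + 1) * g = 2 * N * g + g + g by ring, Finset.sum_range_add, Finset.sum_range_add,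
      ih]
    simp only [zero_add]
    have : ∀ j, 2 * N * g + g + j = g + 2 * N * g + j := fun j => by ring
    simp only [this]
    ring

theorem PotHyp.exists_exp_moment (H : PotHyp P V r α B Cv Cm) :
    ∃ C > 0, ∀ g : ℕ, 1 ≤ g → ∀ w : ℕ → ℝ, (∀ j, |w j| ≤ 1) → ∀ t : ℝ, |t| * g * C ≤ 1 →
      ∫ ω, Real.exp (t * ∑ j ∈ Finset.range (4 * g ^ 3), w j * V (shiftn (j : ℤ) ω)) ∂P ≤
        C * Real.exp (C * t ^ 2 * ∑ j ∈ Finset.range (4 * g ^ 3), w j ^ 2) := by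
  obtain ⟨C, hC, hE⟩ := H.exists_exp_moment_blocks
  have hB0 := H.B0
  refine ⟨4 * C + 2 * (B + 1), by positivity, fun g hg w hw t ht => ?_⟩
  have h43 : 4 * g ^ 3 = 2 * (2 * g ^ 2) * g := by ring
  have htg : 0 ≤ |t| * g := by positivity
  have hτ : |2 * t| * g * (B + 1) ≤ 1 := by
    rw [abs_mul, abs_two]
    nlinarith [mul_nonneg htg hC.le]
  rw [h43]
  simp only [sum_range_two_mul_blocks]
  have hσ : ∀ s, 0 ≤ ∑ i ∈ Finset.range (2 * g ^ 2), ∑ j ∈ Finset.range g,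
      w (s + 2 * i * g + j) ^ 2 :=
    fun s => Finset.sum_nonneg fun i _ => Finset.sum_nonneg fun j _ => sq_nonneg _
  have h0 := hE g hg 0 w hw (2 * t) hτ (2 * g ^ 2) le_rfl
  have h1 := hE g hg g w hw (2 * t) hτ (2 * g ^ 2) le_rfl
  have hσ0 := hσ 0
  have hσ1 := hσ g
  set S : ℕ → (ℤ → A) → ℝ := fun s ω => ∑ i ∈ Finset.range (2 * g ^ 2), ∑ j ∈ Finset.range g,
    w (s + 2 * i * g + j) * V (shiftn ((s + 2 * i * g + j : ℕ) : ℤ) ω) with hS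
  have hSm : ∀ s, Measurable (S s) := fun s =>
    Finset.measurable_sum _ fun i _ => Finset.measurable_sum _ fun j _ => (H.measV _).const_mul _
  have hSb : ∀ s ω, |S s ω| ≤ (2 * g ^ 2 : ℕ) * (g * B) := fun s ω => by
    refine (Finset.abs_sum_le_sum_abs _ _).trans ?_
    have : ∀ i ∈ Finset.range (2 * g ^ 2), |∑ j ∈ Finset.range g,
        w (s + 2 * i * g + j) * V (shiftn ((s + 2 * i * g + j : ℕ) : ℤ) ω)| ≤ g * B := fun i _ => by
      refine (Finset.abs_sum_le_sum_abs _ _).trans ?_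
      have : ∀ j ∈ Finset.range g, |w (s + 2 * i * g + j) *
          V (shiftn ((s + 2 * i * g + j : ℕ) : ℤ) ω)| ≤ B := fun j _ => by
        rw [abs_mul]
        calc _ ≤ 1 * B := mul_le_mul (hw _) (H.bdd _) (abs_nonneg _) zero_le_one
          _ = B := one_mul B
      refine (Finset.sum_le_sum this).trans (by simp)
    refine (Finset.sum_le_sum this).trans (by simp)
  have hi : ∀ s, Integrable (fun ω => Real.exp (2 * t * S s ω)) P := fun s =>
    integrable_of_bdd (B := Real.exp (|2 * t| * ((2 * g ^ 2 : ℕ) * (g * B))))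
      ((hSm s).const_mul _).exp fun ω => by
        rw [abs_of_pos (Real.exp_pos _)]
        refine Real.exp_le_exp.2 ((le_abs_self _).trans ?_)
        rw [abs_mul]
        exact mul_le_mul_of_nonneg_left (hSb s ω) (abs_nonneg _)
  set a0 := ∑ i ∈ Finset.range (2 * g ^ 2), ∑ j ∈ Finset.range g, w (0 + 2 * i * g + j) ^ 2
  set a1 := ∑ i ∈ Finset.range (2 * g ^ 2), ∑ j ∈ Finset.range g, w (g + 2 * i * g + j) ^ 2
  have key : ∫ ω, Real.exp (t * (S 0 ω + S g ω)) ∂P ≤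
      ((∫ ω, Real.exp (2 * t * S 0 ω) ∂P) + ∫ ω, Real.exp (2 * t * S g ω) ∂P) / 2 := by
    rw [← integral_add (hi 0) (hi g), ← integral_div]
    refine integral_mono_of_nonneg (ae_of_all _ fun ω => (Real.exp_pos _).le)
      (((hi 0).add (hi g)).div_const 2) (ae_of_all _ fun ω => ?_)
    simp only
    have e0 : Real.exp (2 * t * S 0 ω) = Real.exp (t * S 0 ω) ^ 2 := by
      rw [← Real.exp_nat_mul]; congr 1; push_cast; ring
    have e1 : Real.exp (2 * t * S g ω) = Real.exp (t * S g ω) ^ 2 := by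
      rw [← Real.exp_nat_mul]; congr 1; push_cast; ring
    rw [mul_add, Real.exp_add, e0, e1]
    nlinarith [sq_nonneg (Real.exp (t * S 0 ω) - Real.exp (t * S g ω))]
  refine key.trans ?_
  have b0 : C * (2 * t) ^ 2 * a0 ≤ (4 * C + 2 * (B + 1)) * t ^ 2 * (a0 + a1) := by
    have : 0 ≤ t ^ 2 * a0 := by positivity
    have : 0 ≤ t ^ 2 * a1 := by positivity
    nlinarith
  have b1 : C * (2 * t) ^ 2 * a1 ≤ (4 * C + 2 * (B + 1)) * t ^ 2 * (a0 + a1) := by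
    have : 0 ≤ t ^ 2 * a0 := by positivity
    have : 0 ≤ t ^ 2 * a1 := by positivity
    nlinarith
  have c0 := mul_le_mul_of_nonneg_left (Real.exp_le_exp.2 b0) hC.le
  have c1 := mul_le_mul_of_nonneg_left (Real.exp_le_exp.2 b1) hC.le
  have hpos := Real.exp_pos ((4 * C + 2 * (B + 1)) * t ^ 2 * (a0 + a1))
  nlinarith [h0.trans c0, h1.trans c1]

end ExpMoment

section PartialSums

variable {A : Type*}

/-- Birkhoff sums of the potential along the shift. -/
def psum (V : (ℤ → A) → ℝ) (n : ℕ) (ω : ℤ → A) : ℝ :=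
  ∑ j ∈ Finset.range n, V (shiftn (j : ℤ) ω)

variable [MeasurableSpace A]

theorem psum_add (V : (ℤ → A) → ℝ) (m n : ℕ) (ω : ℤ → A) :
    psum V (m + n) ω = psum V m ω + psum V n (shiftn (m : ℤ) ω) := by
  unfold psum
  rw [Finset.sum_range_add]
  congr 1
  refine Finset.sum_congr rfl fun j _ => ?_
  rw [shiftn_add]
  congr 2
  push_cast
  ring

variable {P : Measure (ℤ → A)} {V : (ℤ → A) → ℝ} {r α B Cv Cm : ℝ}

namespace PotHyp

theorem measurable_psum (H : PotHyp P V r α B Cv Cm) (n : ℕ) : Measurable (psum V n) :=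
  Finset.measurable_sum _ fun j _ => H.measV j

theorem abs_psum_le (H : PotHyp P V r α B Cv Cm) (n : ℕ) (ω : ℤ → A) :
    |psum V n ω| ≤ n * B := by
  refine (Finset.abs_sum_le_sum_abs _ _).trans ?_
  refine (Finset.sum_le_sum fun j _ => H.bdd _).trans ?_
  simp

theorem psum_trunc (H : PotHyp P V r α B Cv Cm) (a : A) (n : ℕ) (ω : ℤ → A) :
    |psum V n ω - psum V n (trunc a 0 (n - 1) ω)| ≤ 2 * Cv / (1 - r) := by
  have hr := H.r0
  have hr1 := H.r1
  have hv := H.Cv0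
  unfold psum
  rw [← Finset.sum_sub_distrib]
  refine (Finset.abs_sum_le_sum_abs _ _).trans ?_
  have h1 : ∀ j ∈ Finset.range n, |V (shiftn (j : ℤ) ω) -
      V (shiftn (j : ℤ) (trunc a 0 (n - 1) ω))| ≤ Cv * (r ^ j + r ^ (n - 1 - j)) := by
    intro j hj
    have hjn := Finset.mem_range.1 hj
    refine (H.trunc_close a (w := min j (n - 1 - j)) (by omega) (by omega) ω).trans ?_
    refine mul_le_mul_of_nonneg_left ?_ hv.le
    rcases min_choice j (n - 1 - j) with h | h <;> rw [h]
    · have : 0 ≤ r ^ (n - 1 - j) := by positivity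
      linarith
    · have : 0 ≤ r ^ j := by positivity
      linarith
  refine (Finset.sum_le_sum h1).trans ?_
  have hs : ∑ j ∈ Finset.range n, r ^ j ≤ 1 / (1 - r) := by
    have := (summable_geometric_of_lt_one hr.le hr1).sum_le_tsum (Finset.range n)
      fun j _ => by positivity
    rwa [tsum_geometric_of_lt_one hr.le hr1, ← one_div] at this
  rw [← Finset.mul_sum, Finset.sum_add_distrib, Finset.sum_range_reflect (fun j => r ^ j)]
  calc _ ≤ Cv * (1 / (1 - r) + 1 / (1 - r)) := by gcongr
    _ = _ := by ring

variable [IsProbabilityMeasure P]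

theorem integrable_psum_sq (H : PotHyp P V r α B Cv Cm) (n : ℕ) :
    Integrable (fun ω => psum V n ω ^ 2) P :=
  integrable_of_bdd (B := (n * B) ^ 2) ((H.measurable_psum n).pow_const 2) fun ω => by
    rw [abs_pow]
    exact pow_le_pow_left₀ (abs_nonneg _) (H.abs_psum_le n ω) 2

theorem integral_psum (H : PotHyp P V r α B Cv Cm) (n : ℕ) : ∫ ω, psum V n ω ∂P = 0 := by
  unfold psum
  rw [integral_finsetSum _ fun j _ => integrable_of_bdd (H.measV _) fun ω => H.bdd _]
  exact Finset.sum_eq_zero fun j _ => H.integral_V j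

theorem exists_doubling (H : PotHyp P V r α B Cv Cm) :
    ∃ C > 0, ∀ n : ℕ, 2 * ∫ ω, psum V n ω ^ 2 ∂P - 2 * C ≤ ∫ ω, psum V (2 * n) ω ^ 2 ∂P := by
  obtain ⟨C, hC, hcov⟩ := H.exists_cov
  have hα := H.hα
  have hs : Summable fun i : ℕ => ((i : ℝ) + 1) ^ (-(α / 2)) := by
    have := (summable_nat_add_iff 1).2 (Real.summable_nat_rpow.2 (by linarith : -(α / 2) < -1))
    simpa using this
  set ρ : ℕ → ℝ := fun i => ((i : ℝ) + 1) ^ (-(α / 2)) with hρ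
  have hρ0 : ∀ i, 0 ≤ ρ i := fun i => by positivity
  set T := ∑' i, ρ i
  have hT : 0 < T := hs.tsum_pos hρ0 0 (by simp [hρ])
  have hle : ∀ n, ∑ i ∈ Finset.range n, ρ i ≤ T := fun n => hs.sum_le_tsum _ fun i _ => hρ0 i
  refine ⟨C * T ^ 2, by positivity, fun n => ?_⟩
  have hm := H.measurable_psum n
  have hms : Measurable fun ω => psum V n (shiftn (n : ℤ) ω) := hm.comp (measurable_shiftn _)
  have i1 : Integrable (fun ω => psum V n ω * psum V n (shiftn (n : ℤ) ω)) P :=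
    integrable_of_bdd (B := n * B * (n * B)) (hm.mul hms) fun ω => by
      rw [abs_mul]
      exact mul_le_mul (H.abs_psum_le n ω) (H.abs_psum_le n _) (abs_nonneg _)
        ((abs_nonneg _).trans (H.abs_psum_le n ω))
  have i2 : Integrable (fun ω => psum V n (shiftn (n : ℤ) ω) ^ 2) P :=
    (measurePreserving_shiftn H.inv n).integrable_comp_of_integrable (H.integrable_psum_sq n)
  have e1 : ∫ ω, psum V (2 * n) ω ^ 2 ∂P = ∫ ω, psum V n ω ^ 2 ∂P +
      2 * ∫ ω, psum V n ω * psum V n (shiftn (n : ℤ) ω) ∂P +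
      ∫ ω, psum V n (shiftn (n : ℤ) ω) ^ 2 ∂P := by
    have i3 : Integrable (fun ω => psum V n ω ^ 2 +
        2 * (psum V n ω * psum V n (shiftn (n : ℤ) ω))) P :=
      (H.integrable_psum_sq n).add (i1.const_mul 2)
    rw [← integral_const_mul, ← integral_add (H.integrable_psum_sq n) (i1.const_mul 2),
      ← integral_add i3 i2]
    congr 1; funext ω
    rw [two_mul, psum_add]; ring
  have e2 : ∫ ω, psum V n (shiftn (n : ℤ) ω) ^ 2 ∂P = ∫ ω, psum V n ω ^ 2 ∂P :=
    integral_shiftn H.inv n (g := fun ω => psum V n ω ^ 2) (hm.pow_const 2)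
  have iV : ∀ i j : ℕ, Integrable (fun ω => V (shiftn (i : ℤ) ω) * V (shiftn (j : ℤ) ω)) P :=
    fun i j => integrable_of_bdd (B := B * B) ((H.measV i).mul (H.measV j)) fun ω => by
      rw [abs_mul]; exact mul_le_mul (H.bdd _) (H.bdd _) (abs_nonneg _) H.B0.le
  have e3 : ∫ ω, psum V n ω * psum V n (shiftn (n : ℤ) ω) ∂P =
      ∑ i ∈ Finset.range n, ∑ j ∈ Finset.range n,
        ∫ ω, V (shiftn (i : ℤ) ω) * V (shiftn ((j + n : ℕ) : ℤ) ω) ∂P := by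
    simp only [psum, Finset.sum_mul_sum, shiftn_add, ← Nat.cast_add]
    rw [integral_finsetSum _ fun i _ => integrable_finsetSum _ fun j _ => iV i (j + n)]
    exact Finset.sum_congr rfl fun i _ => integral_finsetSum _ fun j _ => iV i (j + n)
  have e4 : |∫ ω, psum V n ω * psum V n (shiftn (n : ℤ) ω) ∂P| ≤ C * T ^ 2 := by
    rw [e3]
    calc _ ≤ ∑ i ∈ Finset.range n, ∑ j ∈ Finset.range n, C * (ρ (n - 1 - i) * ρ j) := by
          refine (Finset.abs_sum_le_sum_abs _ _).trans (Finset.sum_le_sum fun i hi =>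
            (Finset.abs_sum_le_sum_abs _ _).trans (Finset.sum_le_sum fun j _ => ?_))
          have hin := Finset.mem_range.1 hi
          refine (hcov i (j + n)).trans (mul_le_mul_of_nonneg_left ?_ hC.le)
          have hsub : ((n - 1 - i : ℕ) : ℝ) = n - 1 - i := by
            rw [Nat.cast_sub (by omega), Nat.cast_sub (by omega)]; simp
          have hi' : (i : ℝ) + 1 ≤ n := by exact_mod_cast hin
          have hj0 : (0 : ℝ) ≤ j := Nat.cast_nonneg j
          push_cast
          rw [abs_of_nonneg (by linarith)]
          have hp : (0 : ℝ) < 1 + (j + n - i) := by linarith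
          have : (1 + ((j : ℝ) + n - i)) ^ (-α) =
              (1 + ((j : ℝ) + n - i)) ^ (-(α / 2)) * (1 + ((j : ℝ) + n - i)) ^ (-(α / 2)) := by
            rw [← Real.rpow_add hp]; congr 1; ring
          rw [this]
          simp only [hρ]
          refine mul_le_mul ?_ ?_ (by positivity) (by positivity)
          · refine Real.rpow_le_rpow_of_nonpos (by positivity) ?_ (by linarith)
            rw [hsub]; linarith
          · refine Real.rpow_le_rpow_of_nonpos (by positivity) ?_ (by linarith)
            linarith
      _ = C * ((∑ i ∈ Finset.range n, ρ i) * ∑ j ∈ Finset.range n, ρ j) := by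
          conv_rhs => rw [← Finset.sum_range_reflect ρ n]
          conv_rhs => arg 2; arg 2; rw [Finset.sum_range_reflect ρ n]
          rw [Finset.sum_mul_sum, Finset.mul_sum]
          exact Finset.sum_congr rfl fun i _ => (Finset.mul_sum _ _ _).symm
      _ ≤ C * (T * T) := by
          have h0 : 0 ≤ ∑ i ∈ Finset.range n, ρ i := Finset.sum_nonneg fun i _ => hρ0 i
          exact mul_le_mul_of_nonneg_left (mul_le_mul (hle n) (hle n) h0 hT.le) hC.le
      _ = C * T ^ 2 := by ring
  rw [e1, e2]
  linarith [(abs_le.1 e4).1]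

/-- If the variances of the Birkhoff sums are bounded then the sums are almost surely bounded
from above. -/
theorem exists_psum_le (H : PotHyp P V r α B Cv Cm) {M : ℝ}
    (hM : ∀ n, ∫ ω, psum V n ω ^ 2 ∂P ≤ M) : ∃ K, ∀ n, ∀ᵐ ω ∂P, psum V n ω ≤ K := by
  obtain ⟨C, hC, hcov⟩ := H.exists_cov_local
  obtain ⟨a⟩ := nonempty_alphabet P
  have hm := H.Cm0
  have hα := H.hα
  have hsum := summable_int_rpow (α := α) (by linarith)
  set ρ : ℤ → ℝ := fun d => (1 + |(d : ℝ)|) ^ (-α) with hρ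
  have hρ0 : ∀ d, 0 ≤ ρ d := fun d => by positivity
  set T := ∑' d, ρ d
  have hT : 0 < T := hsum.tsum_pos hρ0 0 (by simp [hρ])
  have row : ∀ f : ℕ → ℤ, Function.Injective f → ∀ s : Finset ℕ, ∑ j ∈ s, ρ (f j) ≤ T :=
    fun f hf s => ((hsum.comp_injective hf).sum_le_tsum s fun j _ => hρ0 _).trans
      (tsum_comp_le_tsum_of_inj hsum hρ0 hf)
  set K₂ := 2 * Cv / (1 - r)
  set θ := K₂ + 2 * C * T + 1 with hθ
  refine ⟨θ + K₂, fun n => ?_⟩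
  rcases Nat.eq_zero_or_pos n with hn | hn
  · subst hn
    have : 0 ≤ K₂ := by
      have := H.Cv0; have := H.r1
      exact div_nonneg (by positivity) (by linarith)
    refine ae_of_all _ fun ω => ?_
    have h : 0 ≤ C * T := by positivity
    simp only [psum, Finset.range_zero, Finset.sum_empty]
    linarith
  set E : Set (ℤ → A) := {ω | θ < psum V n (trunc a 0 (n - 1) ω)} with hE
  have hEm : MeasurableSet E :=
    measurableSet_lt measurable_const ((H.measurable_psum n).comp (measurable_trunc a _ _))
  set φ : (ℤ → A) → ℝ := E.indicator fun _ => 1 with hφ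
  have hφm : Measurable φ := measurable_const.indicator hEm
  have hφ0 : ∀ ω, 0 ≤ φ ω := fun ω => Set.indicator_nonneg (fun _ _ => zero_le_one) ω
  have hφ1 : ∀ ω, φ ω ≤ 1 := fun ω => Set.indicator_le_self' (fun _ _ => zero_le_one) ω
  have hφa : ∀ ω, |φ ω| ≤ 1 := fun ω => by rw [abs_of_nonneg (hφ0 ω)]; exact hφ1 ω
  have hφl : LocalOn 0 ((n : ℤ) - 1) φ := fun ω ω' h => by
    simp only [hφ, hE, Set.indicator, Set.mem_ofPred_eq, trunc_congr a h]
  set p := ∫ ω, φ ω ∂P with hp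
  have hpP : p = P.real E := by
    rw [hp, hφ, integral_indicator_const _ hEm]; simp
  have hp0 : 0 ≤ p := integral_nonneg hφ0
  have hp1 : p ≤ 1 := by rw [hpP]; exact measureReal_le_one
  set ψ : ℕ → (ℤ → A) → ℝ := fun i ω => φ (shiftn ((i * n : ℕ) : ℤ) ω) with hψ
  have hψm : ∀ i, Measurable (ψ i) := fun i => hφm.comp (measurable_shiftn _)
  have hψa : ∀ i ω, |ψ i ω| ≤ 1 := fun i ω => hφa _
  have hψi : ∀ i, Integrable (ψ i) P := fun i => integrable_of_bdd (hψm i) (hψa i)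
  have hψp : ∀ i, ∫ ω, ψ i ω ∂P = p := fun i => integral_shiftn H.inv (i * n) hφm
  have hψp' : ∀ i, ∫ ω, |ψ i ω| ∂P = p := fun i => by
    rw [← hψp i]; congr 1; funext ω; exact abs_of_nonneg (hφ0 _)
  have hψl : ∀ i, LocalOn ((i * n : ℕ) : ℤ) ((i * n : ℕ) + (n - 1 : ℤ)) (ψ i) := fun i ω ω' h => by
    refine hφl _ _ fun j h1 h2 => ?_
    exact h _ (by omega) (by omega)
  -- the lower bound for the correlation of the block indicator with the total sum
  have hlow : ∀ Q i : ℕ, i < Q → p ≤ ∫ ω, ψ i ω * psum V (Q * n) ω ∂P := by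
    intro Q i hi
    obtain ⟨R, rfl⟩ := Nat.exists_eq_add_of_lt hi
    have hiV : ∀ j : ℕ, Integrable (fun ω => ψ i ω * V (shiftn (j : ℤ) ω)) P := fun j =>
      integrable_of_bdd (B := 1 * B) ((hψm i).mul (H.measV j)) fun ω => by
        rw [abs_mul]; exact mul_le_mul (hψa i ω) (H.bdd _) (abs_nonneg _) zero_le_one
    have hsplit : ∀ ω, ψ i ω * psum V ((i + R + 1) * n) ω =
        (∑ j ∈ Finset.range (i * n), ψ i ω * V (shiftn (j : ℤ) ω)) +
        ψ i ω * psum V n (shiftn ((i * n : ℕ) : ℤ) ω) +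
        ∑ j ∈ Finset.range (R * n), ψ i ω * V (shiftn ((i * n + n + j : ℕ) : ℤ) ω) := by
      intro ω
      rw [show (i + R + 1) * n = i * n + n + R * n by ring, psum_add, psum_add]
      simp only [psum, ← Finset.mul_sum, shiftn_add]
      rw [mul_add, mul_add]
      congr 3
      funext j
      congr 2
      push_cast; ring
    have hmid : ∫ ω, ψ i ω * psum V n (shiftn ((i * n : ℕ) : ℤ) ω) ∂P ≥ p * (2 * C * T + 1) := by
      have h1 := integral_shiftn H.inv (i * n) (g := fun ω => φ ω * psum V n ω)
        (hφm.mul (H.measurable_psum n))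
      simp only [hψ]
      rw [h1, hp, ← integral_mul_const]
      refine integral_mono ((integrable_of_bdd hφm hφa).mul_const _)
        (integrable_of_bdd (B := 1 * (n * B)) (hφm.mul (H.measurable_psum n)) fun ω => by
          rw [abs_mul]
          exact mul_le_mul (hφa ω) (H.abs_psum_le n ω) (abs_nonneg _) zero_le_one) fun ω => ?_
      simp only [hφ, Set.indicator]
      split_ifs with h
      · have h2 := H.psum_trunc a n ω
        have h3 : θ < psum V n (trunc a 0 (n - 1) ω) := h
        have := (abs_le.1 h2).1
        linarith
      · simp
    have hmi : Integrable (fun ω => ψ i ω * psum V n (shiftn ((i * n : ℕ) : ℤ) ω)) P :=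
      integrable_of_bdd (B := 1 * (n * B))
        ((hψm i).mul ((H.measurable_psum n).comp (measurable_shiftn _))) fun ω => by
          rw [abs_mul]
          exact mul_le_mul (hψa i ω) (H.abs_psum_le n _) (abs_nonneg _) zero_le_one
    have hb1 : |∑ j ∈ Finset.range (i * n), ∫ ω, ψ i ω * V (shiftn (j : ℤ) ω) ∂P| ≤ C * p * T := by
      refine (Finset.abs_sum_le_sum_abs _ _).trans ?_
      have : ∀ j ∈ Finset.range (i * n), |∫ ω, ψ i ω * V (shiftn (j : ℤ) ω) ∂P| ≤
          C * p * ρ ((i * n : ℕ) - j - 1) := fun j hj => by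
        have hj' := Finset.mem_range.1 hj
        have := hcov _ _ (ψ i) (by omega) (hψm i) ⟨1, hψa i⟩ (hψl i) j (i * n - j) (by omega)
          (Or.inr (by omega))
        rw [hψp'] at this
        refine this.trans_eq ?_
        simp only [hρ]
        congr 2
        have h4 : ((i * n - j : ℕ) : ℤ) = ((i * n : ℕ) : ℤ) - j := by omega
        have h5 : ((i * n - j : ℕ) : ℝ) = ((i * n : ℕ) : ℝ) - j := by exact_mod_cast h4
        have h6 : (1 : ℝ) ≤ ((i * n - j : ℕ) : ℝ) := by
          exact_mod_cast (by omega : 1 ≤ i * n - j)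
        push_cast at h5 h6 ⊢
        rw [abs_of_nonneg (by linarith)]
        linarith
      refine (Finset.sum_le_sum this).trans ?_
      rw [← Finset.mul_sum]
      refine mul_le_mul_of_nonneg_left (row (fun j => ((i * n : ℕ) : ℤ) - j - 1) ?_ _)
        (by positivity)
      intro x y h; simp only at h; omega
    have hb2 : |∑ j ∈ Finset.range (R * n),
        ∫ ω, ψ i ω * V (shiftn ((i * n + n + j : ℕ) : ℤ) ω) ∂P| ≤ C * p * T := by
      refine (Finset.abs_sum_le_sum_abs _ _).trans ?_
      have : ∀ j ∈ Finset.range (R * n), |∫ ω, ψ i ω * V (shiftn ((i * n + n + j : ℕ) : ℤ) ω) ∂P| ≤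
          C * p * ρ j := fun j hj => by
        have := hcov _ _ (ψ i) (by omega) (hψm i) ⟨1, hψa i⟩ (hψl i) (i * n + n + j) (j + 1)
          (by omega) (Or.inl (by push_cast; omega))
        rw [hψp'] at this
        refine this.trans_eq ?_
        simp only [hρ]
        congr 2
        push_cast
        rw [abs_of_nonneg (Nat.cast_nonneg j)]
        ring
      refine (Finset.sum_le_sum this).trans ?_
      rw [← Finset.mul_sum]
      exact mul_le_mul_of_nonneg_left (row (fun j => (j : ℤ)) Nat.cast_injective _) (by positivity)
    simp only [hsplit]
    have hi3 : Integrable (fun ω => (∑ j ∈ Finset.range (i * n), ψ i ω * V (shiftn (j : ℤ) ω)) +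
        ψ i ω * psum V n (shiftn ((i * n : ℕ) : ℤ) ω)) P :=
      (integrable_finsetSum _ fun j _ => hiV j).add hmi
    rw [integral_add hi3
      (integrable_finsetSum _ fun j _ => hiV _),
      integral_add (integrable_finsetSum _ fun j _ => hiV j) hmi,
      integral_finsetSum _ fun j _ => hiV j, integral_finsetSum _ fun j _ => hiV _]
    have g1 := (abs_le.1 hb1).1
    have g2 := (abs_le.1 hb2).1
    linarith
  set C₃ := 1 + Cm * 2 ^ α with hC₃
  have hC₃0 : 0 < C₃ := by positivity
  have hcv : ∀ i j : ℕ, i < j →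
      |∫ ω, (ψ i ω - p) * (ψ j ω - p) ∂P| ≤ C₃ * p * ρ ((j : ℤ) - i) := by
    intro i j hij
    have hii : Integrable (fun ω => ψ i ω * ψ j ω) P :=
      integrable_of_bdd (B := 1) ((hψm i).mul (hψm j)) fun ω => by
        rw [abs_mul]; exact mul_le_one₀ (hψa i ω) (abs_nonneg _) (hψa j ω)
    have h1 : ∫ ω, (ψ i ω - p) * (ψ j ω - p) ∂P = (∫ ω, ψ i ω * ψ j ω ∂P) -
        (∫ ω, ψ i ω ∂P) * ∫ ω, ψ j ω ∂P := by
      have : ∀ ω, (ψ i ω - p) * (ψ j ω - p) = ψ i ω * ψ j ω - p * ψ i ω - p * ψ j ω + p * p :=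
        fun ω => by ring
      simp only [this]
      have k1 : Integrable (fun ω => ψ i ω * ψ j ω - p * ψ i ω) P := hii.sub ((hψi i).const_mul p)
      have k2 : Integrable (fun ω => ψ i ω * ψ j ω - p * ψ i ω - p * ψ j ω) P :=
        k1.sub ((hψi j).const_mul p)
      rw [integral_add k2 (integrable_const _), integral_sub k1 ((hψi j).const_mul p),
        integral_sub hii ((hψi i).const_mul p), integral_const_mul, integral_const_mul, hψp, hψp]
      simp
    have hge : (i + 1) * n ≤ j * n := Nat.mul_le_mul_right n hij
    have hin : (i + 1) * n = i * n + n := by ring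
    have h2 := H.mix _ _ _ _ (by omega) (by omega) (by omega) (ψ i) (ψ j) (hψm i) (hψm j)
      ⟨1, hψa i⟩ ⟨1, hψa j⟩ (hψl i) (hψl j)
    rw [h1]
    refine h2.trans ?_
    rw [hψp', hψp']
    have hgap : ((j : ℝ) - i) ≤ (((j * n : ℕ) : ℤ) : ℝ) - (((i * n : ℕ) + (n - 1 : ℤ) : ℤ) : ℝ) := by
      have : (j : ℤ) - i ≤ ((j * n : ℕ) : ℤ) - ((i * n : ℕ) + (n - 1 : ℤ)) := by
        push_cast
        have h5 : (j : ℤ) - i - 1 ≤ (j - i - 1) * n := by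
          have h6 : (0 : ℤ) ≤ (j : ℤ) - i - 1 := by omega
          have h7 : (1 : ℤ) ≤ n := by omega
          nlinarith
        have h8 : ((j : ℤ) - i - 1) * n = j * n - i * n - n := by ring
        omega
      exact_mod_cast this
    have hij' : (1 : ℝ) ≤ (j : ℝ) - i := by
      have : (i : ℝ) + 1 ≤ j := by exact_mod_cast hij
      linarith
    have h3 : ((((j * n : ℕ) : ℤ) : ℝ) - (((i * n : ℕ) + (n - 1 : ℤ) : ℤ) : ℝ)) ^ (-α) ≤
        2 ^ α * ρ ((j : ℤ) - i) := by
      simp only [hρ]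
      push_cast at hgap ⊢
      rw [abs_of_nonneg (by linarith)]
      refine rpow_neg_le_of_half (by linarith) (by linarith) two_pos ?_
      linarith
    calc _ ≤ Cm * p * p * (2 ^ α * ρ ((j : ℤ) - i)) := by gcongr
      _ = p * (Cm * 2 ^ α * p * ρ ((j : ℤ) - i)) := by ring
      _ ≤ 1 * (Cm * 2 ^ α * p * ρ ((j : ℤ) - i)) :=
          mul_le_mul_of_nonneg_right hp1 (by have := hρ0 ((j : ℤ) - i); positivity)
      _ ≤ C₃ * p * ρ ((j : ℤ) - i) := by
          have : 0 ≤ p * ρ ((j : ℤ) - i) := mul_nonneg hp0 (hρ0 _)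
          rw [hC₃]; linarith
  have hcv' : ∀ i j : ℕ, |∫ ω, (ψ i ω - p) * (ψ j ω - p) ∂P| ≤ C₃ * p * ρ ((j : ℤ) - i) := by
    intro i j
    rcases lt_trichotomy i j with h | h | h
    · exact hcv i j h
    · subst h
      have h1 : ∀ ω, ψ i ω * ψ i ω = ψ i ω := fun ω => by
        simp only [hψ, hφ, Set.indicator]; split_ifs <;> simp
      have h2 : ∀ ω, (ψ i ω - p) * (ψ i ω - p) = (1 - 2 * p) * ψ i ω + p * p := fun ω => by
        linear_combination h1 ω
      simp only [h2]
      rw [integral_add ((hψi i).const_mul _) (integrable_const _), integral_const_mul, hψp]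
      simp only [integral_const, probReal_univ, smul_eq_mul, one_mul, sub_self, hρ, Int.cast_zero,
        abs_zero, add_zero, Real.one_rpow, mul_one]
      have : 0 ≤ Cm * 2 ^ α * p := by positivity
      rw [abs_of_nonneg (by nlinarith), hC₃]
      nlinarith
    · have := hcv j i h
      simp only [mul_comm (ψ j _ - p)] at this
      refine this.trans_eq ?_
      simp only [hρ]
      push_cast
      rw [abs_sub_comm]
  have hfin : ∀ Q : ℕ, (Q : ℝ) * p ≤ M * (C₃ * T) := by
    intro Q
    set U : (ℤ → A) → ℝ := fun ω => ∑ i ∈ Finset.range Q, (ψ i ω - p) with hU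
    have hUm : Measurable U := Finset.measurable_sum _ fun i _ => (hψm i).sub_const p
    have hSm := H.measurable_psum (Q * n)
    have hd : ∀ i ω, |ψ i ω - p| ≤ 2 := fun i ω => by
      refine (abs_sub _ _).trans ?_
      have := hψa i ω
      rw [abs_of_nonneg hp0]; linarith
    have hUb : ∀ ω, |U ω| ≤ Q * 2 := fun ω => by
      refine (Finset.abs_sum_le_sum_abs _ _).trans ((Finset.sum_le_sum fun i _ => hd i ω).trans ?_)
      simp
    have hUi : Integrable (fun ω => U ω ^ 2) P :=
      integrable_of_bdd (B := (Q * 2) ^ 2) (hUm.pow_const 2) fun ω => by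
        rw [abs_pow]; exact pow_le_pow_left₀ (abs_nonneg _) (hUb ω) 2
    have hii : ∀ i j, Integrable (fun ω => (ψ i ω - p) * (ψ j ω - p)) P := fun i j =>
      integrable_of_bdd (B := 2 * 2) (((hψm i).sub_const p).mul ((hψm j).sub_const p)) fun ω => by
        rw [abs_mul]; exact mul_le_mul (hd i ω) (hd j ω) (abs_nonneg _) zero_le_two
    have hU2 : ∫ ω, U ω ^ 2 ∂P ≤ Q * (C₃ * p * T) := by
      simp only [hU, sq, Finset.sum_mul_sum]
      rw [integral_finsetSum _ fun i _ => integrable_finsetSum _ fun j _ => hii i j]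
      have : ∀ i ∈ Finset.range Q, ∫ ω, ∑ j ∈ Finset.range Q, (ψ i ω - p) * (ψ j ω - p) ∂P ≤
          C₃ * p * T := fun i _ => by
        rw [integral_finsetSum _ fun j _ => hii i j]
        refine (Finset.sum_le_sum fun j _ => (le_abs_self _).trans (hcv' i j)).trans ?_
        rw [← Finset.mul_sum]
        refine mul_le_mul_of_nonneg_left (row (fun j => (j : ℤ) - i) ?_ _) (by positivity)
        intro x y h; simp only at h; omega
      refine (Finset.sum_le_sum this).trans (by simp)
    have hS2 := hM (Q * n)
    have hψS : ∀ i, Integrable (fun ω => ψ i ω * psum V (Q * n) ω) P := fun i =>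
      integrable_of_bdd (B := 1 * ((Q * n : ℕ) * B)) ((hψm i).mul hSm) fun ω => by
        rw [abs_mul]
        exact mul_le_mul (hψa i ω) (H.abs_psum_le _ ω) (abs_nonneg _) zero_le_one
    have hSi : Integrable (psum V (Q * n)) P := integrable_of_bdd hSm (H.abs_psum_le _)
    have hUS : ∫ ω, U ω * psum V (Q * n) ω ∂P =
        ∑ i ∈ Finset.range Q, ∫ ω, ψ i ω * psum V (Q * n) ω ∂P := by
      simp only [hU, Finset.sum_mul, sub_mul]
      have k1 : ∀ i, Integrable (fun ω => ψ i ω * psum V (Q * n) ω - p * psum V (Q * n) ω) P :=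
        fun i => (hψS i).sub (hSi.const_mul p)
      rw [integral_finsetSum _ fun i _ => k1 i]
      refine Finset.sum_congr rfl fun i _ => ?_
      rw [integral_sub (hψS i) (hSi.const_mul p), integral_const_mul, H.integral_psum, mul_zero,
        sub_zero]
    have hge : (Q : ℝ) * p ≤ ∫ ω, U ω * psum V (Q * n) ω ∂P := by
      rw [hUS]
      have := Finset.sum_le_sum fun i hi => hlow Q i (Finset.mem_range.1 hi)
      simpa using this
    set s := 1 / (C₃ * T) with hs
    have hs0 : 0 < s := by positivity
    have hsC : s * (C₃ * T) = 1 := by rw [hs]; field_simp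
    have hle : ∫ ω, U ω * psum V (Q * n) ω ∂P ≤
        s / 2 * (∫ ω, U ω ^ 2 ∂P) + 1 / (2 * s) * ∫ ω, psum V (Q * n) ω ^ 2 ∂P := by
      rw [← integral_const_mul, ← integral_const_mul,
        ← integral_add (hUi.const_mul _) ((H.integrable_psum_sq _).const_mul _)]
      refine integral_mono (integrable_of_bdd (B := (Q * 2) * ((Q * n : ℕ) * B)) (hUm.mul hSm)
        fun ω => ?_) ((hUi.const_mul _).add ((H.integrable_psum_sq _).const_mul _)) fun ω => ?_
      · rw [abs_mul]
        exact mul_le_mul (hUb ω) (H.abs_psum_le _ ω) (abs_nonneg _) (by positivity)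
      · have : 0 ≤ (s * U ω - psum V (Q * n) ω) ^ 2 / (2 * s) := by positivity
        have e : (s * U ω - psum V (Q * n) ω) ^ 2 / (2 * s) = s / 2 * U ω ^ 2 +
            1 / (2 * s) * psum V (Q * n) ω ^ 2 - U ω * psum V (Q * n) ω := by
          field_simp; ring
        simp only
        linarith
    have h1 : s / 2 * (∫ ω, U ω ^ 2 ∂P) ≤ Q * p / 2 := by
      calc _ ≤ s / 2 * (Q * (C₃ * p * T)) := by gcongr
        _ = Q * p / 2 * (s * (C₃ * T)) := by ring
        _ = _ := by rw [hsC, mul_one]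
    have h2 : 1 / (2 * s) * ∫ ω, psum V (Q * n) ω ^ 2 ∂P ≤ M * (C₃ * T) / 2 := by
      calc _ ≤ 1 / (2 * s) * M := by gcongr
        _ = M * (C₃ * T) / 2 := by rw [hs]; field_simp
    linarith
  have hpz : p = 0 := by
    by_contra hne
    have hpos : 0 < p := lt_of_le_of_ne hp0 (Ne.symm hne)
    obtain ⟨Q, hQ⟩ := exists_nat_gt (M * (C₃ * T) / p)
    rw [div_lt_iff₀ hpos] at hQ
    linarith [hfin Q]
  have hPE : P E = 0 := by
    rw [hpP] at hpz
    exact (measureReal_eq_zero_iff).1 hpz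
  filter_upwards [measure_eq_zero_iff_ae_notMem.1 hPE] with ω hω
  have h1 := (abs_le.1 (H.psum_trunc a n ω)).2
  have h2 : psum V n (trunc a 0 (n - 1) ω) ≤ θ := not_lt.1 hω
  linarith

end PotHyp

end PartialSums

section Dichotomy

variable {A : Type*} [MeasurableSpace A]
variable {P : Measure (ℤ → A)} {V : (ℤ → A) → ℝ} {r α B Cv Cm : ℝ}

namespace PotHyp

variable [IsProbabilityMeasure P]

/-- Unbounded variance forces a quantitative spread of the Birkhoff sums. -/
theorem exists_spread (H : PotHyp P V r α B Cv Cm)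
    (hM : ∀ M, ∃ n, M < ∫ ω, psum V n ω ^ 2 ∂P) :
    ∃ c > 0, ∀ K : ℝ, 1 ≤ K → ∃ n : ℕ, ∀ x : ℝ,
      P.real {ω | |psum V n ω - x| ≤ K} ≤ 1 - c / K ^ 2 := by
  obtain ⟨C, hC, hdbl⟩ := H.exists_doubling
  obtain ⟨m, hm⟩ := hM (2 * C + 1)
  have hB := H.B0
  have hpow : ∀ k : ℕ, 2 * C + 2 ^ k ≤ ∫ ω, psum V (2 ^ k * m) ω ^ 2 ∂P := by
    intro k
    induction k with
    | zero => simpa using hm.le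
    | succ k ih =>
      have := hdbl (2 ^ k * m)
      rw [show 2 ^ (k + 1) * m = 2 * (2 ^ k * m) by ring, pow_succ]
      linarith
  have hd : (0 : ℝ) < 8 * B * m + 1 := by positivity
  refine ⟨1 / (8 * B * m + 1) ^ 2, by positivity, fun K hK => ?_⟩
  obtain ⟨k, hk1, hk2⟩ := exists_nat_pow_near (x := 4 * K ^ 2) (y := (2 : ℝ)) (by nlinarith)
    (by norm_num)
  refine ⟨2 ^ k * m, fun x => ?_⟩
  set n := 2 ^ k * m with hn
  have ha : 2 * K ^ 2 ≤ ∫ ω, psum V n ω ^ 2 ∂P := by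
    have := hpow k
    rw [← hn] at this
    rw [pow_succ (2 : ℝ) k] at hk2
    linarith
  have hnle : (n : ℝ) ≤ 4 * K ^ 2 * m := by
    rw [hn]; push_cast; gcongr
  set Ev := {ω | |psum V n ω - x| ≤ K} with hEv
  have hmeas := H.measurable_psum n
  have hEm : MeasurableSet Ev :=
    measurableSet_le ((hmeas.sub_const x).abs) measurable_const
  have hK2 : 1 / (8 * B * m + 1) ^ 2 / K ^ 2 ≤ 1 := by
    rw [div_div, div_le_one (by positivity)]
    have h1 : (1 : ℝ) ≤ 8 * B * m + 1 := by
      have : (0 : ℝ) ≤ 8 * B * m := by positivity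
      linarith
    exact one_le_mul_of_one_le_of_one_le (one_le_pow₀ h1) (one_le_pow₀ hK)
  rcases Set.eq_empty_or_nonempty Ev with he | ⟨ω₀, hω₀⟩
  · rw [he]; simp only [measureReal_empty]; linarith
  have hx : |x| ≤ n * B + K := by
    have h1 := H.abs_psum_le n ω₀
    have h2 : |psum V n ω₀ - x| ≤ K := hω₀
    rw [abs_le] at *
    constructor <;> linarith
  set R := 2 * (n * B) + K with hR
  have hR0 : 0 < R := by positivity
  have hSx : ∀ ω, |psum V n ω - x| ≤ R := fun ω => by
    refine (abs_sub _ _).trans ?_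
    linarith [H.abs_psum_le n ω]
  have hi : Integrable (fun ω => (psum V n ω - x) ^ 2) P :=
    integrable_of_bdd (B := R ^ 2) ((hmeas.sub_const x).pow_const 2) fun ω => by
      rw [abs_pow]; exact pow_le_pow_left₀ (abs_nonneg _) (hSx ω) 2
  have hSi : Integrable (psum V n) P := integrable_of_bdd hmeas (H.abs_psum_le n)
  have hlow : 2 * K ^ 2 ≤ ∫ ω, (psum V n ω - x) ^ 2 ∂P := by
    have e : ∀ ω, (psum V n ω - x) ^ 2 = psum V n ω ^ 2 - 2 * x * psum V n ω + x ^ 2 :=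
      fun ω => by ring
    have k1 : Integrable (fun ω => psum V n ω ^ 2 - 2 * x * psum V n ω) P :=
      (H.integrable_psum_sq n).sub (hSi.const_mul _)
    simp only [e]
    rw [integral_add k1 (integrable_const _), integral_sub (H.integrable_psum_sq n)
      (hSi.const_mul _), integral_const_mul, H.integral_psum]
    simp only [integral_const, probReal_univ, smul_eq_mul]
    nlinarith [sq_nonneg x]
  have hup : ∫ ω, (psum V n ω - x) ^ 2 ∂P ≤ K ^ 2 + (1 - P.real Ev) * R ^ 2 := by
    have h1 : ∫ ω, (psum V n ω - x) ^ 2 ∂P ≤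
        ∫ ω, (K ^ 2 + Evᶜ.indicator (fun _ => R ^ 2) ω) ∂P := by
      refine integral_mono hi ((integrable_const _).add
        ((integrable_const _).indicator hEm.compl)) fun ω => ?_
      simp only [Set.indicator, Set.mem_compl_iff, ite_not]
      split_ifs with h
      · rw [← sq_abs]
        have h2 : |psum V n ω - x| ≤ K := h
        have := pow_le_pow_left₀ (abs_nonneg _) h2 2
        linarith
      · rw [← sq_abs]
        have := pow_le_pow_left₀ (abs_nonneg _) (hSx ω) 2
        nlinarith [sq_nonneg K]
    refine h1.trans_eq ?_
    rw [integral_add (integrable_const _) ((integrable_const _).indicator hEm.compl),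
      integral_indicator_const _ hEm.compl, probReal_compl_eq_one_sub hEm]
    simp
  have hRK : R ≤ K ^ 2 * (8 * B * m + 1) := by
    rw [hR]
    nlinarith
  have h3 : K ^ 2 ≤ (1 - P.real Ev) * (K ^ 2 * (8 * B * m + 1)) ^ 2 := by
    have h4 : 0 ≤ 1 - P.real Ev := by linarith [measureReal_le_one (μ := P) (s := Ev)]
    have h5 : R ^ 2 ≤ (K ^ 2 * (8 * B * m + 1)) ^ 2 := pow_le_pow_left₀ hR0.le hRK 2
    nlinarith [mul_le_mul_of_nonneg_left h5 h4]
  have hK0 : 0 < K ^ 2 := by positivity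
  have h6 : 1 / (8 * B * m + 1) ^ 2 / K ^ 2 ≤ 1 - P.real Ev := by
    rw [div_div, div_le_iff₀ (by positivity)]
    have h7 : (1 - P.real Ev) * (K ^ 2 * (8 * B * m + 1)) ^ 2 =
      K ^ 2 * ((1 - P.real Ev) * ((8 * B * m + 1) ^ 2 * K ^ 2)) := by ring
    rw [h7] at h3
    exact (le_mul_iff_one_le_right hK0).1 h3
  linarith

/-- Either the Birkhoff sums stay almost surely bounded along all orbits, or they spread. -/
theorem bounded_or_spread (H : PotHyp P V r α B Cv Cm) :
    (∃ K, ∀ᵐ ω ∂P, ∀ s n : ℕ, |psum V n (shiftn (s : ℤ) ω)| ≤ K) ∨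
    ∃ c > 0, ∀ K : ℝ, 1 ≤ K → ∃ n : ℕ, ∀ x : ℝ,
      P.real {ω | |psum V n ω - x| ≤ K} ≤ 1 - c / K ^ 2 := by
  by_cases h : ∀ M, ∃ n, M < ∫ ω, psum V n ω ^ 2 ∂P
  · exact Or.inr (H.exists_spread h)
  · push Not at h
    obtain ⟨M, hM⟩ := h
    left
    have hneg : ∀ n ω, psum (fun ω => -V ω) n ω = -psum V n ω := fun n ω => by
      simp [psum, Finset.sum_neg_distrib]
    obtain ⟨K, hK⟩ := H.exists_psum_le hM
    obtain ⟨K', hK'⟩ := H.neg.exists_psum_le (M := M) fun n => by simpa [hneg] using hM n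
    refine ⟨max K K', ?_⟩
    rw [ae_all_iff]; intro s
    rw [ae_all_iff]; intro n
    have h1 := (measurePreserving_shiftn H.inv s).quasiMeasurePreserving.ae (hK n)
    have h2 := (measurePreserving_shiftn H.inv s).quasiMeasurePreserving.ae (hK' n)
    filter_upwards [h1, h2] with ω h1 h2
    rw [hneg] at h2
    rw [abs_le]
    constructor
    · linarith [le_max_right K K']
    · exact h1.trans (le_max_left _ _)

end PotHyp

end Dichotomy

section Filter

/-- The solution of the linearized Riccati recursion started at zero. -/
def filt (κ : ℝ) (f : ℕ → ℝ) : ℕ → ℝ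
  | 0 => 0
  | n + 1 => Real.exp (-2 * κ) * filt κ f n - f n

theorem isFilt_filt (κ : ℝ) (f : ℕ → ℝ) : IsFilt κ f (filt κ f) := fun _ => rfl

theorem filt_eq_sum (κ : ℝ) (f : ℕ → ℝ) (n : ℕ) :
    filt κ f n = -∑ j ∈ Finset.range n, Real.exp (-2 * κ) ^ (n - 1 - j) * f j := by
  induction n with
  | zero => simp [filt]
  | succ n ih =>
    rw [Finset.sum_range_succ, filt, ih, mul_neg, Finset.mul_sum]
    have : ∀ j ∈ Finset.range n, Real.exp (-2 * κ) * (Real.exp (-2 * κ) ^ (n - 1 - j) * f j) =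
        Real.exp (-2 * κ) ^ (n + 1 - 1 - j) * f j := fun j hj => by
      have := Finset.mem_range.1 hj
      rw [← mul_assoc, ← pow_succ']
      congr 2; omega
    rw [Finset.sum_congr rfl this]
    simp
    ring

theorem filt_abs_le {κ K : ℝ} (hκ : 0 ≤ κ) {f : ℕ → ℝ}
    (hS : ∀ n, |∑ j ∈ Finset.range n, f j| ≤ K) (n : ℕ) : |filt κ f n| ≤ 2 * K := by
  have hq0 := Real.exp_pos (-2 * κ)
  have hq1 : Real.exp (-2 * κ) ≤ 1 := Real.exp_le_one_iff.2 (by linarith)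
  have hK : 0 ≤ K := (abs_nonneg _).trans (hS 0)
  have key : ∀ n, |filt κ f n + ∑ j ∈ Finset.range n, f j| ≤ K := by
    intro n
    induction n with
    | zero => simpa [filt] using hK
    | succ n ih =>
      rw [Finset.sum_range_succ, filt]
      have e : Real.exp (-2 * κ) * filt κ f n - f n + (∑ j ∈ Finset.range n, f j + f n) =
        Real.exp (-2 * κ) * (filt κ f n + ∑ j ∈ Finset.range n, f j) +
          (1 - Real.exp (-2 * κ)) * ∑ j ∈ Finset.range n, f j := by ring
      rw [e]
      have h2 := hS n
      rw [abs_le] at *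
      constructor <;> nlinarith
  have h1 := key n
  have h2 := hS n
  rw [abs_le] at *
  constructor <;> linarith

theorem sum_exp_sq_le {κ : ℝ} (hκ : 0 < κ) (hκ1 : κ ≤ 1 / 1000) (n : ℕ) :
    ∑ j ∈ Finset.range n, (Real.exp (-2 * κ) ^ (n - 1 - j)) ^ 2 ≤ 1 / κ := by
  have hq := exp_neg_two_le hκ hκ1
  have hq0 := Real.exp_pos (-2 * κ)
  have hq1 : Real.exp (-2 * κ) < 1 := by linarith
  rw [Finset.sum_range_reflect (fun j => (Real.exp (-2 * κ) ^ j) ^ 2)]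
  have h1 : ∀ j ∈ Finset.range n, (Real.exp (-2 * κ) ^ j) ^ 2 ≤ Real.exp (-2 * κ) ^ j :=
    fun j _ => by
      have := pow_le_one₀ (n := j) hq0.le hq1.le
      have h0 : 0 ≤ Real.exp (-2 * κ) ^ j := by positivity
      nlinarith
  refine (Finset.sum_le_sum h1).trans ?_
  refine ((summable_geometric_of_lt_one hq0.le hq1).sum_le_tsum _ fun j _ => by positivity).trans ?_
  rw [tsum_geometric_of_lt_one hq0.le hq1, ← one_div]
  exact one_div_le_one_div_of_le hκ (by linarith)

variable {A : Type*}

/-- The rescaled potential along the orbit of `ω`. -/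
def noise (ν : ℝ) (V : (ℤ → A) → ℝ) (ω : ℤ → A) (n : ℕ) : ℝ := ν * V (shiftn ((n : ℤ) + 1) ω)

variable [MeasurableSpace A]

theorem noise_shiftn (ν : ℝ) (V : (ℤ → A) → ℝ) (ω : ℤ → A) (s n : ℕ) :
    noise ν V (shiftn (s : ℤ) ω) n = noise ν V ω (s + n) := by
  simp only [noise, shiftn_add]
  congr 3
  push_cast
  ring

theorem sum_noise (ν : ℝ) (V : (ℤ → A) → ℝ) (ω : ℤ → A) (n : ℕ) :
    ∑ j ∈ Finset.range n, noise ν V ω j = ν * psum V n (shiftn 1 ω) := by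
  simp only [noise, psum, Finset.mul_sum]
  simp only [shiftn_add]

theorem filt_noise (κ ν : ℝ) (V : (ℤ → A) → ℝ) (ω : ℤ → A) (n : ℕ) :
    filt κ (noise ν V ω) n = -ν * ∑ j ∈ Finset.range n,
      Real.exp (-2 * κ) ^ (n - 1 - j) * V (shiftn (j : ℤ) (shiftn ((1 : ℕ) : ℤ) ω)) := by
  rw [filt_eq_sum, neg_mul ν, Finset.mul_sum, neg_inj]
  refine Finset.sum_congr rfl fun j _ => ?_
  simp only [noise, shiftn_add, Nat.cast_one]
  ring

variable {P : Measure (ℤ → A)} {V : (ℤ → A) → ℝ} {r α B Cv Cm : ℝ}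

namespace PotHyp

theorem measurable_noise (H : PotHyp P V r α B Cv Cm) (ν : ℝ) (n : ℕ) :
    Measurable fun ω => noise ν V ω n := (H.measV _).const_mul ν

theorem measurable_filt (H : PotHyp P V r α B Cv Cm) (κ ν : ℝ) (n : ℕ) :
    Measurable fun ω => filt κ (noise ν V ω) n := by
  induction n with
  | zero => exact measurable_const
  | succ n ih => exact (ih.const_mul _).sub (H.measurable_noise ν n)

theorem abs_noise_le (H : PotHyp P V r α B Cv Cm) {ν : ℝ} (hν : 0 ≤ ν) (ω : ℤ → A) (n : ℕ) :
    |noise ν V ω n| ≤ ν * B := by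
  rw [noise, abs_mul, abs_of_nonneg hν]
  exact mul_le_mul_of_nonneg_left (H.bdd _) hν

theorem abs_filt_le (H : PotHyp P V r α B Cv Cm) {κ ν : ℝ} (hκ : 0 ≤ κ) (hν : 0 ≤ ν)
    (ω : ℤ → A) (n : ℕ) : |filt κ (noise ν V ω) n| ≤ n * (ν * B) := by
  have hq1 : Real.exp (-2 * κ) ≤ 1 := Real.exp_le_one_iff.2 (by linarith)
  induction n with
  | zero => simp [filt]
  | succ n ih =>
    rw [filt]
    refine (abs_sub _ _).trans ?_
    rw [abs_mul, abs_of_pos (Real.exp_pos _)]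
    have := H.abs_noise_le hν ω n
    have h2 := mul_le_of_le_one_left (abs_nonneg (filt κ (noise ν V ω) n)) hq1
    push_cast
    linarith

variable [IsProbabilityMeasure P]

theorem integrable_filt (H : PotHyp P V r α B Cv Cm) {κ ν : ℝ} (hκ : 0 ≤ κ) (hν : 0 ≤ ν)
    (n : ℕ) : Integrable (fun ω => filt κ (noise ν V ω) n) P :=
  integrable_of_bdd (H.measurable_filt κ ν n) fun ω => H.abs_filt_le hκ hν ω n

theorem exists_integral_filt (H : PotHyp P V r α B Cv Cm) :
    ∃ C > 0, ∀ κ ν : ℝ, 0 < κ → κ ≤ 1 / 1000 → 0 ≤ ν → ∀ n,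
      ∫ ω, |filt κ (noise ν V ω) n| ∂P ≤ C * (ν / Real.sqrt κ) := by
  obtain ⟨C, hC, hvar⟩ := H.exists_var
  refine ⟨C + 1, by positivity, fun κ ν hκ hκ1 hν n => ?_⟩
  set W : (ℤ → A) → ℝ := fun ω => ∑ j ∈ Finset.range n,
    Real.exp (-2 * κ) ^ (n - 1 - j) * V (shiftn (j : ℤ) ω) with hW
  have hWm : Measurable W := Finset.measurable_sum _ fun j _ => (H.measV _).const_mul _
  have hq1 : Real.exp (-2 * κ) ≤ 1 := Real.exp_le_one_iff.2 (by linarith)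
  have hWb : ∀ ω, |W ω| ≤ n * B := fun ω => by
    refine (Finset.abs_sum_le_sum_abs _ _).trans ?_
    refine (Finset.sum_le_sum fun j _ => ?_).trans_eq (by simp : ∑ j ∈ Finset.range n, B = n * B)
    rw [abs_mul, abs_of_nonneg (by positivity)]
    exact (mul_le_of_le_one_left (abs_nonneg _)
      (pow_le_one₀ (Real.exp_pos _).le hq1)).trans (H.bdd _)
  have hW2 : ∫ ω, W ω ^ 2 ∂P ≤ C * (1 / κ) :=
    (hvar _ _).trans (mul_le_mul_of_nonneg_left (sum_exp_sq_le hκ hκ1 n) hC.le)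
  have hWi : Integrable (fun ω => W ω ^ 2) P :=
    integrable_of_bdd (B := (n * B) ^ 2) (hWm.pow_const 2) fun ω => by
      rw [abs_pow]; exact pow_le_pow_left₀ (abs_nonneg _) (hWb ω) 2
  have h1 : ∫ ω, |filt κ (noise ν V ω) n| ∂P = ν * ∫ ω, |W ω| ∂P := by
    rw [← integral_shiftn H.inv 1 (g := fun ω => |W ω|) hWm.abs, ← integral_const_mul]
    congr 1; funext ω
    rw [filt_noise, abs_mul, abs_neg, abs_of_nonneg hν]
  have hs : 0 < Real.sqrt κ := Real.sqrt_pos.2 hκ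
  have hss : Real.sqrt κ ^ 2 = κ := Real.sq_sqrt hκ.le
  have h2 : ∫ ω, |W ω| ∂P ≤ (C + 1) / Real.sqrt κ := by
    calc ∫ ω, |W ω| ∂P ≤ ∫ ω, (Real.sqrt κ * W ω ^ 2 + 1 / Real.sqrt κ) ∂P := by
          refine integral_mono (integrable_of_bdd (B := n * B) hWm.abs fun ω => by
            rw [abs_abs]; exact hWb ω) ((hWi.const_mul _).add (integrable_const _)) fun ω => ?_
          simp only
          rw [← sub_nonneg]
          have : Real.sqrt κ * W ω ^ 2 + 1 / Real.sqrt κ - |W ω| =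
              ((Real.sqrt κ * |W ω|) ^ 2 + 1 - Real.sqrt κ * |W ω|) / Real.sqrt κ := by
            field_simp
            rw [sq_abs]
          rw [this]
          refine div_nonneg ?_ hs.le
          nlinarith [sq_nonneg (Real.sqrt κ * |W ω| - 1 / 2)]
      _ = Real.sqrt κ * (∫ ω, W ω ^ 2 ∂P) + 1 / Real.sqrt κ := by
          rw [integral_add (hWi.const_mul _) (integrable_const _), integral_const_mul]
          simp
      _ ≤ Real.sqrt κ * (C * (1 / κ)) + 1 / Real.sqrt κ := by gcongr
      _ = _ := by
          rw [← hss, Real.sqrt_sq hs.le]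
          field_simp
  rw [h1]
  calc ν * ∫ ω, |W ω| ∂P ≤ ν * ((C + 1) / Real.sqrt κ) := by gcongr
    _ = _ := by ring

theorem exists_filt_tail (H : PotHyp P V r α B Cv Cm) :
    ∃ C > 0, ∀ κ ν t : ℝ, 0 < κ → κ ≤ 1 / 1000 → 0 < ν → 0 < t → ∀ g : ℕ, 1 ≤ g →
      t * g * C ≤ 1 → ∀ n ≤ 4 * g ^ 3, ∀ ε : ℝ,
      P.real {ω | ε < |filt κ (noise ν V ω) n|} ≤
        2 * C * Real.exp (C * t ^ 2 / κ - t * ε / ν) := by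
  obtain ⟨C, hC, hmom⟩ := H.exists_exp_moment
  refine ⟨C, hC, fun κ ν t hκ hκ1 hν ht g hg htg n hn ε => ?_⟩
  have hq1 : Real.exp (-2 * κ) ≤ 1 := Real.exp_le_one_iff.2 (by linarith)
  set w : ℕ → ℝ := fun j => if j < n then Real.exp (-2 * κ) ^ (n - 1 - j) else 0 with hw
  have hw1 : ∀ j, |w j| ≤ 1 := fun j => by
    simp only [hw]; split_ifs
    · rw [abs_of_nonneg (by positivity)]; exact pow_le_one₀ (Real.exp_pos _).le hq1
    · simp
  have hsub : Finset.range n ⊆ Finset.range (4 * g ^ 3) := Finset.range_subset_range.2 hn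
  have hwsum : ∀ c : ℕ → ℝ → ℝ, (∀ j, c j 0 = 0) → ∑ j ∈ Finset.range (4 * g ^ 3), c j (w j) =
      ∑ j ∈ Finset.range n, c j (Real.exp (-2 * κ) ^ (n - 1 - j)) := fun c hc => by
    rw [← Finset.sum_subset hsub]
    · exact Finset.sum_congr rfl fun j hj => by simp only [hw, if_pos (Finset.mem_range.1 hj)]
    · intro j _ hj
      rw [Finset.mem_range] at hj
      simp only [hw, if_neg hj, hc]
  set W : (ℤ → A) → ℝ := fun ω => ∑ j ∈ Finset.range (4 * g ^ 3), w j * V (shiftn (j : ℤ) ω)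
    with hW
  have hWm : Measurable W := Finset.measurable_sum _ fun j _ => (H.measV _).const_mul _
  have hWb : ∀ ω, |W ω| ≤ (4 * g ^ 3 : ℕ) * B := fun ω => by
    refine (Finset.abs_sum_le_sum_abs _ _).trans ?_
    refine (Finset.sum_le_sum fun j _ => ?_).trans_eq
      (by simp : ∑ j ∈ Finset.range (4 * g ^ 3), B = (4 * g ^ 3 : ℕ) * B)
    rw [abs_mul]
    exact (mul_le_of_le_one_left (abs_nonneg _) (hw1 j)).trans (H.bdd _)
  have hfin : ∀ τ : ℝ, Integrable (fun ω => Real.exp (τ * W ω)) P := fun τ =>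
    integrable_of_bdd (B := Real.exp (|τ| * ((4 * g ^ 3 : ℕ) * B)))
      (Real.measurable_exp.comp (hWm.const_mul τ)) fun ω => by
        rw [Real.abs_exp]
        refine Real.exp_le_exp.2 ((le_abs_self _).trans ?_)
        rw [abs_mul]
        exact mul_le_mul_of_nonneg_left (hWb ω) (abs_nonneg _)
  have hmgf : ∀ τ : ℝ, |τ| = t → ProbabilityTheory.mgf W P τ ≤ C * Real.exp (C * t ^ 2 / κ) := by
    intro τ hτ
    refine (hmom g hg w hw1 τ (by rw [hτ]; exact htg)).trans ?_
    refine mul_le_mul_of_nonneg_left (Real.exp_le_exp.2 ?_) hC.le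
    rw [hwsum (fun _ x => x ^ 2) (fun j => by simp), ← sq_abs τ, hτ, mul_div_assoc, mul_assoc]
    refine mul_le_mul_of_nonneg_left ?_ hC.le
    rw [div_eq_mul_one_div (t ^ 2)]
    exact mul_le_mul_of_nonneg_left (sum_exp_sq_le hκ hκ1 n) (by positivity)
  have h1 : P.real {ω | ε < |filt κ (noise ν V ω) n|} = P.real {ω | ε < ν * |W ω|} := by
    have hm : MeasurableSet {ω | ε < ν * |W ω|} :=
      measurableSet_lt measurable_const (hWm.abs.const_mul ν)
    have := (measurePreserving_shiftn H.inv 1).measureReal_preimage hm.nullMeasurableSet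
    rw [← this]
    congr 1
    ext ω
    simp only [Set.mem_ofPred_eq, Set.mem_preimage, filt_noise, hW]
    rw [hwsum (fun j x => x * V (shiftn (j : ℤ) (shiftn ((1 : ℕ) : ℤ) ω))) (fun j => by simp),
      abs_mul, abs_neg, abs_of_pos hν]
  rw [h1]
  have hup := ProbabilityTheory.measure_ge_le_exp_mul_mgf (μ := P) (X := W) (ε / ν) ht.le (hfin t)
  have hdn := ProbabilityTheory.measure_le_le_exp_mul_mgf (μ := P) (X := W) (-(ε / ν)) (t := -t)
    (by linarith) (hfin (-t))
  have hle : P.real {ω | ε < ν * |W ω|} ≤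
      P.real {ω | ε / ν ≤ W ω} + P.real {ω | W ω ≤ -(ε / ν)} := by
    refine (measureReal_mono ?_).trans (measureReal_union_le _ _)
    intro ω hω
    have h3 : ε / ν < |W ω| := by
      rw [div_lt_iff₀ hν, mul_comm]; exact hω
    rcases lt_abs.1 h3 with h | h
    · exact Or.inl h.le
    · exact Or.inr (by simp only [Set.mem_ofPred_eq]; linarith)
  have m1 := hmgf t (abs_of_pos ht)
  have m2 := hmgf (-t) (by rw [abs_neg, abs_of_pos ht])
  have he : Real.exp (C * t ^ 2 / κ - t * ε / ν) =
      Real.exp (-t * (ε / ν)) * Real.exp (C * t ^ 2 / κ) := by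
    rw [← Real.exp_add]; congr 1; ring
  rw [show - -t * -(ε / ν) = -t * (ε / ν) by ring] at hdn
  rw [he]
  have hp := Real.exp_pos (-t * (ε / ν))
  have k1 := mul_le_mul_of_nonneg_left m1 hp.le
  have k2 := mul_le_mul_of_nonneg_left m2 hp.le
  linarith

end PotHyp

end Filter

section Escape

/-- The scale separation between the exponent `κ`, the noise strength `ν` and the block length,
quantified by a large constant `M`. -/
structure Scale (M κ ν : ℝ) (h : ℕ) : Prop where
  κ0 : 0 < κ
  ν0 : 0 < ν
  M1 : 1000 ≤ M
  hκ : M * κ ≤ 1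
  hν : M * ν ≤ κ
  hκ3 : M * κ ^ 3 ≤ ν
  hh : M ≤ h
  hpow : M * (κ * (1 - κ / 2) ^ h) ≤ ν
  hcontr : (1 - κ / 5) ^ (2 * h) ≤ 1 / 2
  hexp : 1.1 < (1 + 0.3 * κ) ^ h * (2.4 * κ)

namespace Scale

variable {M κ ν : ℝ} {h : ℕ}

theorem κ1 (S : Scale M κ ν h) : κ ≤ 1 / 1000 := by
  nlinarith [S.hκ, S.M1, S.κ0]

theorem mono (S : Scale M κ ν h) {M' : ℝ} (hM : 1000 ≤ M') (hle : M' ≤ M) : Scale M' κ ν h := by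
  have h1 := S.κ0
  have h2 := S.ν0
  have h4 := S.κ1
  have h3 : 0 ≤ κ * (1 - κ / 2) ^ h := mul_nonneg h1.le (pow_nonneg (by linarith) _)
  exact ⟨h1, h2, hM, (mul_le_mul_of_nonneg_right hle h1.le).trans S.hκ,
    (mul_le_mul_of_nonneg_right hle h2.le).trans S.hν,
    (mul_le_mul_of_nonneg_right hle (by positivity)).trans S.hκ3, hle.trans S.hh,
    (mul_le_mul_of_nonneg_right hle h3).trans S.hpow, S.hcontr, S.hexp⟩

theorem contr_pow (S : Scale M κ ν h) {n : ℕ} (hn : 2 * h ≤ n) : (1 - κ / 5) ^ n ≤ 1 / 2 :=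
  (pow_le_pow_of_le_one (by linarith [S.κ1]) (by linarith [S.κ0]) hn).trans S.hcontr

theorem trapped (S : Scale M κ ν h) {B : ℝ} (hB : 10 * B ≤ M) {f u Z : ℕ → ℝ}
    (hf : ∀ n, |f n| ≤ ν * B)
    (hu : IsSol κ f u) (hne : ¬(u 1 = 0 ∧ u 0 = 0)) (hZ : IsFilt κ f Z)
    (good : ∀ n ≤ 4 * h + 4, |Z n| ≤ κ / 100)
    (hend : ¬InCone κ 1.5 (u (4 * h + 4 + 1)) (u (4 * h + 4))) :
    u 0 ≠ 0 ∧ -(2.5 * κ) ≤ ric κ u 0 ∧ ric κ u 0 ≤ -(1.7 * κ) ∧ |ric κ u 0 - yb κ h f| ≤ ν := by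
  have hκ := S.κ0
  have hκ1 := S.κ1
  have hr := ric_of_not_inCone hκ hκ1 hu hne hZ (M := 2 * h + 1) good (by omega)
    (S.contr_pow (by omega)) hend
  have hge := ric_ge hκ hκ1 (y := ric κ u) hZ (h := h) (fun n hn => good n (by omega))
    (fun n hn => ⟨(hr n (by omega)).2.2.1, (hr n (by omega)).2.2.2.1⟩)
    (fun n hn => (hr n (by omega)).2.2.2.2) S.hexp
  have h0 := hr 0 (by omega)
  refine ⟨h0.1, hge 0 (by omega), h0.2.2.2.1.le, ?_⟩
  have hf' : ∀ n, |f n| ≤ κ / 10 := fun n => by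
    refine (hf n).trans ?_
    have := mul_le_mul_of_nonneg_right hB S.ν0.le
    have := S.hν
    linarith
  refine (yb_trapped hκ hκ1 h f (ric κ u) (fun n hn => ⟨hge n hn,
    (hr n (by omega)).2.2.2.1.le⟩) (fun n _ => hf' n)
    fun n hn => (hr n (by omega)).2.2.2.2).trans ?_
  have h3 : 0 ≤ κ * (1 - κ / 2) ^ h := mul_nonneg hκ.le (pow_nonneg (by linarith) _)
  have := S.hpow
  have := S.M1
  nlinarith

end Scale

theorem measurable_yb {Ω : Type*} [MeasurableSpace Ω] (κ : ℝ) (k : ℕ) {f : Ω → ℕ → ℝ}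
    (hf : ∀ n, Measurable fun ω => f ω n) : Measurable fun ω => yb κ k (f ω) := by
  induction k generalizing f with
  | zero => exact measurable_const
  | succ k ih =>
    have h1 := (ih (f := fun ω n => f ω (n + 1)) fun n => hf (n + 1)).add (hf 0)
    have h2 : Measurable fun ω => clip κ (yb κ k (fun n => f ω (n + 1)) + f ω 0) :=
      measurable_const.max (measurable_const.min h1)
    exact h2.div (measurable_const.sub h2)

theorem measurable_solSeq {Ω : Type*} [MeasurableSpace Ω] (x z : ℝ) {e : Ω → ℕ → ℝ}
    (he : ∀ n, Measurable fun ω => e ω n) (n : ℕ) : Measurable fun ω => solSeq (e ω) x z n := by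
  have : Measurable (fun ω => solSeq (e ω) x z n) ∧
      Measurable fun ω => solSeq (e ω) x z (n + 1) := by
    induction n with
    | zero => exact ⟨measurable_const, measurable_const⟩
    | succ n ih => exact ⟨ih.2, ((he n).mul ih.2).sub ih.1⟩
  exact this.1

variable {A : Type*} [MeasurableSpace A]
variable {P : Measure (ℤ → A)} {V : (ℤ → A) → ℝ} {r α B Cv Cm : ℝ}

namespace PotHyp

variable [IsProbabilityMeasure P]

/-- The contracting direction determined by the future does not concentrate at the scale of the
noise if the Birkhoff sums spread. -/
theorem exists_escape (H : PotHyp P V r α B Cv Cm) {K c : ℝ} {n : ℕ} (hK : 1 ≤ K)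
    (hn : ∀ x, P.real {ω | |psum V n ω - x| ≤ 3 * K + 2} ≤ 1 - c) :
    ∃ M ≥ 1000, ∀ κ ν h, Scale M κ ν h → ∀ d, -(2.7 * κ) ≤ d → d ≤ -(1.6 * κ) →
      P.real {ω | |yb κ h (noise ν V ω) - d| ≤ K * ν} ≤ 1 - c / 2 := by
  have hB := H.B0
  set N := (n : ℝ) with hN
  have hN0 : 0 ≤ N := Nat.cast_nonneg n
  have hK0 : 0 ≤ K := by linarith
  have hM : 0 ≤ N + 40 * (2 * K + N * B) + 400 * N + 3 * 2 ^ n + 20 * N * K + 10 * N ^ 2 * B +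
    100 * N ^ 2 := by positivity
  refine ⟨1000 + N + 40 * (2 * K + N * B) + 400 * N + 3 * 2 ^ n + 20 * N * K + 10 * N ^ 2 * B +
    100 * N ^ 2, by linarith, fun κ ν h S d hd1 hd2 => ?_⟩
  set M := 1000 + N + 40 * (2 * K + N * B) + 400 * N + 3 * 2 ^ n + 20 * N * K + 10 * N ^ 2 * B +
    100 * N ^ 2 with hM
  have p1 : 0 ≤ N * B := by positivity
  have p2 : 0 ≤ N * K := by positivity
  have p3 : 0 ≤ N ^ 2 * B := by positivity
  have p4 : 0 ≤ N ^ 2 := by positivity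
  have p5 : (0 : ℝ) ≤ 3 * 2 ^ n := by positivity
  have hκ := S.κ0
  have hκ1 := S.κ1
  have hν := S.ν0
  have hnh : n ≤ h := by
    have := S.hh
    have : (n : ℝ) ≤ h := by linarith
    exact_mod_cast this
  obtain ⟨k, rfl⟩ := Nat.exists_eq_add_of_le hnh
  have hκ2 : M * κ ^ 2 ≤ κ := by nlinarith [S.hκ]
  have hk : (1 - κ / 2) ^ k * (3 * κ) ≤ K * ν := by
    have h1 := S.hpow
    have h2 : (1 / 2 : ℝ) ^ n ≤ (1 - κ / 2) ^ n := pow_le_pow_left₀ (by norm_num) (by linarith) n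
    have h3 : 0 ≤ κ * (1 - κ / 2) ^ k := mul_nonneg hκ.le (pow_nonneg (by linarith) _)
    rw [pow_add] at h1
    have h4 : 3 * 2 ^ n * ((1 / 2) ^ n * (κ * (1 - κ / 2) ^ k)) ≤
        M * ((1 - κ / 2) ^ n * (κ * (1 - κ / 2) ^ k)) := by
      refine mul_le_mul (by linarith) (mul_le_mul_of_nonneg_right h2 h3) (by positivity)
        (by linarith [S.M1])
    have h5 : (3 * 2 ^ n * ((1 / 2) ^ n * (κ * (1 - κ / 2) ^ k)) : ℝ) =
        (1 - κ / 2) ^ k * (3 * κ) := by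
      rw [one_div, inv_pow]; field_simp
    nlinarith
  have he : 2 * (K * ν) + N * (ν * B + 10 * κ ^ 2) ≤ κ / 20 := by
    have h1 : 40 * (2 * K + N * B) * ν ≤ M * ν :=
      mul_le_mul_of_nonneg_right (by linarith) hν.le
    have h2 : 400 * N * κ ^ 2 ≤ M * κ ^ 2 :=
      mul_le_mul_of_nonneg_right (by linarith) (by positivity)
    have := S.hν
    linarith
  have herr : 3 * (K * ν) + N * (10 * κ * (2 * (K * ν) + N * (ν * B + 10 * κ ^ 2))) ≤
      (3 * K + 2) * ν := by
    have h1 : (20 * N * K + 10 * N ^ 2 * B) * κ ≤ M * κ :=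
      mul_le_mul_of_nonneg_right (by linarith) hκ.le
    have h2 : 100 * N ^ 2 * κ ^ 3 ≤ M * κ ^ 3 :=
      mul_le_mul_of_nonneg_right (by linarith) (by positivity)
    have h3 := mul_le_mul_of_nonneg_right (h1.trans S.hκ) hν.le
    have := S.hκ3
    linarith
  set Ev := {ω | |yb κ (n + k) (noise ν V ω) - d| ≤ K * ν} with hEv
  have hEm : MeasurableSet Ev := measurableSet_le
    ((measurable_yb κ (n + k) fun j => H.measurable_noise ν j).sub_const d).abs measurable_const
  set Ev' := shiftn (n : ℤ) ⁻¹' Ev with hEv'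
  have hEm' : MeasurableSet Ev' := measurable_shiftn _ hEm
  have hEP : P.real Ev' = P.real Ev :=
    (measurePreserving_shiftn H.inv n).measureReal_preimage hEm.nullMeasurableSet
  set x := -(N * (psi κ d - d)) / ν with hx
  set G := {ω | |psum V n ω - x| ≤ 3 * K + 2} with hG
  have hGm : MeasurableSet G :=
    measurableSet_le ((H.measurable_psum n).sub_const x).abs measurable_const
  have hGP : P.real (shiftn ((1 : ℕ) : ℤ) ⁻¹' G) = P.real G :=
    (measurePreserving_shiftn H.inv 1).measureReal_preimage hGm.nullMeasurableSet
  have hsub : Ev ∩ Ev' ⊆ shiftn ((1 : ℕ) : ℤ) ⁻¹' G := by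
    rintro ω ⟨h1, h2⟩
    simp only [hEv', hEv, Set.mem_preimage, Set.mem_ofPred_eq] at h1 h2
    have e : noise ν V (shiftn (n : ℤ) ω) = fun j => noise ν V ω (n + j) :=
      funext fun j => noise_shiftn ν V ω n j
    rw [e] at h2
    have := sum_noise_of_yb hκ hκ1 k n hd1 hd2 (by positivity) (noise ν V ω)
      (H.abs_noise_le hν.le ω) hk h1 h2 he
    rw [sum_noise] at this
    have h3 := this.trans herr
    have e2 : ν * psum V n (shiftn 1 ω) + N * (psi κ d - d) =
        ν * (psum V n (shiftn 1 ω) - x) := by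
      rw [hx]; field_simp; ring
    rw [e2, abs_mul, abs_of_pos hν, mul_comm (3 * K + 2)] at h3
    exact le_of_mul_le_mul_left h3 hν
  have h1 : P.real (Ev ∩ Ev') ≤ 1 - c := (measureReal_mono hsub).trans (hGP.le.trans (hn x))
  have h2 := measureReal_union_add_inter (μ := P) (s := Ev) hEm'
  have h3 : P.real (Ev ∪ Ev') ≤ 1 := measureReal_le_one
  linarith

end PotHyp

end Escape

section Truncation

variable {A : Type*}

/-- The orbit started in the expanding direction. -/
def orbit (κ ν : ℝ) (V : (ℤ → A) → ℝ) (ω : ℤ → A) : ℕ → ℝ :=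
  solSeq (energy κ (noise ν V ω)) 1 0

theorem isSol_orbit (κ ν : ℝ) (V : (ℤ → A) → ℝ) (ω : ℤ → A) :
    IsSol κ (noise ν V ω) (orbit κ ν V ω) := isSol_solSeq _ _ _ _

/-- The orbit is outside the expanding cone at time `s`. -/
def exitSet (κ ν : ℝ) (V : (ℤ → A) → ℝ) (s : ℕ) : Set (ℤ → A) :=
  {ω | ¬InCone κ 1.5 (orbit κ ν V ω (s + 1)) (orbit κ ν V ω s)}

/-- The filtered noise is large somewhere in the first block. -/
def badSet (κ ν : ℝ) (V : (ℤ → A) → ℝ) (h : ℕ) : Set (ℤ → A) :=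
  {ω | ∃ n ≤ 4 * h + 4, κ / 100 < |filt κ (noise ν V ω) n|}

variable [MeasurableSpace A]
variable {P : Measure (ℤ → A)} {V : (ℤ → A) → ℝ} {r α B Cv Cm : ℝ}

theorem isSol_orbit_shift (κ ν : ℝ) (V : (ℤ → A) → ℝ) (ω : ℤ → A) (s : ℕ) :
    IsSol κ (noise ν V (shiftn (s : ℤ) ω)) (fun n => orbit κ ν V ω (s + n)) := by
  have := (isSol_orbit κ ν V ω).shift s
  simpa only [← noise_shiftn] using this

/-- The noise seen from time `s`, cut off near the origin and in the far future. -/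
def futureNoise (ν : ℝ) (V : (ℤ → A) → ℝ) (a : A) (s gap h : ℕ) (ω : ℤ → A) (j : ℕ) : ℝ :=
  if j < gap then 0 else noise ν V (trunc a (s + gap) (s + 2 * h + 2) ω) (s + j)

namespace PotHyp

theorem measurable_orbit (H : PotHyp P V r α B Cv Cm) (κ ν : ℝ) (n : ℕ) :
    Measurable fun ω => orbit κ ν V ω n :=
  measurable_solSeq 1 0 (fun j => measurable_const.sub ((H.measurable_noise ν j).const_mul _)) n

theorem measurableSet_exitSet (H : PotHyp P V r α B Cv Cm) (κ ν : ℝ) (s : ℕ) :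
    MeasurableSet (exitSet κ ν V s) := by
  have h1 := H.measurable_orbit κ ν s
  have h2 := H.measurable_orbit κ ν (s + 1)
  refine MeasurableSet.compl (MeasurableSet.inter ?_ (MeasurableSet.compl ?_))
  · exact measurableSet_le ((h1.pow_const 2).const_mul _) (h2.mul h1)
  · exact MeasurableSet.inter (h2 (measurableSet_singleton 0)) (h1 (measurableSet_singleton 0))

theorem measurableSet_badSet (H : PotHyp P V r α B Cv Cm) (κ ν : ℝ) (h : ℕ) :
    MeasurableSet (badSet κ ν V h) := by
  have : badSet κ ν V h = ⋃ n ∈ Finset.range (4 * h + 5),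
      {ω | κ / 100 < |filt κ (noise ν V ω) n|} := by
    ext ω
    simp only [badSet, Set.mem_ofPred_eq, Set.mem_iUnion, Finset.mem_range, exists_prop]
    exact exists_congr fun n => and_congr_left fun _ => by omega
  rw [this]
  exact Finset.measurableSet_biUnion _ fun n _ =>
    measurableSet_lt measurable_const (H.measurable_filt κ ν n).abs

theorem energy_close (H : PotHyp P V r α B Cv Cm) {κ ν : ℝ} (hκ : 0 < κ) (hκ1 : κ ≤ 1 / 1000)
    (hν : 0 ≤ ν) (ω : ℤ → A) (n : ℕ) :
    |energy κ (noise ν V ω) n - 2| ≤ 3 * κ + 2 * (ν * B) := by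
  have h1 := H.abs_noise_le hν ω n
  have h2 := Real.abs_exp_sub_one_le (x := κ) (by rw [abs_of_pos hκ]; linarith)
  have h3 := Real.add_one_le_exp (-κ)
  have h4 : Real.exp (-κ) ≤ 1 := Real.exp_le_one_iff.2 (by linarith)
  rw [abs_of_pos hκ] at h2
  have h5 : |Real.exp κ * noise ν V ω n| ≤ 2 * (ν * B) := by
    rw [abs_mul, abs_of_pos (Real.exp_pos κ)]
    exact mul_le_mul (by linarith [(abs_le.1 h2).2]) h1 (abs_nonneg _) zero_le_two
  unfold energy
  rw [abs_le] at *
  constructor <;> linarith [h2.1, h2.2, h5.1, h5.2]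

theorem noise_trunc_close (H : PotHyp P V r α B Cv Cm) {ν : ℝ} (hν : 0 ≤ ν) (a : A) {l h : ℤ}
    {n w : ℕ} (hl : l ≤ n + 1 - w) (hh : n + 1 + w ≤ h) (ω : ℤ → A) :
    |noise ν V ω n - noise ν V (trunc a l h ω) n| ≤ ν * Cv * r ^ w := by
  rw [noise, noise, ← mul_sub, abs_mul, abs_of_nonneg hν, mul_assoc]
  exact mul_le_mul_of_nonneg_left (H.trunc_close a (n := n + 1) hl hh ω) hν

/-- The Riccati variable at time `s` depends only on the coordinates in `[-s, s]` up to an error of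
the order of the noise. -/
theorem exists_past_trunc (H : PotHyp P V r α B Cv Cm) :
    ∃ K ≥ 0, ∃ M ≥ 1000, ∀ κ ν h, Scale M κ ν h → ∀ (a : A) (s : ℕ) (ω : ℤ → A),
      let u := orbit κ ν V ω
      let u' := orbit κ ν V (trunc a (-s) s ω)
      (u s ≠ 0 → -(3 * κ) ≤ ric κ u s → ric κ u s ≤ 0 →
        u' s ≠ 0 ∧ |ric κ u s - ric κ u' s| ≤ K * ν) ∧
      (u' s ≠ 0 → -(3 * κ) ≤ ric κ u' s → ric κ u' s ≤ 0 →
        u s ≠ 0 ∧ |ric κ u' s - ric κ u s| ≤ K * ν) := by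
  have hr := H.r0
  have hr1 := H.r1
  have hB := H.B0
  have hCv := H.Cv0
  set σ := (1 - r) / 8 with hσ
  have hσ0 : 0 < σ := by rw [hσ]; linarith
  have hσ1 : σ ≤ 1 := by rw [hσ]; linarith
  set θ := (1 + 2 * σ) ^ 2 * r with hθ
  have hθ1 : θ < 1 := by
    have e : 1 - θ = (1 - r) * (1 - r / 2 - r * (1 - r) / 16) := by rw [hθ, hσ]; ring
    have : 0 < (1 - r) * (1 - r / 2 - r * (1 - r) / 16) :=
      mul_pos (by linarith) (by nlinarith)
    linarith
  set E₀ := (1 + 1 / σ) * (2 * Cv / r) / (1 - θ) with hE₀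
  have hE₀0 : 0 ≤ E₀ := by
    have : 0 < 1 - θ := by linarith
    positivity
  set K := 2 * (3 + 2 * σ) * (2 + 1 / σ) * E₀ with hK
  have hK0 : 0 ≤ K := by positivity
  have hq : 0 ≤ (3 + 2 * B) / σ ^ 2 := by positivity
  refine ⟨K, hK0, 1000 + (3 + 2 * B) / σ ^ 2 + K, by linarith, fun κ ν h S a s ω => ?_⟩
  set M := 1000 + (3 + 2 * B) / σ ^ 2 + K with hM
  have hκ := S.κ0
  have hκ1 := S.κ1
  have hν := S.ν0
  have hM1 : 1 ≤ M := by linarith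
  have hνκ : ν ≤ κ := by nlinarith [S.hν]
  have hs : 3 * κ + 2 * (ν * B) ≤ σ ^ 2 := by
    have h1 : (3 + 2 * B) / σ ^ 2 * κ ≤ 1 :=
      (mul_le_mul_of_nonneg_right (by linarith) hκ.le).trans S.hκ
    rw [div_mul_eq_mul_div, div_le_one (by positivity)] at h1
    nlinarith
  have hs1 : 3 * κ + 2 * (ν * B) ≤ σ := hs.trans (by nlinarith)
  have hs2 : (3 * κ + 2 * (ν * B)) * (1 + 1 / σ) ≤ 1 + 2 * σ - 1 := by
    calc _ ≤ σ ^ 2 * (1 + 1 / σ) := by gcongr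
      _ = σ * (σ + 1) := by field_simp
      _ ≤ _ := by nlinarith
  have hKν : K * ν ≤ 1 := by
    have h1 : K * ν ≤ M * ν := mul_le_mul_of_nonneg_right (by linarith) hν.le
    linarith [S.hν]
  have hexp2 : Real.exp κ ≤ 2 := by
    have h2 := Real.abs_exp_sub_one_le (x := κ) (by rw [abs_of_pos hκ]; linarith)
    rw [abs_of_pos hκ] at h2
    linarith [(abs_le.1 h2).2]
  have hee : ∀ n < s, |energy κ (noise ν V ω) n - energy κ (noise ν V (trunc a (-s) s ω)) n| ≤
      2 * Cv / r * ν * r ^ (s - n) := by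
    intro n hn
    have h1 := H.noise_trunc_close hν.le a (l := -s) (h := s) (n := n) (w := s - n - 1)
      (by omega) (by omega) ω
    have e : energy κ (noise ν V ω) n - energy κ (noise ν V (trunc a (-s) s ω)) n =
        -(Real.exp κ * (noise ν V ω n - noise ν V (trunc a (-s) s ω) n)) := by
      unfold energy; ring
    rw [e, abs_neg, abs_mul, abs_of_pos (Real.exp_pos κ)]
    refine (mul_le_mul hexp2 h1 (abs_nonneg _) zero_le_two).trans_eq ?_
    rw [show s - n = s - n - 1 + 1 by omega, pow_succ]
    field_simp
    congr 2
    omega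
  have hD : 0 ≤ 2 * Cv / r * ν := by positivity
  have hEν : (1 + 1 / σ) * (2 * Cv / r * ν) / (1 - θ) = E₀ * ν := by rw [hE₀]; ring
  have hE1 : 2 * (3 + 2 * σ) * (2 + 1 / σ) * (E₀ * ν) = K * ν := by rw [hK]; ring
  have c1 := state_close hσ0 le_rfl hs2 hs1 hr hD hθ.symm hθ1
    (isSol_orbit κ ν V ω) (isSol_orbit κ ν V (trunc a (-s) s ω)) rfl rfl
    (H.energy_close hκ hκ1 hν.le ω) (H.energy_close hκ hκ1 hν.le _) hee
  have c2 := state_close hσ0 le_rfl hs2 hs1 hr hD hθ.symm hθ1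
    (isSol_orbit κ ν V (trunc a (-s) s ω)) (isSol_orbit κ ν V ω) rfl rfl
    (H.energy_close hκ hκ1 hν.le _) (H.energy_close hκ hκ1 hν.le ω)
    (fun n hn => by rw [abs_sub_comm]; exact hee n hn)
  rw [hEν] at c1 c2
  have hE0 : 0 ≤ E₀ * ν := by positivity
  constructor
  · intro g1 g2 g3
    have := ric_close hκ hκ1 hσ0 hE0 g1 g2 g3 c1 (by rw [hE1]; exact hKν)
    rwa [hE1] at this
  · intro g1 g2 g3
    have := ric_close hκ hκ1 hσ0 hE0 g1 g2 g3 c2 (by rw [hE1]; exact hKν)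
    rwa [hE1] at this

theorem futureNoise_close (H : PotHyp P V r α B Cv Cm) {κ ν : ℝ} (hκ : 0 < κ)
    (hκ1 : κ ≤ 1 / 1000) (hν : 0 ≤ ν) (a : A) (s gap h : ℕ) (ω : ℤ → A) :
    |yb κ h (noise ν V (shiftn (s : ℤ) ω)) - yb κ h (futureNoise ν V a s gap h ω)| ≤
      (gap * (B + Cv) + Cv / (1 - r)) * ν := by
  have hr := H.r0
  have hr1 := H.r1
  have hB := H.B0
  have hCv := H.Cv0
  refine (yb_lip hκ hκ1 h _ _).trans ?_
  have hj : ∀ j ∈ Finset.range h, |noise ν V (shiftn (s : ℤ) ω) j -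
      futureNoise ν V a s gap h ω j| ≤ (if j < gap then ν * B else 0) + ν * Cv * r ^ (j - gap) := by
    intro j hj
    have hjh := Finset.mem_range.1 hj
    rw [futureNoise]
    split_ifs with hg
    · rw [sub_zero]
      have := H.abs_noise_le hν (shiftn (s : ℤ) ω) j
      have h0 : 0 ≤ ν * Cv * r ^ (j - gap) := by positivity
      linarith
    · rw [noise_shiftn, zero_add]
      exact H.noise_trunc_close hν a (w := j - gap) (by push_cast; omega) (by push_cast; omega) ω
  refine (Finset.sum_le_sum hj).trans ?_
  rw [Finset.sum_add_distrib, ← Finset.mul_sum]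
  have h1 : ∑ j ∈ Finset.range h, (if j < gap then ν * B else 0) ≤ gap * (ν * B) := by
    rw [← Finset.sum_filter, Finset.sum_const, nsmul_eq_mul]
    refine mul_le_mul_of_nonneg_right ?_ (by positivity)
    have : ((Finset.range h).filter (· < gap)) ⊆ Finset.range gap := fun j hj => by
      simp only [Finset.mem_filter, Finset.mem_range] at hj ⊢; exact hj.2
    exact_mod_cast (Finset.card_le_card this).trans (Finset.card_range gap).le
  have h2 : ∑ j ∈ Finset.range h, r ^ (j - gap) ≤ gap + 1 / (1 - r) := by
    calc ∑ j ∈ Finset.range h, r ^ (j - gap)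
        ≤ ∑ j ∈ Finset.range (gap + h), r ^ (j - gap) :=
          Finset.sum_le_sum_of_subset_of_nonneg (Finset.range_mono (by omega))
            fun j _ _ => by positivity
      _ = ∑ j ∈ Finset.range gap, r ^ (j - gap) + ∑ j ∈ Finset.range h, r ^ j := by
          rw [Finset.sum_range_add]
          simp only [Nat.add_sub_cancel_left]
      _ ≤ gap + 1 / (1 - r) := by
          refine add_le_add ?_ ?_
          · calc _ ≤ ∑ j ∈ Finset.range gap, (1 : ℝ) :=
                  Finset.sum_le_sum fun j _ => pow_le_one₀ hr.le hr1.le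
              _ = gap := by simp
          · rw [one_div, ← tsum_geometric_of_lt_one hr.le hr1]
            exact (summable_geometric_of_lt_one hr.le hr1).sum_le_tsum _ fun j _ => by positivity
  have h3 := mul_le_mul_of_nonneg_left h2 (mul_nonneg hν hCv.le)
  have h4 : ν * Cv * (gap + 1 / (1 - r)) = gap * (ν * Cv) + Cv / (1 - r) * ν := by ring
  linarith

end PotHyp

end Truncation

section ExitProbability

variable {A : Type*} [MeasurableSpace A]
variable {P : Measure (ℤ → A)} {V : (ℤ → A) → ℝ} {r α B Cv Cm : ℝ}

theorem localOn_futureNoise (ν : ℝ) (V : (ℤ → A) → ℝ) (a : A) (s gap h : ℕ) :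
    LocalOn (s + gap : ℤ) (s + 2 * h + 2 : ℤ) (futureNoise ν V a s gap h) := fun ω ω' hω => by
  funext j
  simp only [futureNoise, trunc_congr a hω]

namespace PotHyp

theorem measurable_futureNoise (H : PotHyp P V r α B Cv Cm) (ν : ℝ) (a : A) (s gap h j : ℕ) :
    Measurable fun ω => futureNoise ν V a s gap h ω j := by
  unfold futureNoise
  split_ifs
  · exact measurable_const
  · exact (H.measurable_noise ν _).comp (measurable_trunc a _ _)

variable [IsProbabilityMeasure P]

theorem mix_sets (H : PotHyp P V r α B Cv Cm) {k l m n : ℤ} (hkl : k ≤ l) (hlm : l < m)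
    (hmn : m ≤ n) {S T : Set (ℤ → A)} (hS : MeasurableSet S) (hT : MeasurableSet T)
    (lS : LocalOn k l (· ∈ S)) (lT : LocalOn m n (· ∈ T)) :
    P.real (S ∩ T) ≤ P.real S * (P.real T + Cm * ((m : ℝ) - l) ^ (-α)) := by
  have b : ∀ S : Set (ℤ → A), ∀ ω, |S.indicator (fun _ => (1 : ℝ)) ω| ≤ 1 := fun S ω => by
    by_cases h : ω ∈ S <;> simp [h]
  have key := H.mix k l m n hkl hlm hmn (S.indicator fun _ => 1) (T.indicator fun _ => 1)
    (measurable_const.indicator hS) (measurable_const.indicator hT) ⟨1, b S⟩ ⟨1, b T⟩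
    (fun ω ω' h => by
      have : (ω ∈ S) = (ω' ∈ S) := lS ω ω' h
      by_cases h1 : ω ∈ S <;> simp [h1, ← this])
    (fun ω ω' h => by
      have : (ω ∈ T) = (ω' ∈ T) := lT ω ω' h
      by_cases h1 : ω ∈ T <;> simp [h1, ← this])
  have ab : ∀ S : Set (ℤ → A), ∀ ω, |S.indicator (fun _ => (1 : ℝ)) ω| =
      S.indicator (fun _ => (1 : ℝ)) ω := fun S ω =>
    abs_of_nonneg (Set.indicator_nonneg (fun _ _ => zero_le_one) ω)
  have mul : ∀ ω, S.indicator (fun _ => (1 : ℝ)) ω * T.indicator (fun _ => (1 : ℝ)) ω =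
      (S ∩ T).indicator (fun _ => (1 : ℝ)) ω := fun ω => by
    by_cases h1 : ω ∈ S <;> by_cases h2 : ω ∈ T <;> simp [h1, h2]
  have int : ∀ {S : Set (ℤ → A)}, MeasurableSet S →
      ∫ ω, S.indicator (fun _ => (1 : ℝ)) ω ∂P = P.real S := fun {S} hS => by
    rw [integral_indicator hS]; simp
  simp only [ab, mul] at key
  rw [int hS, int hT, int (hS.inter hT)] at key
  have p0 : 0 ≤ P.real S := measureReal_nonneg
  have p1 : P.real T ≤ 1 := measureReal_le_one
  have hx : 0 ≤ Cm * ((m : ℝ) - l) ^ (-α) :=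
    mul_nonneg H.Cm0.le (Real.rpow_nonneg (by
      have : (l : ℝ) ≤ m := by exact_mod_cast hlm.le
      linarith) _)
  have h2 := mul_le_mul_of_nonneg_left p1 (mul_nonneg p0 hx)
  have h1 := (abs_le.1 key).2
  have e : Cm * P.real S * P.real T * ((m : ℝ) - l) ^ (-α) =
    P.real S * (Cm * ((m : ℝ) - l) ^ (-α)) * P.real T := by ring
  rw [e] at h1
  linarith

/-- The scale-dependent conditional escape estimate with the constants made explicit. -/
theorem exit_step_of (H : PotHyp P V r α B Cv Cm) {κ ν M K₂ c : ℝ} {h gap s : ℕ} (a : A)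
    (S : Scale M κ ν h) (hB : 10 * B ≤ M) (hK₂ : 0 ≤ K₂) (hMK : 10 * K₂ + 10 ≤ M) (hgap : 1 ≤ gap)
    (hMgap : (gap : ℝ) ≤ M) (hmix : Cm * (gap : ℝ) ^ (-α) ≤ c / 4)
    (past : ∀ ω : ℤ → A,
      let u := orbit κ ν V ω
      let u' := orbit κ ν V (trunc a (-s) s ω)
      (u s ≠ 0 → -(3 * κ) ≤ ric κ u s → ric κ u s ≤ 0 →
        u' s ≠ 0 ∧ |ric κ u s - ric κ u' s| ≤ K₂ * ν) ∧
      (u' s ≠ 0 → -(3 * κ) ≤ ric κ u' s → ric κ u' s ≤ 0 →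
        u s ≠ 0 ∧ |ric κ u' s - ric κ u s| ≤ K₂ * ν))
    (esc : ∀ d, -(2.7 * κ) ≤ d → d ≤ -(1.6 * κ) →
      P.real {ω | |yb κ h (noise ν V ω) - d| ≤ (2 + K₂ + 2 * (gap * (B + Cv) + Cv / (1 - r))) * ν}
        ≤ 1 - c / 2) :
    P.real (exitSet κ ν V (s + (4 * h + 4))) ≤
      P.real (badSet κ ν V h) + (1 - c / 4) * P.real (exitSet κ ν V s) := by
  have hκ := S.κ0
  have hκ1 := S.κ1
  have hν := S.ν0
  set K₁ := gap * (B + Cv) + Cv / (1 - r) with hK₁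
  have hK₂ν : K₂ * ν ≤ κ / 10 := by nlinarith [S.hν]
  have hν10 : ν ≤ κ / 10 := by nlinarith [S.hν]
  set Y : (ℤ → A) → ℝ := fun ω => ric κ (orbit κ ν V (trunc a (-s) s ω)) s with hY
  set G : (ℤ → A) → ℝ := fun ω => yb κ h (futureNoise ν V a s gap h ω) with hG
  have mY : Measurable Y := by
    have h1 := (H.measurable_orbit κ ν s).comp (measurable_trunc a (-s) s)
    have h2 := (H.measurable_orbit κ ν (s + 1)).comp (measurable_trunc a (-s) s)
    exact (h2.div (h1.const_mul _)).sub_const 1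
  have mG : Measurable G := measurable_yb κ h (H.measurable_futureNoise ν a s gap h)
  set I := Finset.Icc ⌊-(2.6 * κ) / ν⌋ ⌊-(1.6 * κ) / ν⌋ with hI
  set a' : ℤ → Set (ℤ → A) := fun i =>
    Y ⁻¹' {y | -(2.6 * κ) ≤ y ∧ y ≤ -(1.6 * κ) ∧ ⌊y / ν⌋ = i} with ha'
  set b' : ℤ → Set (ℤ → A) := fun i => G ⁻¹' {y | |y - i * ν| ≤ (2 + K₂ + K₁) * ν} with hb'
  have ma : ∀ i, MeasurableSet (a' i) := fun i => by
    refine mY (measurableSet_Ici.inter (measurableSet_Iic.inter ?_))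
    exact (Int.measurable_floor.comp (measurable_id.div_const ν)) (measurableSet_singleton i)
  have mb : ∀ i, MeasurableSet (b' i) := fun i =>
    mG (measurableSet_le (measurable_id.sub_const _).abs measurable_const)
  have incl : exitSet κ ν V (s + (4 * h + 4)) ⊆
      (shiftn (s : ℤ)) ⁻¹' badSet κ ν V h ∪ ⋃ i ∈ I, a' i ∩ b' i := by
    intro ω hω
    by_cases hbad : shiftn (s : ℤ) ω ∈ badSet κ ν V h
    · exact Or.inl hbad
    right
    have good : ∀ n ≤ 4 * h + 4, |filt κ (noise ν V (shiftn (s : ℤ) ω)) n| ≤ κ / 100 := by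
      intro n hn
      by_contra hc
      exact hbad ⟨n, hn, not_le.1 hc⟩
    obtain ⟨t0, t1, t2, t3⟩ := S.trapped hB (H.abs_noise_le hν.le (shiftn (s : ℤ) ω))
      (isSol_orbit_shift κ ν V ω s)
      ((isSol_orbit κ ν V ω).ne_zero (by simp [orbit, solSeq]) s)
      (isFilt_filt κ _) good hω
    have hrr : ric κ (fun n => orbit κ ν V ω (s + n)) 0 = ric κ (orbit κ ν V ω) s := rfl
    rw [hrr] at t1 t2 t3
    obtain ⟨-, p2⟩ := (past ω).1 t0 (by linarith) (by linarith)
    have p3 : |ric κ (orbit κ ν V ω) s - Y ω| ≤ K₂ * ν := p2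
    have p4 := abs_le.1 p3
    have hY1 : -(2.6 * κ) ≤ Y ω := by linarith
    have hY2 : Y ω ≤ -(1.6 * κ) := by linarith
    have fc := H.futureNoise_close hκ hκ1 hν.le a s gap h ω
    refine Set.mem_biUnion (x := ⌊Y ω / ν⌋) ?_ ⟨⟨hY1, hY2, rfl⟩, ?_⟩
    · simp only [hI, Finset.coe_Icc, Set.mem_Icc]
      exact ⟨Int.floor_le_floor (div_le_div_of_nonneg_right hY1 hν.le),
        Int.floor_le_floor (div_le_div_of_nonneg_right hY2 hν.le)⟩
    · have f1 := Int.floor_le (Y ω / ν)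
      have f2 := Int.lt_floor_add_one (Y ω / ν)
      rw [le_div_iff₀ hν] at f1
      rw [div_lt_iff₀ hν] at f2
      have fc' := abs_le.1 fc
      have t3' := abs_le.1 t3
      change |yb κ h (futureNoise ν V a s gap h ω) - _| ≤ _
      rw [abs_le]
      constructor <;> linarith
  have prod : ∀ i ∈ I, P.real (a' i ∩ b' i) ≤ P.real (a' i) * (1 - c / 4) := by
    intro i hi
    simp only [hI, Finset.mem_Icc] at hi
    have i1 : -(2.7 * κ) ≤ i * ν := by
      have h1 := Int.lt_floor_add_one (-(2.6 * κ) / ν)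
      have h2 : ((⌊-(2.6 * κ) / ν⌋ : ℤ) : ℝ) ≤ i := by exact_mod_cast hi.1
      have h3 : -(2.6 * κ) / ν < i + 1 := by linarith
      rw [div_lt_iff₀ hν] at h3
      linarith
    have i2 : i * ν ≤ -(1.6 * κ) := by
      have h1 := Int.floor_le (-(1.6 * κ) / ν)
      have h2 : (i : ℝ) ≤ ⌊-(1.6 * κ) / ν⌋ := by exact_mod_cast hi.2
      exact (le_div_iff₀ hν).1 (h2.trans h1)
    have hb : P.real (b' i) ≤ 1 - c / 2 := by
      have mE : MeasurableSet {ω | |yb κ h (noise ν V ω) - i * ν| ≤ (2 + K₂ + 2 * K₁) * ν} :=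
        measurableSet_le ((measurable_yb κ h (H.measurable_noise ν)).sub_const _).abs
          measurable_const
      refine le_trans ?_ (esc _ i1 i2)
      rw [← (measurePreserving_shiftn H.inv s).measureReal_preimage mE.nullMeasurableSet]
      refine measureReal_mono fun ω hω => ?_
      have h1 : |yb κ h (futureNoise ν V a s gap h ω) - i * ν| ≤ (2 + K₂ + K₁) * ν := hω
      have h2 := H.futureNoise_close hκ hκ1 hν.le a s gap h ω
      have h3 := abs_add_le (yb κ h (noise ν V (shiftn (s : ℤ) ω)) -
        yb κ h (futureNoise ν V a s gap h ω)) (yb κ h (futureNoise ν V a s gap h ω) - i * ν)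
      rw [sub_add_sub_cancel] at h3
      change |yb κ h (noise ν V (shiftn (s : ℤ) ω)) - i * ν| ≤ _
      linarith
    have gh : gap ≤ 2 * h + 2 := by
      have : (gap : ℝ) ≤ h := hMgap.trans S.hh
      have : gap ≤ h := by exact_mod_cast this
      omega
    have := H.mix_sets (P := P) (k := -s) (l := s) (m := s + gap) (n := s + 2 * h + 2) (by omega)
      (by omega) (by omega) (ma i) (mb i)
      (fun ω ω' hω => by
        have : Y ω = Y ω' := localOn_trunc a (-s) s (fun ω => ric κ (orbit κ ν V ω) s) ω ω' hω
        simp only [ha', Set.mem_preimage, this])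
      (fun ω ω' hω => by
        have : G ω = G ω' := congrArg (yb κ h) (localOn_futureNoise ν V a s gap h ω ω' hω)
        simp only [hb', Set.mem_preimage, this])
    refine this.trans (mul_le_mul_of_nonneg_left ?_ measureReal_nonneg)
    have e : (((s + gap : ℤ) : ℤ) : ℝ) - ((s : ℤ) : ℝ) = gap := by push_cast; ring
    rw [e]
    linarith
  have asum : ∑ i ∈ I, P.real (a' i) ≤ P.real (exitSet κ ν V s) := by
    rw [← measureReal_biUnion_finset (fun i _ j _ hij => ?_) (fun i _ => ma i)]
    · refine measureReal_mono (Set.iUnion₂_subset fun i _ ω hω => ?_)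
      obtain ⟨y1, y2, -⟩ : -(2.6 * κ) ≤ Y ω ∧ Y ω ≤ -(1.6 * κ) ∧ _ := hω
      have hne : orbit κ ν V (trunc a (-s) s ω) s ≠ 0 := by
        intro h0
        have : Y ω = -1 := by simp [hY, ric, h0]
        nlinarith
      obtain ⟨q1, q2⟩ := (past ω).2 hne (by linarith) (by linarith)
      have q3 : |Y ω - ric κ (orbit κ ν V ω) s| ≤ K₂ * ν := q2
      have q4 : ric κ (orbit κ ν V ω) s < -(1.5 * κ) := by
        have := (abs_le.1 q3).1
        have h9 : K₂ * ν < κ / 10 := by nlinarith [S.hν]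
        linarith
      rintro ⟨hc, -⟩
      have hsq : 0 < orbit κ ν V ω s ^ 2 := by positivity
      have he := Real.exp_pos κ
      have e2 : orbit κ ν V ω (s + 1) * orbit κ ν V ω s =
          Real.exp κ * (1 + ric κ (orbit κ ν V ω) s) * orbit κ ν V ω s ^ 2 := by
        unfold ric; field_simp; ring
      rw [e2] at hc
      have := mul_pos he hsq
      nlinarith
    · refine Set.disjoint_left.2 fun ω h1 h2 => hij ?_
      exact h1.2.2.symm.trans h2.2.2
  calc P.real (exitSet κ ν V (s + (4 * h + 4)))
      ≤ P.real ((shiftn (s : ℤ)) ⁻¹' badSet κ ν V h ∪ ⋃ i ∈ I, a' i ∩ b' i) :=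
        measureReal_mono incl
    _ ≤ P.real ((shiftn (s : ℤ)) ⁻¹' badSet κ ν V h) + P.real (⋃ i ∈ I, a' i ∩ b' i) :=
        measureReal_union_le _ _
    _ ≤ P.real (badSet κ ν V h) + ∑ i ∈ I, P.real (a' i) * (1 - c / 4) := by
        rw [(measurePreserving_shiftn H.inv s).measureReal_preimage
          (H.measurableSet_badSet κ ν h).nullMeasurableSet]
        gcongr
        exact (measureReal_biUnion_finset_le _ _).trans (Finset.sum_le_sum prod)
    _ ≤ _ := by
        rw [← Finset.sum_mul, mul_comm]
        have hc : 0 ≤ 1 - c / 4 := by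
          have h1 : (0 : ℝ) ≤ 1 - c / 2 :=
            measureReal_nonneg.trans (esc (-(2 * κ)) (by linarith) (by linarith))
          linarith
        gcongr

end PotHyp

end ExitProbability

section ExitBound

variable {A : Type*} [MeasurableSpace A]
variable {P : Measure (ℤ → A)} [IsProbabilityMeasure P] {V : (ℤ → A) → ℝ} {r α B Cv Cm : ℝ}

namespace PotHyp

theorem exists_exit_step (H : PotHyp P V r α B Cv Cm) {c₁ : ℝ} (hc₁ : 0 < c₁)
    (hs : ∀ K : ℝ, 1 ≤ K → ∃ n : ℕ, ∀ x : ℝ, P.real {ω | |psum V n ω - x| ≤ K} ≤ 1 - c₁ / K ^ 2) :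
    ∃ c > 0, ∃ M ≥ 1000, ∀ κ ν h, Scale M κ ν h → ∀ s,
      P.real (exitSet κ ν V (s + (4 * h + 4))) ≤
        P.real (badSet κ ν V h) + (1 - c) * P.real (exitSet κ ν V s) := by
  obtain ⟨a⟩ := nonempty_alphabet P
  obtain ⟨K₂, hK₂, M₁, hM₁, past⟩ := H.exists_past_trunc
  have hB := H.B0
  have hCv := H.Cv0
  have hCm := H.Cm0
  have hα := H.hα
  have hr1 : 0 < 1 - r := by linarith [H.r1]
  set Q := 8 + 3 * K₂ + 6 * (B + Cv) + 6 * (Cv / (1 - r)) with hQ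
  have hq : 0 < Cv / (1 - r) := by positivity
  have hQ0 : 0 < Q := by positivity
  obtain ⟨gap, hgap1, hgap⟩ : ∃ gap : ℕ, 1 ≤ gap ∧
      Cm * (gap : ℝ) ^ (-α) ≤ c₁ / (Q * gap) ^ 2 / 4 := by
    have ht : Tendsto (fun n : ℕ => (n : ℝ) ^ (-(α - 2))) atTop (nhds 0) :=
      (tendsto_rpow_neg_atTop (by linarith)).comp tendsto_natCast_atTop_atTop
    have hp : 0 < c₁ / Q ^ 2 / 4 / Cm := by positivity
    obtain ⟨n, h1, h2⟩ := ((ht.eventually_lt_const hp).and (eventually_ge_atTop 1)).exists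
    refine ⟨n, h2, ?_⟩
    have hn : (0 : ℝ) < n := by exact_mod_cast h2
    have e : (n : ℝ) ^ (-α) = (n : ℝ) ^ (-(α - 2)) / (n : ℝ) ^ 2 := by
      rw [← Real.rpow_natCast (n : ℝ) 2, ← Real.rpow_sub hn]
      congr 1; push_cast; ring
    rw [lt_div_iff₀ hCm] at h1
    have e2 : c₁ / (Q * n) ^ 2 / 4 = c₁ / Q ^ 2 / 4 / (n : ℝ) ^ 2 := by field_simp
    rw [e, e2, ← mul_div_assoc]
    exact div_le_div_of_nonneg_right (by linarith) (by positivity)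
  have hg1 : (1 : ℝ) ≤ gap := by exact_mod_cast hgap1
  set K := 2 + K₂ + 2 * (gap * (B + Cv) + Cv / (1 - r)) with hK
  have hK1 : 1 ≤ K := by
    have : 0 ≤ gap * (B + Cv) + Cv / (1 - r) := by positivity
    linarith
  have hKQ : 3 * K + 2 ≤ Q * gap := by
    have : 0 ≤ (8 + 3 * K₂ + 6 * (Cv / (1 - r))) * ((gap : ℝ) - 1) :=
      mul_nonneg (by positivity) (by linarith)
    rw [hK, hQ]
    linarith
  set c := c₁ / (Q * gap) ^ 2 with hc
  have hc0 : 0 < c := by positivity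
  obtain ⟨n, hn⟩ := hs (3 * K + 2) (by linarith)
  obtain ⟨M₂, hM₂, esc⟩ := H.exists_escape (K := K) (c := c) hK1 (n := n) fun x =>
    (hn x).trans (sub_le_sub_left (div_le_div_of_nonneg_left hc₁.le (by positivity)
      (pow_le_pow_left₀ (by linarith) hKQ 2)) 1)
  refine ⟨c / 4, by positivity, 1000 + 10 * B + (10 * K₂ + 10) + gap + M₁ + M₂, by linarith,
    fun κ ν h S s => ?_⟩
  have S0 : Scale (1000 + 10 * B + (10 * K₂ + 10) + gap) κ ν h :=
    S.mono (by linarith) (by linarith)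
  exact H.exit_step_of a S0 (by linarith) hK₂ (by linarith) hgap1 (by linarith) hgap
    (past κ ν h (S.mono hM₁ (by linarith)) a s) (esc κ ν h (S.mono hM₂ (by linarith)))

end PotHyp

end ExitBound

section ExitProbabilityBound

variable {A : Type*} [MeasurableSpace A]
variable {P : Measure (ℤ → A)} [IsProbabilityMeasure P] {V : (ℤ → A) → ℝ} {r α B Cv Cm : ℝ}

namespace PotHyp

theorem exitSet_subset {κ ν M : ℝ} {h : ℕ} (S : Scale M κ ν h) (V : (ℤ → A) → ℝ) (s : ℕ) :
    exitSet κ ν V (s + (4 * h + 4)) ⊆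
      (shiftn (s : ℤ)) ⁻¹' badSet κ ν V h ∪ exitSet κ ν V s := by
  intro ω hω
  by_contra hc
  simp only [Set.mem_union, not_or] at hc
  refine hω ?_
  have good : ∀ n ≤ 4 * h + 4, |filt κ (noise ν V (shiftn (s : ℤ) ω)) n| ≤ κ / 100 := by
    intro n hn
    by_contra h2
    exact hc.1 ⟨n, hn, not_le.1 h2⟩
  exact (cone_end S.κ0 S.κ1 (isSol_orbit_shift κ ν V ω s) (isFilt_filt κ _) good
    (S.contr_pow (by omega)) (by norm_num) (by norm_num) (not_not.1 hc.2)).1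

theorem exitSet_zero {κ : ℝ} (ν : ℝ) (V : (ℤ → A) → ℝ) : exitSet κ ν V 0 = ∅ := by
  ext ω
  simp [exitSet, InCone, orbit, solSeq]

theorem exists_exit_le (H : PotHyp P V r α B Cv Cm) :
    ∃ C > 0, ∃ M ≥ 1000, ∀ κ ν h, Scale M κ ν h → ∀ k : ℕ,
      P.real (exitSet κ ν V (k * (4 * h + 4))) ≤ C * P.real (badSet κ ν V h) := by
  rcases H.bounded_or_spread with ⟨K, hK⟩ | ⟨c₁, hc₁, hs⟩
  · refine ⟨1, one_pos, 1000 + 200 * |K|, by linarith [abs_nonneg K], fun κ ν h S k => ?_⟩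
    have hbad : P.real (badSet κ ν V h) = 0 := by
      rw [measureReal_def, ENNReal.toReal_eq_zero_iff]
      left
      refine measure_mono_null (t := {ω | ¬∀ s n : ℕ, |psum V n (shiftn (s : ℤ) ω)| ≤ K}) ?_ hK
      rintro ω ⟨n, -, hn⟩ hω
      have h1 := filt_abs_le S.κ0.le (f := noise ν V ω) (K := ν * |K|) (fun n => by
        rw [sum_noise, abs_mul, abs_of_pos S.ν0]
        have := hω 1 n
        push_cast at this
        exact mul_le_mul_of_nonneg_left (this.trans (le_abs_self K)) S.ν0.le) n
      have h2 := S.hν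
      have h3 := S.ν0
      nlinarith
    rw [hbad, mul_zero]
    induction k with
    | zero => rw [zero_mul, exitSet_zero, measureReal_empty]
    | succ k ih =>
      rw [add_mul, one_mul]
      refine (measureReal_mono (exitSet_subset S V _)).trans ((measureReal_union_le _ _).trans ?_)
      rw [(measurePreserving_shiftn H.inv _).measureReal_preimage
          (H.measurableSet_badSet κ ν h).nullMeasurableSet, hbad, zero_add]
      exact ih
  · obtain ⟨c, hc, M, hM, step⟩ := H.exists_exit_step hc₁ hs
    set c' := min c 1 with hc'
    have hc'0 : 0 < c' := lt_min hc one_pos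
    refine ⟨1 / c', by positivity, M, hM, fun κ ν h S k => ?_⟩
    have p0 : 0 ≤ P.real (badSet κ ν V h) := measureReal_nonneg
    induction k with
    | zero => rw [zero_mul, exitSet_zero, measureReal_empty]; positivity
    | succ k ih =>
      rw [add_mul, one_mul]
      have h1 := step κ ν h S (k * (4 * h + 4))
      have h2 : (1 - c) * P.real (exitSet κ ν V (k * (4 * h + 4))) ≤
          (1 - c') * P.real (exitSet κ ν V (k * (4 * h + 4))) :=
        mul_le_mul_of_nonneg_right (by linarith [min_le_left c 1]) measureReal_nonneg
      have h3 := mul_le_mul_of_nonneg_left ih (by linarith [min_le_right c 1] : 0 ≤ 1 - c')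
      have e : (1 - c') * (1 / c' * P.real (badSet κ ν V h)) =
          1 / c' * P.real (badSet κ ν V h) - P.real (badSet κ ν V h) := by
        field_simp
      linarith

theorem exists_bad_le (H : PotHyp P V r α B Cv Cm) :
    ∃ C > 0, ∀ κ ν t : ℝ, 0 < κ → κ ≤ 1 / 1000 → 0 < ν → 0 < t → ∀ g h : ℕ, 1 ≤ g → t * g * C ≤ 1 →
      h + 1 ≤ g ^ 3 → P.real (badSet κ ν V h) ≤
        (4 * h + 5) * (2 * C * Real.exp (C * t ^ 2 / κ - t * (κ / 100) / ν)) := by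
  obtain ⟨C, hC, tail⟩ := H.exists_filt_tail
  refine ⟨C, hC, fun κ ν t hκ hκ1 hν ht g h hg htg hgh => ?_⟩
  have : badSet κ ν V h = ⋃ n ∈ Finset.range (4 * h + 5),
      {ω | κ / 100 < |filt κ (noise ν V ω) n|} := by
    ext ω
    simp only [badSet, Set.mem_ofPred_eq, Set.mem_iUnion, Finset.mem_range, exists_prop]
    exact exists_congr fun n => and_congr_left fun _ => by omega
  rw [this]
  refine (measureReal_biUnion_finset_le _ _).trans ((Finset.sum_le_sum fun n hn =>
    tail κ ν t hκ hκ1 hν ht g hg htg n (by have := Finset.mem_range.1 hn; omega) _).trans_eq ?_)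
  rw [Finset.sum_const, Finset.card_range, nsmul_eq_mul]
  push_cast
  ring

end PotHyp

end ExitProbabilityBound

theorem log_slow {F : ℕ → ℝ} (hF : ∀ n, 0 < F n) (h1 : ∀ n, F (n + 1) ≤ Real.exp 2 * F n)
    (h2 : ∀ n, F n ≤ Real.exp 2 * F (n + 1)) (n m : ℕ) :
    |Real.log (F (n + m)) - Real.log (F n)| ≤ 2 * m := by
  induction m with
  | zero => simp
  | succ m ih =>
    have l1 := Real.log_le_log (hF _) (h1 (n + m))
    have l2 := Real.log_le_log (hF _) (h2 (n + m))
    rw [Real.log_mul (Real.exp_ne_zero _) (hF _).ne', Real.log_exp] at l1 l2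
    rw [abs_le] at ih ⊢
    rw [← add_assoc]
    push_cast
    constructor <;> linarith [ih.1, ih.2]

theorem five_le_exp_two : 5 ≤ Real.exp 2 := by
  have := Real.exp_one_gt_d9
  rw [show (2 : ℝ) = 1 + 1 by norm_num, Real.exp_add]
  nlinarith

theorem size_step {e x y z : ℝ} (he : |e - 2| ≤ 1) (hx : x = e * y - z) :
    |x| + |y| ≤ Real.exp 2 * (|y| + |z|) ∧ |y| + |z| ≤ Real.exp 2 * (|x| + |y|) := by
  have he' := abs_le.1 he
  have h3 : |e * y| ≤ 3 * |y| := by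
    rw [abs_mul]
    exact mul_le_mul_of_nonneg_right (abs_le.2 ⟨by linarith, by linarith⟩) (abs_nonneg y)
  have h1 : |x| ≤ |e * y| + |z| := by rw [hx]; exact abs_sub _ _
  have h2 : |z| ≤ |e * y| + |x| := by
    have : z = e * y - x := by rw [hx]; ring
    rw [this]; exact abs_sub _ _
  have h5 := five_le_exp_two
  have ax := abs_nonneg x
  have ay := abs_nonneg y
  have az := abs_nonneg z
  constructor
  · have := mul_le_mul_of_nonneg_right h5 (add_nonneg ay az)
    linarith
  · have := mul_le_mul_of_nonneg_right h5 (add_nonneg ax ay)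
    linarith

section Growth

variable {A : Type*}

/-- The orbit started in the contracting direction. -/
def coorbit (κ ν : ℝ) (V : (ℤ → A) → ℝ) (ω : ℤ → A) : ℕ → ℝ :=
  solSeq (energy κ (noise ν V ω)) 0 1

theorem isSol_coorbit (κ ν : ℝ) (V : (ℤ → A) → ℝ) (ω : ℤ → A) :
    IsSol κ (noise ν V ω) (coorbit κ ν V ω) := isSol_solSeq _ _ _ _

/-- The size of the state of the orbit at time `n`. -/
def orbitSize (κ ν : ℝ) (V : (ℤ → A) → ℝ) (ω : ℤ → A) (n : ℕ) : ℝ :=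
  |orbit κ ν V ω (n + 1)| + |orbit κ ν V ω n|

/-- The size of the fundamental matrix at time `n`. -/
def totalSize (κ ν : ℝ) (V : (ℤ → A) → ℝ) (ω : ℤ → A) (n : ℕ) : ℝ :=
  orbitSize κ ν V ω n + (|coorbit κ ν V ω (n + 1)| + |coorbit κ ν V ω n|)

theorem orbitSize_zero (κ ν : ℝ) (V : (ℤ → A) → ℝ) (ω : ℤ → A) : orbitSize κ ν V ω 0 = 1 := by
  simp [orbitSize, orbit, solSeq]

theorem totalSize_zero (κ ν : ℝ) (V : (ℤ → A) → ℝ) (ω : ℤ → A) : totalSize κ ν V ω 0 = 2 := by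
  simp only [totalSize, orbitSize_zero, coorbit, solSeq]
  norm_num

theorem orbitSize_pos (κ ν : ℝ) (V : (ℤ → A) → ℝ) (ω : ℤ → A) (n : ℕ) :
    0 < orbitSize κ ν V ω n := by
  have := (isSol_orbit κ ν V ω).ne_zero (by simp [orbit, solSeq]) n
  rw [orbitSize]
  rcases not_and_or.1 this with h | h
  · linarith [abs_pos.2 h, abs_nonneg (orbit κ ν V ω n)]
  · linarith [abs_pos.2 h, abs_nonneg (orbit κ ν V ω (n + 1))]

theorem totalSize_pos (κ ν : ℝ) (V : (ℤ → A) → ℝ) (ω : ℤ → A) (n : ℕ) :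
    0 < totalSize κ ν V ω n :=
  add_pos_of_pos_of_nonneg (orbitSize_pos κ ν V ω n) (by positivity)

variable [MeasurableSpace A]
theorem isSol_coorbit_shift (κ ν : ℝ) (V : (ℤ → A) → ℝ) (ω : ℤ → A) (s : ℕ) :
    IsSol κ (noise ν V (shiftn (s : ℤ) ω)) (fun n => coorbit κ ν V ω (s + n)) := by
  have := (isSol_coorbit κ ν V ω).shift s
  simpa only [← noise_shiftn] using this

variable {P : Measure (ℤ → A)} {V : (ℤ → A) → ℝ} {r α B Cv Cm : ℝ}
variable {M κ ν : ℝ} {h : ℕ}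

namespace PotHyp

theorem energy_near_two (H : PotHyp P V r α B Cv Cm) (S : Scale M κ ν h) (hB : 10 * B ≤ M)
    (ω : ℤ → A) (n : ℕ) : |energy κ (noise ν V ω) n - 2| ≤ 1 := by
  refine (H.energy_close S.κ0 S.κ1 S.ν0.le ω n).trans ?_
  have := S.κ1
  have := mul_le_mul_of_nonneg_right hB S.ν0.le
  have := S.hν
  linarith

theorem orbitSize_slow (H : PotHyp P V r α B Cv Cm) (S : Scale M κ ν h) (hB : 10 * B ≤ M)
    (ω : ℤ → A) (n m : ℕ) :
    |Real.log (orbitSize κ ν V ω (n + m)) - Real.log (orbitSize κ ν V ω n)| ≤ 2 * m :=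
  log_slow (orbitSize_pos κ ν V ω)
    (fun n => (size_step (H.energy_near_two S hB ω n) (isSol_orbit κ ν V ω n)).1)
    (fun n => (size_step (H.energy_near_two S hB ω n) (isSol_orbit κ ν V ω n)).2) n m

theorem totalSize_slow (H : PotHyp P V r α B Cv Cm) (S : Scale M κ ν h) (hB : 10 * B ≤ M)
    (ω : ℤ → A) (n m : ℕ) :
    |Real.log (totalSize κ ν V ω (n + m)) - Real.log (totalSize κ ν V ω n)| ≤ 2 * m := by
  have h1 := fun n => size_step (H.energy_near_two S hB ω n) (isSol_orbit κ ν V ω n)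
  have h2 := fun n => size_step (H.energy_near_two S hB ω n) (isSol_coorbit κ ν V ω n)
  refine log_slow (totalSize_pos κ ν V ω) (fun n => ?_) (fun n => ?_) n m
  · rw [totalSize, totalSize, mul_add]
    exact add_le_add (h1 n).1 (h2 n).1
  · rw [totalSize, totalSize, mul_add]
    exact add_le_add (h1 n).2 (h2 n).2

theorem measurable_orbitSize (H : PotHyp P V r α B Cv Cm) (κ ν : ℝ) (n : ℕ) :
    Measurable fun ω => orbitSize κ ν V ω n :=
  (H.measurable_orbit κ ν (n + 1)).abs.add (H.measurable_orbit κ ν n).abs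

theorem measurable_coorbit (H : PotHyp P V r α B Cv Cm) (κ ν : ℝ) (n : ℕ) :
    Measurable fun ω => coorbit κ ν V ω n :=
  measurable_solSeq 0 1 (fun j => measurable_const.sub ((H.measurable_noise ν j).const_mul _)) n

theorem measurable_totalSize (H : PotHyp P V r α B Cv Cm) (κ ν : ℝ) (n : ℕ) :
    Measurable fun ω => totalSize κ ν V ω n :=
  (H.measurable_orbitSize κ ν n).add
    ((H.measurable_coorbit κ ν (n + 1)).abs.add (H.measurable_coorbit κ ν n).abs)

/-- Growth of the orbit over one block, up to filtered noise and exceptional events. -/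
theorem log_orbitSize_block (H : PotHyp P V r α B Cv Cm) (S : Scale M κ ν h) (hB : 10 * B ≤ M)
    (ω : ℤ → A) (s : ℕ) :
    Real.log (orbitSize κ ν V ω s) + (κ * (4 * h + 4) - 20) -
      42 * ∑ i ∈ Finset.range (4 * h + 5), |filt κ (noise ν V (shiftn (s : ℤ) ω)) i| -
      3 * (4 * h + 4) * (badSet κ ν V h).indicator (fun _ => 1) (shiftn (s : ℤ) ω) -
      3 * (4 * h + 4) * (exitSet κ ν V s).indicator (fun _ => 1) ω ≤
      Real.log (orbitSize κ ν V ω (s + (4 * h + 4))) := by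
  have hsum : 0 ≤ ∑ i ∈ Finset.range (4 * h + 5), |filt κ (noise ν V (shiftn (s : ℤ) ω)) i| :=
    Finset.sum_nonneg fun _ _ => abs_nonneg _
  have hL : (0 : ℝ) ≤ 4 * h + 4 := by positivity
  have hi1 : 0 ≤ (badSet κ ν V h).indicator (fun _ => (1 : ℝ)) (shiftn (s : ℤ) ω) :=
    Set.indicator_nonneg (fun _ _ => zero_le_one) _
  have hi2 : 0 ≤ (exitSet κ ν V s).indicator (fun _ => (1 : ℝ)) ω :=
    Set.indicator_nonneg (fun _ _ => zero_le_one) _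
  by_cases hbe : shiftn (s : ℤ) ω ∈ badSet κ ν V h ∨ ω ∈ exitSet κ ν V s
  · have slow := (abs_le.1 (H.orbitSize_slow S hB ω s (4 * h + 4))).1
    push_cast at slow
    have hge : 1 ≤ (badSet κ ν V h).indicator (fun _ => (1 : ℝ)) (shiftn (s : ℤ) ω) +
        (exitSet κ ν V s).indicator (fun _ => (1 : ℝ)) ω := by
      rcases hbe with hb | hb
      · rw [Set.indicator_of_mem hb]; linarith
      · rw [Set.indicator_of_mem hb]; linarith
    have h1 := mul_le_mul_of_nonneg_left hge hL
    have h2 := mul_le_mul_of_nonneg_right (S.κ1.trans (by norm_num : (1 / 1000 : ℝ) ≤ 1)) hL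
    linarith
  · rw [not_or] at hbe
    have good : ∀ n ≤ 4 * h + 4, |filt κ (noise ν V (shiftn (s : ℤ) ω)) n| ≤ κ / 100 := by
      intro n hn
      by_contra h2
      exact hbe.1 ⟨n, hn, not_le.1 h2⟩
    have := (cone_end S.κ0 S.κ1 (isSol_orbit_shift κ ν V ω s) (isFilt_filt κ _) good
      (S.contr_pow (by omega)) (by norm_num) (by norm_num) (not_not.1 hbe.2)).2
    rw [Set.indicator_of_notMem hbe.1, Set.indicator_of_notMem hbe.2]
    push_cast at this
    change Real.log (orbitSize κ ν V ω s) + _ - _ - _ ≤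
      Real.log (orbitSize κ ν V ω (s + (4 * h + 4))) at this
    linarith

/-- Upper bound for the growth of the fundamental matrix over one block. -/
theorem log_totalSize_block (H : PotHyp P V r α B Cv Cm) (S : Scale M κ ν h) (hB : 10 * B ≤ M)
    (ω : ℤ → A) (s : ℕ) :
    Real.log (totalSize κ ν V ω (s + (4 * h + 4))) ≤
      Real.log (totalSize κ ν V ω s) + (κ * (4 * h + 4) + 5 - Real.log κ) +
      ∑ i ∈ Finset.range (4 * h + 5), |filt κ (noise ν V (shiftn (s : ℤ) ω)) i| +
      2 * (4 * h + 4) * (badSet κ ν V h).indicator (fun _ => 1) (shiftn (s : ℤ) ω) := by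
  have hsum : 0 ≤ ∑ i ∈ Finset.range (4 * h + 5), |filt κ (noise ν V (shiftn (s : ℤ) ω)) i| :=
    Finset.sum_nonneg fun _ _ => abs_nonneg _
  have hκ := S.κ0
  have hL : (0 : ℝ) ≤ 4 * h + 4 := by positivity
  have hκL := mul_nonneg hκ.le hL
  have hlog : Real.log κ ≤ 0 := Real.log_nonpos hκ.le (S.κ1.trans (by norm_num))
  by_cases hb : shiftn (s : ℤ) ω ∈ badSet κ ν V h
  · have slow := (abs_le.1 (H.totalSize_slow S hB ω s (4 * h + 4))).2
    push_cast at slow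
    rw [Set.indicator_of_mem hb]
    linarith
  · have good : ∀ n ≤ 4 * h + 4, |filt κ (noise ν V (shiftn (s : ℤ) ω)) n| ≤ κ / 100 := by
      intro n hn
      by_contra h2
      exact hb ⟨n, hn, not_le.1 h2⟩
    have b1 := block_upper hκ S.κ1 (isSol_orbit_shift κ ν V ω s) (isFilt_filt κ _) rfl good
      (S.contr_pow (by omega))
    have b2 := block_upper hκ S.κ1 (isSol_coorbit_shift κ ν V ω s) (isFilt_filt κ _) rfl good
      (S.contr_pow (by omega))
    rw [Set.indicator_of_notMem hb]
    have b3 := add_le_add b1 b2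
    rw [← add_mul, ← add_div] at b3
    change totalSize κ ν V ω (s + (4 * h + 4)) ≤ totalSize κ ν V ω s / κ * _ at b3
    have b4 := Real.log_le_log (totalSize_pos κ ν V ω _) b3
    have t0 := totalSize_pos κ ν V ω s
    rw [Real.log_mul (div_pos t0 hκ).ne' (Real.exp_ne_zero _), Real.log_exp,
      Real.log_div t0.ne' hκ.ne'] at b4
    push_cast at b4
    linarith

variable [IsProbabilityMeasure P]

theorem integrable_log_orbitSize (H : PotHyp P V r α B Cv Cm) (S : Scale M κ ν h)
    (hB : 10 * B ≤ M) (n : ℕ) : Integrable (fun ω => Real.log (orbitSize κ ν V ω n)) P :=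
  integrable_of_bdd (H.measurable_orbitSize κ ν n).log (B := 2 * n) fun ω => by
    have := H.orbitSize_slow S hB ω 0 n
    rwa [orbitSize_zero, Real.log_one, sub_zero, zero_add] at this

theorem integrable_log_totalSize (H : PotHyp P V r α B Cv Cm) (S : Scale M κ ν h)
    (hB : 10 * B ≤ M) (n : ℕ) : Integrable (fun ω => Real.log (totalSize κ ν V ω n)) P :=
  integrable_of_bdd (H.measurable_totalSize κ ν n).log (B := 2 * n + |Real.log 2|) fun ω => by
    have h1 := H.totalSize_slow S hB ω 0 n
    rw [totalSize_zero, zero_add] at h1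
    have h2 := abs_sub_abs_le_abs_sub (Real.log (totalSize κ ν V ω n)) (Real.log 2)
    linarith

theorem integrable_indicator_one {T : Set (ℤ → A)} (hT : MeasurableSet T) :
    Integrable (T.indicator fun _ => (1 : ℝ)) P :=
  (integrable_const 1).indicator hT

theorem integral_sum_filt_le (H : PotHyp P V r α B Cv Cm) {C : ℝ}
    (hC : ∀ n, ∫ ω, |filt κ (noise ν V ω) n| ∂P ≤ C) (hκ : 0 ≤ κ) (hν : 0 ≤ ν) (s L : ℕ) :
    Integrable (fun ω => ∑ i ∈ Finset.range L, |filt κ (noise ν V (shiftn (s : ℤ) ω)) i|) P ∧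
    ∫ ω, ∑ i ∈ Finset.range L, |filt κ (noise ν V (shiftn (s : ℤ) ω)) i| ∂P ≤ L * C := by
  have hi : ∀ i, Integrable (fun ω => |filt κ (noise ν V (shiftn (s : ℤ) ω)) i|) P := fun i =>
    (measurePreserving_shiftn H.inv s).integrable_comp_of_integrable (H.integrable_filt hκ hν i).abs
  refine ⟨integrable_finsetSum _ fun i _ => hi i, ?_⟩
  rw [integral_finsetSum _ fun i _ => hi i]
  calc _ ≤ ∑ i ∈ Finset.range L, C := Finset.sum_le_sum fun i _ => by
        rw [integral_shiftn H.inv s (g := fun ω => |filt κ (noise ν V ω) i|)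
          (H.measurable_filt κ ν i).abs]
        exact hC i
    _ = L * C := by simp

end PotHyp

end Growth

theorem norm_map_ofReal (a b c d : ℝ) :
    ‖(!![(a : ℂ), (b : ℂ); (c : ℂ), (d : ℂ)] : Matrix (Fin 2) (Fin 2) ℂ)‖ =
      max (max |a| |b|) (max |c| |d|) := by
  refine le_antisymm ?_ ?_
  · rw [Matrix.norm_le_iff (by positivity)]
    intro i j
    fin_cases i <;> fin_cases j <;> simp [Complex.norm_real]
  · have h := fun i j => Matrix.norm_entry_le_entrywise_sup_norm
      (!![(a : ℂ), (b : ℂ); (c : ℂ), (d : ℂ)] : Matrix (Fin 2) (Fin 2) ℂ) (i := i) (j := j)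
    have h00 := h 0 0
    have h01 := h 0 1
    have h10 := h 1 0
    have h11 := h 1 1
    simp [Complex.norm_real] at h00 h01 h10 h11
    simp [h00, h01, h10, h11]

section Lyapunov

variable {A : Type*}

theorem transferProd_eq {κ ν lam E : ℝ} (hE : E = Real.exp κ + Real.exp (-κ))
    (hlam : lam = Real.exp κ * ν) (V : (ℤ → A) → ℝ) (n : ℕ) (ω : ℤ → A) :
    transferProd lam V (E : ℂ) n ω =
      !![((orbit κ ν V ω (n + 1) : ℝ) : ℂ), ((coorbit κ ν V ω (n + 1) : ℝ) : ℂ);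
        ((orbit κ ν V ω n : ℝ) : ℂ), ((coorbit κ ν V ω n : ℝ) : ℂ)] := by
  induction n with
  | zero =>
    ext i j
    fin_cases i <;> fin_cases j <;> simp [transferProd, orbit, coorbit, solSeq]
  | succ n ih =>
    have h1 : orbit κ ν V ω (n + 1 + 1) =
        (E - lam * V (shiftn (n + 1) ω)) * orbit κ ν V ω (n + 1) - orbit κ ν V ω n := by
      rw [isSol_orbit κ ν V ω n, hE, hlam, noise]; ring
    have h2 : coorbit κ ν V ω (n + 1 + 1) =
        (E - lam * V (shiftn (n + 1) ω)) * coorbit κ ν V ω (n + 1) - coorbit κ ν V ω n := by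
      rw [isSol_coorbit κ ν V ω n, hE, hlam, noise]; ring
    rw [transferProd, ih, transferMat, h1, h2]
    ext i j
    fin_cases i <;> fin_cases j <;> simp [Matrix.mul_apply, Fin.sum_univ_two, sub_eq_add_neg]

variable [MeasurableSpace A]
variable {P : Measure (ℤ → A)} {V : (ℤ → A) → ℝ} {r α B Cv Cm : ℝ}
variable {M κ ν : ℝ} {h : ℕ}
variable [IsProbabilityMeasure P]

namespace PotHyp

theorem integral_log_norm (H : PotHyp P V r α B Cv Cm) (S : Scale M κ ν h) (hB : 10 * B ≤ M)
    {lam E : ℝ} (hE : E = Real.exp κ + Real.exp (-κ)) (hlam : lam = Real.exp κ * ν) (n : ℕ) :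
    ∫ ω, Real.log (orbitSize κ ν V ω n) ∂P - 1 ≤
        ∫ ω, Real.log ‖transferProd lam V (E : ℂ) n ω‖ ∂P ∧
      ∫ ω, Real.log ‖transferProd lam V (E : ℂ) n ω‖ ∂P ≤
        ∫ ω, Real.log (totalSize κ ν V ω n) ∂P := by
  have hn : ∀ ω, ‖transferProd lam V (E : ℂ) n ω‖ =
      max (max |orbit κ ν V ω (n + 1)| |coorbit κ ν V ω (n + 1)|)
        (max |orbit κ ν V ω n| |coorbit κ ν V ω n|) := fun ω => by
    rw [transferProd_eq hE hlam, norm_map_ofReal]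
  have hmeas : Measurable fun ω => Real.log ‖transferProd lam V (E : ℂ) n ω‖ := by
    simp only [hn]
    exact ((((H.measurable_orbit κ ν _).abs.max (H.measurable_coorbit κ ν _).abs)).max
      ((H.measurable_orbit κ ν _).abs.max (H.measurable_coorbit κ ν _).abs)).log
  have lo : ∀ ω, orbitSize κ ν V ω n ≤ 2 * ‖transferProd lam V (E : ℂ) n ω‖ := fun ω => by
    rw [hn, orbitSize]
    have h1 := (le_max_left |orbit κ ν V ω (n + 1)| |coorbit κ ν V ω (n + 1)|).trans
      (le_max_left _ (max |orbit κ ν V ω n| |coorbit κ ν V ω n|))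
    have h2 := (le_max_left |orbit κ ν V ω n| |coorbit κ ν V ω n|).trans
      (le_max_right (max |orbit κ ν V ω (n + 1)| |coorbit κ ν V ω (n + 1)|) _)
    linarith
  have hi : ∀ ω, ‖transferProd lam V (E : ℂ) n ω‖ ≤ totalSize κ ν V ω n := fun ω => by
    rw [hn, totalSize, orbitSize]
    have h1 := abs_nonneg (orbit κ ν V ω (n + 1))
    have h2 := abs_nonneg (orbit κ ν V ω n)
    have h3 := abs_nonneg (coorbit κ ν V ω (n + 1))
    have h4 := abs_nonneg (coorbit κ ν V ω n)
    refine max_le (max_le ?_ ?_) (max_le ?_ ?_) <;> linarith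
  have pos : ∀ ω, 0 < ‖transferProd lam V (E : ℂ) n ω‖ := fun ω => by
    linarith [lo ω, orbitSize_pos κ ν V ω n]
  have log_lo : ∀ ω, Real.log (orbitSize κ ν V ω n) - 1 ≤
      Real.log ‖transferProd lam V (E : ℂ) n ω‖ := fun ω => by
    have := Real.log_le_log (orbitSize_pos κ ν V ω n) (lo ω)
    rw [Real.log_mul two_ne_zero (pos ω).ne'] at this
    linarith [Real.log_two_lt_d9]
  have log_hi : ∀ ω, Real.log ‖transferProd lam V (E : ℂ) n ω‖ ≤
      Real.log (totalSize κ ν V ω n) := fun ω => Real.log_le_log (pos ω) (hi ω)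
  have i1 : Integrable (fun ω => Real.log (orbitSize κ ν V ω n) - 1) P :=
    (H.integrable_log_orbitSize S hB n).sub (integrable_const 1)
  have i2 := H.integrable_log_totalSize S hB n
  have i3 : Integrable (fun ω => Real.log ‖transferProd lam V (E : ℂ) n ω‖) P :=
    integrable_of_le_of_le hmeas.aestronglyMeasurable (ae_of_all _ log_lo) (ae_of_all _ log_hi)
      i1 i2
  refine ⟨?_, integral_mono i3 i2 log_hi⟩
  have := integral_mono i1 i3 log_lo
  rwa [integral_sub (H.integrable_log_orbitSize S hB n) (integrable_const 1), integral_const,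
    probReal_univ, one_smul] at this

theorem integral_indicator_shiftn (H : PotHyp P V r α B Cv Cm) {T : Set (ℤ → A)}
    (hT : MeasurableSet T) (s : ℕ) :
    Integrable (fun ω => T.indicator (fun _ => (1 : ℝ)) (shiftn (s : ℤ) ω)) P ∧
      ∫ ω, T.indicator (fun _ => (1 : ℝ)) (shiftn (s : ℤ) ω) ∂P = P.real T := by
  refine ⟨(measurePreserving_shiftn H.inv s).integrable_comp_of_integrable
    (integrable_indicator_one hT), ?_⟩
  rw [integral_shiftn H.inv s (g := T.indicator fun _ => (1 : ℝ)) (measurable_const.indicator hT),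
    integral_indicator hT]
  simp

theorem integral_log_orbitSize_ge (H : PotHyp P V r α B Cv Cm) (S : Scale M κ ν h)
    (hB : 10 * B ≤ M) {C q : ℝ} (hC : ∀ n, ∫ ω, |filt κ (noise ν V ω) n| ∂P ≤ C)
    (hq : ∀ k : ℕ, P.real (exitSet κ ν V (k * (4 * h + 4))) ≤ q) (k : ℕ) :
    k * (κ * (4 * h + 4) - 20 - 42 * ((4 * h + 5) * C) -
      3 * (4 * h + 4) * P.real (badSet κ ν V h) - 3 * (4 * h + 4) * q) ≤
      ∫ ω, Real.log (orbitSize κ ν V ω (k * (4 * h + 4))) ∂P := by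
  induction k with
  | zero => simp [orbitSize_zero]
  | succ k ih =>
    set s := k * (4 * h + 4) with hs
    have e : (k + 1) * (4 * h + 4) = s + (4 * h + 4) := by rw [hs]; ring
    rw [e]
    obtain ⟨f1, f2⟩ := H.integral_sum_filt_le hC S.κ0.le S.ν0.le s (4 * h + 5)
    obtain ⟨b1, b2⟩ := H.integral_indicator_shiftn (H.measurableSet_badSet κ ν h) s
    have x1 : Integrable ((exitSet κ ν V s).indicator fun _ => (1 : ℝ)) P :=
      integrable_indicator_one (H.measurableSet_exitSet κ ν s)
    have x2 : ∫ ω, (exitSet κ ν V s).indicator (fun _ => (1 : ℝ)) ω ∂P ≤ q := by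
      rw [integral_indicator (H.measurableSet_exitSet κ ν s)]
      simpa using hq k
    have o1 := H.integrable_log_orbitSize S hB s
    have i1 : Integrable (fun ω => Real.log (orbitSize κ ν V ω s) + (κ * (4 * h + 4) - 20)) P :=
      o1.add (integrable_const _)
    have i2 : Integrable (fun ω => Real.log (orbitSize κ ν V ω s) + (κ * (4 * h + 4) - 20) -
        42 * ∑ i ∈ Finset.range (4 * h + 5), |filt κ (noise ν V (shiftn (s : ℤ) ω)) i|) P :=
      i1.sub (f1.const_mul 42)
    have i3 : Integrable (fun ω => Real.log (orbitSize κ ν V ω s) + (κ * (4 * h + 4) - 20) -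
        42 * ∑ i ∈ Finset.range (4 * h + 5), |filt κ (noise ν V (shiftn (s : ℤ) ω)) i| -
        3 * (4 * h + 4) * (badSet κ ν V h).indicator (fun _ => 1) (shiftn (s : ℤ) ω)) P :=
      i2.sub (b1.const_mul _)
    have := integral_mono (i3.sub (x1.const_mul (3 * (4 * h + 4))))
      (H.integrable_log_orbitSize S hB (s + (4 * h + 4))) (fun ω => H.log_orbitSize_block S hB ω s)
    refine le_trans ?_ this
    simp only [Pi.sub_apply]
    rw [integral_sub i3 (x1.const_mul _), integral_sub i2 (b1.const_mul _),
      integral_sub i1 (f1.const_mul _), integral_add o1 (integrable_const _), integral_const_mul,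
      integral_const_mul, integral_const_mul, integral_const, probReal_univ, one_smul, b2]
    have hL : (0 : ℝ) ≤ 3 * (4 * h + 4) := by positivity
    have x3 := mul_le_mul_of_nonneg_left x2 hL
    push_cast at f2 ⊢
    linarith

theorem integral_log_totalSize_le (H : PotHyp P V r α B Cv Cm) (S : Scale M κ ν h)
    (hB : 10 * B ≤ M) {C : ℝ} (hC : ∀ n, ∫ ω, |filt κ (noise ν V ω) n| ∂P ≤ C) (k : ℕ) :
    ∫ ω, Real.log (totalSize κ ν V ω (k * (4 * h + 4))) ∂P ≤
      Real.log 2 + k * (κ * (4 * h + 4) + 5 - Real.log κ + (4 * h + 5) * C +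
        2 * (4 * h + 4) * P.real (badSet κ ν V h)) := by
  induction k with
  | zero => simp [totalSize_zero]
  | succ k ih =>
    set s := k * (4 * h + 4) with hs
    have e : (k + 1) * (4 * h + 4) = s + (4 * h + 4) := by rw [hs]; ring
    rw [e]
    obtain ⟨f1, f2⟩ := H.integral_sum_filt_le hC S.κ0.le S.ν0.le s (4 * h + 5)
    obtain ⟨b1, b2⟩ := H.integral_indicator_shiftn (H.measurableSet_badSet κ ν h) s
    have o1 := H.integrable_log_totalSize S hB s
    have i1 : Integrable (fun ω => Real.log (totalSize κ ν V ω s) +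
        (κ * (4 * h + 4) + 5 - Real.log κ)) P := o1.add (integrable_const _)
    have i2 : Integrable (fun ω => Real.log (totalSize κ ν V ω s) +
        (κ * (4 * h + 4) + 5 - Real.log κ) +
        ∑ i ∈ Finset.range (4 * h + 5), |filt κ (noise ν V (shiftn (s : ℤ) ω)) i|) P := i1.add f1
    have := integral_mono (H.integrable_log_totalSize S hB (s + (4 * h + 4)))
      (i2.add (b1.const_mul (2 * (4 * h + 4)))) (fun ω => H.log_totalSize_block S hB ω s)
    refine this.trans ?_
    simp only [Pi.add_apply]
    rw [integral_add i2 (b1.const_mul _), integral_add i1 f1, integral_add o1 (integrable_const _),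
      integral_const_mul, integral_const, probReal_univ, one_smul, b2]
    push_cast at f2 ⊢
    linarith

theorem abs_lyapunov_sub_le (H : PotHyp P V r α B Cv Cm) (S : Scale M κ ν h)
    (hB : 10 * B ≤ M) {C q : ℝ} (hC : ∀ n, ∫ ω, |filt κ (noise ν V ω) n| ∂P ≤ C)
    (hq : ∀ k : ℕ, P.real (exitSet κ ν V (k * (4 * h + 4))) ≤ q)
    {lam E γ : ℝ} (hE : E = Real.exp κ + Real.exp (-κ)) (hlam : lam = Real.exp κ * ν)
    (hγ : IsLyapunov P lam V (E : ℂ) γ) :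
    |γ - κ| ≤ (20 - Real.log κ) / h + 84 * C + 3 * P.real (badSet κ ν V h) + 3 * q := by
  set p := P.real (badSet κ ν V h) with hp
  have hκ := S.κ0
  have hh : (0 : ℝ) < h := by linarith [S.hh, S.M1]
  have hC0 : 0 ≤ C := (integral_nonneg fun _ => abs_nonneg _).trans (hC 0)
  have hp0 : 0 ≤ p := measureReal_nonneg
  have hq0 : 0 ≤ q := measureReal_nonneg.trans (hq 0)
  have hlog : Real.log κ ≤ 0 := Real.log_nonpos hκ.le (S.κ1.trans (by norm_num))
  set L : ℝ := 4 * h + 4 with hL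
  have hL0 : 0 < L := by rw [hL]; positivity
  have sub : Tendsto (fun k : ℕ => (((k * (4 * h + 4) : ℕ) : ℝ))⁻¹ *
      ∫ ω, Real.log ‖transferProd lam V (E : ℂ) (k * (4 * h + 4)) ω‖ ∂P) atTop (nhds γ) :=
    hγ.comp (tendsto_id.atTop_mul_const' (by positivity))
  have small : Tendsto (fun k : ℕ => (1 / L) * (1 / (k : ℝ))) atTop (nhds 0) := by
    simpa using tendsto_one_div_atTop_nhds_zero_nat.const_mul (1 / L)
  have inv : ∀ k : ℕ, (((k * (4 * h + 4) : ℕ) : ℝ))⁻¹ = 1 / L * (1 / (k : ℝ)) := fun k => by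
    push_cast
    rw [mul_inv, one_div, one_div, mul_comm]
  have lower : (κ * L - 20 - 42 * ((4 * h + 5) * C) - 3 * L * p - 3 * L * q) / L ≤ γ := by
    refine le_of_tendsto_of_tendsto (f := fun k : ℕ =>
      (κ * L - 20 - 42 * ((4 * h + 5) * C) - 3 * L * p - 3 * L * q) / L - 1 / L * (1 / (k : ℝ)))
      ?_ sub ?_
    · simpa using small.const_sub
        ((κ * L - 20 - 42 * ((4 * h + 5) * C) - 3 * L * p - 3 * L * q) / L)
    · filter_upwards [eventually_ge_atTop 1] with k hk
      have hk0 : (0 : ℝ) < k := by exact_mod_cast hk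
      have h1 := H.integral_log_orbitSize_ge S hB hC hq k
      have h2 := (H.integral_log_norm S hB hE hlam (k * (4 * h + 4))).1
      rw [inv]
      have h3 : 0 ≤ 1 / L * (1 / (k : ℝ)) := by positivity
      have h4 := mul_le_mul_of_nonneg_left ((sub_le_sub_right h1 1).trans h2) h3
      refine le_trans (le_of_eq ?_) h4
      field_simp
      rw [hL, hp]
      ring
  have upper : γ ≤ (κ * L + 5 - Real.log κ + (4 * h + 5) * C + 2 * L * p) / L := by
    refine le_of_tendsto_of_tendsto sub (g := fun k : ℕ =>
      (κ * L + 5 - Real.log κ + (4 * h + 5) * C + 2 * L * p) / L +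
        Real.log 2 * (1 / L * (1 / (k : ℝ)))) ?_ ?_
    · simpa using (small.const_mul (Real.log 2)).const_add
        ((κ * L + 5 - Real.log κ + (4 * h + 5) * C + 2 * L * p) / L)
    · filter_upwards [eventually_ge_atTop 1] with k hk
      have hk0 : (0 : ℝ) < k := by exact_mod_cast hk
      have h1 := H.integral_log_totalSize_le S hB hC k
      have h2 := (H.integral_log_norm S hB hE hlam (k * (4 * h + 4))).2
      rw [inv]
      have h3 : 0 ≤ 1 / L * (1 / (k : ℝ)) := by positivity
      have h4 := mul_le_mul_of_nonneg_left (h2.trans h1) h3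
      refine h4.trans (le_of_eq ?_)
      field_simp
      ring
  have hhL : (20 - Real.log κ) / L ≤ (20 - Real.log κ) / h :=
    div_le_div_of_nonneg_left (by linarith) hh (by linarith)
  have hCL : (4 * h + 5) * C / L ≤ 2 * C := by
    rw [div_le_iff₀ hL0, hL]
    nlinarith
  have s1 : (κ * L - 20 - 42 * ((4 * h + 5) * C) - 3 * L * p - 3 * L * q) / L =
      κ - 20 / L - 42 * ((4 * h + 5) * C / L) - 3 * p - 3 * q := by field_simp
  have s2 : (κ * L + 5 - Real.log κ + (4 * h + 5) * C + 2 * L * p) / L =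
      κ + (5 - Real.log κ) / L + (4 * h + 5) * C / L + 2 * p := by field_simp; ring
  have d1 : 20 / L ≤ (20 - Real.log κ) / L := div_le_div_of_nonneg_right (by linarith) hL0.le
  have d2 : (5 - Real.log κ) / L ≤ (20 - Real.log κ) / L :=
    div_le_div_of_nonneg_right (by linarith) hL0.le
  rw [s1] at lower
  rw [s2] at upper
  rw [abs_le]
  constructor <;> linarith

/-- The Lyapunov exponent equals `κ` up to an explicit error, at every admissible scale. -/
theorem exists_lyapunov_bound (H : PotHyp P V r α B Cv Cm) :
    ∃ C > 0, ∃ M ≥ 1000, ∀ κ ν h, Scale M κ ν h → ∀ lam E γ : ℝ, E = Real.exp κ + Real.exp (-κ) →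
      lam = Real.exp κ * ν → IsLyapunov P lam V (E : ℂ) γ →
      ∀ t : ℝ, 0 < t → ∀ g : ℕ, 1 ≤ g → t * g * C ≤ 1 → h + 1 ≤ g ^ 3 →
      |γ - κ| ≤ C * ((1 - Real.log κ) / h + ν / Real.sqrt κ +
        h * Real.exp (C * t ^ 2 / κ - t * κ / (100 * ν))) := by
  obtain ⟨C₁, hC₁, M, hM, hexit⟩ := H.exists_exit_le
  obtain ⟨C₂, hC₂, hbad⟩ := H.exists_bad_le
  obtain ⟨C₃, hC₃, hfilt⟩ := H.exists_integral_filt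
  have hB := H.B0
  refine ⟨20 + 84 * C₃ + (3 + 3 * C₁) * (18 * C₂) + C₂, by positivity, M + 10 * B,
    by linarith,
    fun κ ν h S lam E γ hE hlam hγ t ht g hg htg hgh => ?_⟩
  set C := 20 + 84 * C₃ + (3 + 3 * C₁) * (18 * C₂) + C₂ with hC
  have c1 : 0 ≤ (3 + 3 * C₁) * (18 * C₂) := by positivity
  have S0 := S.mono hM (by linarith)
  have hκ := S.κ0
  have hν := S.ν0
  have hh : (1 : ℝ) ≤ h := by linarith [S.hh, S.M1]
  have hlog : Real.log κ ≤ 0 := Real.log_nonpos hκ.le (S.κ1.trans (by norm_num))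
  have main := H.abs_lyapunov_sub_le S (by linarith) (hfilt κ ν hκ S.κ1 hν.le)
    (hexit κ ν h S0) hE hlam hγ
  have htg0 : 0 ≤ t * g := by positivity
  have bad := hbad κ ν t hκ S.κ1 hν ht g h hg
    ((mul_le_mul_of_nonneg_left (by linarith : C₂ ≤ C) htg0).trans htg) hgh
  set X := Real.exp (C * t ^ 2 / κ - t * κ / (100 * ν)) with hX
  have hX0 : 0 < X := Real.exp_pos _
  have bX : Real.exp (C₂ * t ^ 2 / κ - t * (κ / 100) / ν) ≤ X := by
    rw [hX, Real.exp_le_exp]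
    have e1 : t * (κ / 100) / ν = t * κ / (100 * ν) := by field_simp
    rw [e1]
    have : C₂ * t ^ 2 / κ ≤ C * t ^ 2 / κ := by
      gcongr
      linarith
    linarith
  have bad2 : P.real (badSet κ ν V h) ≤ 18 * C₂ * (h * X) := by
    refine bad.trans ?_
    calc _ ≤ (9 * h) * (2 * C₂ * X) := by
          gcongr
          linarith
      _ = _ := by ring
  have hxx : 0 ≤ h * X := by positivity
  have y1 : 0 ≤ (1 - Real.log κ) / h := div_nonneg (by linarith) (by linarith)
  have y2 : 0 ≤ ν / Real.sqrt κ := by positivity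
  have z1 : (20 - Real.log κ) / h ≤ C * ((1 - Real.log κ) / h) := by
    rw [← mul_div_assoc]
    refine div_le_div_of_nonneg_right ?_ (by linarith)
    nlinarith
  have z2 : 84 * (C₃ * (ν / Real.sqrt κ)) ≤ C * (ν / Real.sqrt κ) := by
    rw [← mul_assoc]
    exact mul_le_mul_of_nonneg_right (by linarith) y2
  have z3 : (3 + 3 * C₁) * P.real (badSet κ ν V h) ≤ C * (h * X) := by
    calc _ ≤ (3 + 3 * C₁) * (18 * C₂ * (h * X)) := by gcongr
      _ = (3 + 3 * C₁) * (18 * C₂) * (h * X) := by ring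
      _ ≤ _ := mul_le_mul_of_nonneg_right (by linarith) hxx
  rw [mul_add, mul_add]
  linarith

end PotHyp

end Lyapunov

theorem eventually_rpow_le {s θ : ℝ} (hs : 0 < s) (hθ : 0 < θ) :
    ∀ᶠ x : ℝ in nhdsWithin 0 (Set.Ioi 0), x ^ s ≤ θ := by
  have h : Tendsto (fun x : ℝ => x ^ s) (nhdsWithin 0 (Set.Ioi 0)) (nhds 0) := by
    have := (Real.continuousAt_rpow_const 0 s (Or.inr hs.le)).tendsto
    rw [Real.zero_rpow hs.ne'] at this
    exact this.mono_left nhdsWithin_le_nhds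
  exact (h.eventually (gt_mem_nhds hθ)).mono fun x hx => hx.le

theorem eventually_exp_neg_rpow_le {c d θ : ℝ} (s : ℝ) (hc : 0 < c) (hd : 0 < d) (hθ : 0 < θ) :
    ∀ᶠ x : ℝ in nhdsWithin 0 (Set.Ioi 0), Real.exp (-(c * x ^ (-d))) ≤ θ * x ^ s := by
  have h := (tendsto_rpow_mul_exp_neg_mul_atTop_nhds_zero (s / d) c hc).comp
    (tendsto_rpow_neg_nhdsGT_zero (neg_neg_of_pos hd))
  filter_upwards [h.eventually (gt_mem_nhds hθ), self_mem_nhdsWithin] with x hx hx0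
  have hx0 : 0 < x := hx0
  have he : (x ^ (-d)) ^ (s / d) = (x ^ s)⁻¹ := by
    rw [← Real.rpow_mul hx0.le, ← Real.rpow_neg hx0.le]
    congr 1
    field_simp
  simp only [Function.comp_apply, he] at hx
  have hp : 0 < x ^ s := Real.rpow_pos_of_pos hx0 s
  rw [inv_mul_lt_iff₀ hp] at hx
  rw [neg_mul] at hx
  linarith

theorem exists_exp_add_exp_neg_eq {x : ℝ} (hx : 0 < x) (hx1 : x ≤ 1 / 2) :
    ∃ κ, x / 2 ≤ κ ∧ κ ≤ x ∧ x - κ ≤ x ^ 3 ∧ 2 + x ^ 2 = Real.exp κ + Real.exp (-κ) := by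
  set y := Real.arsinh (x / 2) with hy
  have hsy : Real.sinh y = x / 2 := Real.sinh_arsinh _
  have hy0 : 0 ≤ y := Real.arsinh_nonneg_iff.2 (by positivity)
  have hyx : y ≤ x / 2 := hsy ▸ Real.self_le_sinh_iff.2 hy0
  have hy1 : |y| ≤ 1 := by rw [abs_of_nonneg hy0]; linarith
  have hy1' : |-y| ≤ 1 := by rwa [abs_neg]
  have h₁ := (abs_le.1 (Real.exp_bound hy1 (n := 3) (by norm_num))).2
  have h₂ := (abs_le.1 (Real.exp_bound hy1' (n := 3) (by norm_num))).1
  rw [abs_neg] at h₂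
  rw [abs_of_nonneg hy0] at h₁ h₂
  norm_num [Finset.sum_range_succ, Nat.factorial] at h₁ h₂
  have hs : x / 2 ≤ y + y ^ 3 := by
    rw [← hsy, Real.sinh_eq]
    nlinarith [pow_nonneg hy0 3]
  have hy3 : y ^ 3 ≤ (x / 2) ^ 3 := pow_le_pow_left₀ hy0 hyx 3
  have hx3 : x ^ 3 ≤ x / 4 := by nlinarith [mul_nonneg hx.le (mul_nonneg hx.le hx.le)]
  refine ⟨2 * y, ?_, by linarith, ?_, ?_⟩
  · nlinarith
  · nlinarith [pow_pos hx 3]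
  · have := Real.cosh_eq (2 * y)
    have h2 := Real.cosh_two_mul y
    have h3 := Real.cosh_sq y
    rw [hsy] at h2 h3
    nlinarith

theorem scale_of_le {M κ ν lam D : ℝ} {h : ℕ} (κ0 : 0 < κ) (hlam : 0 < lam) (hM : 1000 ≤ M)
    (hMκ : M * κ ≤ 1) (hν : lam / 2 ≤ ν) (hνl : ν ≤ lam) (hMl : M * lam ≤ κ)
    (hκ3 : M * κ ^ 3 ≤ lam / 2) (hh : M ≤ h) (hD : D ≤ κ * h)
    (hpow : M * κ * Real.exp (-(1 / 2 * D)) ≤ lam / 2)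
    (hcontr : Real.exp (-(2 / 5 * D)) ≤ 1 / 2)
    (hexp : 1.1 * Real.exp (-(3 / 20 * D)) < 2.4 * κ) : Scale M κ ν h := by
  have hκ1 : κ ≤ 1 / 1000 := by nlinarith
  have hexp_pow (a : ℝ) (ha : a * κ ≤ 1) (n : ℕ) :
      (1 - a * κ) ^ n ≤ Real.exp (-(a * κ * n)) := by
    rw [show -(a * κ * n) = n * (-(a * κ)) by ring, Real.exp_nat_mul]
    refine pow_le_pow_left₀ (by linarith) ?_ n
    linarith [Real.add_one_le_exp (-(a * κ))]
  refine ⟨κ0, by linarith, hM, hMκ, by nlinarith, by linarith, hh, ?_, ?_, ?_⟩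
  · have h1 := hexp_pow (1 / 2) (by linarith) h
    have h2 : Real.exp (-(1 / 2 * κ * h)) ≤ Real.exp (-(1 / 2 * D)) :=
      Real.exp_le_exp.2 (by nlinarith)
    have h3 : (1 - κ / 2) ^ h ≤ Real.exp (-(1 / 2 * D)) := by
      rw [show 1 - κ / 2 = 1 - 1 / 2 * κ by ring]; exact h1.trans h2
    calc M * (κ * (1 - κ / 2) ^ h) ≤ M * (κ * Real.exp (-(1 / 2 * D))) := by gcongr
      _ ≤ ν := by linarith
  · have h1 := hexp_pow (1 / 5) (by linarith) (2 * h)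
    have h2 : Real.exp (-(1 / 5 * κ * (2 * h : ℕ))) ≤ Real.exp (-(2 / 5 * D)) := by
      refine Real.exp_le_exp.2 ?_
      push_cast
      nlinarith
    rw [show 1 - κ / 5 = 1 - 1 / 5 * κ by ring]
    exact (h1.trans h2).trans hcontr
  · have h1 : Real.exp (3 / 20 * κ) ≤ 1 + 0.3 * κ := by
      have := (abs_le.1 (Real.abs_exp_sub_one_sub_id_le (x := 3 / 20 * κ)
        (by rw [abs_of_pos (by positivity)]; linarith))).2
      nlinarith
    have h2 : Real.exp (3 / 20 * D) ≤ (1 + 0.3 * κ) ^ h := by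
      calc Real.exp (3 / 20 * D) ≤ Real.exp (h * (3 / 20 * κ)) :=
            Real.exp_le_exp.2 (by nlinarith)
        _ = Real.exp (3 / 20 * κ) ^ h := Real.exp_nat_mul _ _
        _ ≤ _ := pow_le_pow_left₀ (Real.exp_pos _).le h1 h
    have h3 : 1.1 < Real.exp (3 / 20 * D) * (2.4 * κ) := by
      have := mul_lt_mul_of_pos_left hexp (Real.exp_pos (3 / 20 * D))
      rwa [mul_left_comm, ← Real.exp_add, add_neg_cancel, Real.exp_zero, mul_one] at this
    exact h3.trans_le (by gcongr)

theorem one_sub_log_le {κ c L η : ℝ} (hc : 0 < c) (hL : 0 < L) (hL1 : L ≤ 1) (hη : 0 < η)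
    (hη₂ : η < 4 / 3) (hκ : c * L ^ (η / 2) ≤ κ) :
    1 - Real.log κ ≤ (1 + (1 / c) ^ (2 / η * (1 - 3 * η / 4)) / (2 / η * (1 - 3 * η / 4))) *
      L ^ (-(1 - 3 * η / 4)) := by
  set s := 2 / η * (1 - 3 * η / 4) with hs
  have hs0 : 0 < s := mul_pos (by positivity) (by linarith)
  have hq : 0 < L ^ (η / 2) := Real.rpow_pos_of_pos hL _
  have hκ0 : 0 < κ := lt_of_lt_of_le (by positivity) hκ
  have h1 : 1 ≤ L ^ (-(1 - 3 * η / 4)) :=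
    Real.one_le_rpow_of_pos_of_le_one_of_nonpos hL hL1 (by linarith)
  have h2 : -Real.log κ ≤ (1 / κ) ^ s / s := by
    rw [← Real.log_inv, ← one_div]
    exact Real.log_le_rpow_div (by positivity) hs0
  have h3 : (1 / κ) ^ s ≤ (1 / c) ^ s * L ^ (-(1 - 3 * η / 4)) := by
    calc (1 / κ) ^ s ≤ (1 / c * L ^ (-(η / 2))) ^ s := by
          refine Real.rpow_le_rpow (by positivity) ?_ hs0.le
          rw [Real.rpow_neg hL.le, ← one_div, one_div_mul_one_div]
          exact one_div_le_one_div_of_le (by positivity) hκ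
      _ = _ := by
          rw [Real.mul_rpow (by positivity) (by positivity), ← Real.rpow_mul hL.le]
          congr 2
          rw [hs]
          field_simp
  have h4 : (1 / κ) ^ s / s ≤ (1 / c) ^ s * L ^ (-(1 - 3 * η / 4)) / s := by gcongr
  have h5 : (1 + (1 / c) ^ s / s) * L ^ (-(1 - 3 * η / 4)) =
    L ^ (-(1 - 3 * η / 4)) + (1 / c) ^ s * L ^ (-(1 - 3 * η / 4)) / s := by ring
  linarith

theorem ceil_le_two_mul {x : ℝ} (hx : 1 ≤ x) : (⌈x⌉₊ : ℝ) ≤ 2 * x := by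
  linarith [Nat.ceil_lt_add_one (by linarith : 0 ≤ x)]

set_option maxHeartbeats 1000000 in
theorem eventually_scale_error_le {ε η : ℝ} (hε : 0 < ε) (hη₁ : 4 / 5 < η) (hη₂ : η < 4 / 3)
    {C M : ℝ} (hC : 0 < C) (hM : 1000 ≤ M) :
    ∃ K > 0, ∀ᶠ L : ℝ in nhdsWithin 0 (Set.Ioi 0), ∃ (κ ν t : ℝ) (h g : ℕ), Scale M κ ν h ∧
      2 + ε * L ^ η = Real.exp κ + Real.exp (-κ) ∧ L = Real.exp κ * ν ∧ 0 < t ∧ 1 ≤ g ∧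
      t * g * C ≤ 1 ∧ h + 1 ≤ g ^ 3 ∧
      |κ - Real.sqrt (ε * L ^ η)| ≤ K * L ^ (7 * η / 4 - 1) ∧
      (1 - Real.log κ) / h + ν / Real.sqrt κ +
        h * Real.exp (C * t ^ 2 / κ - t * κ / (100 * ν)) ≤ K * L ^ (1 - η / 4) := by
  set b := (max (η / 4) ((2 - η) / 3) + (2 - η) / 2) / 2 with hb
  have hmax : max (η / 4) ((2 - η) / 3) < (2 - η) / 2 := max_lt (by linarith) (by linarith)
  have hb₁ : η / 4 < b := by have := le_max_left (η / 4) ((2 - η) / 3); linarith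
  have hb₂ : (2 - η) / 3 < b := by have := le_max_right (η / 4) ((2 - η) / 3); linarith
  have hb₃ : b < (2 - η) / 2 := by linarith
  clear_value b
  set c := Real.sqrt ε / 2 with hc
  have hc0 : 0 < c := by positivity
  have hc2 : Real.sqrt ε = 2 * c := by rw [hc]; ring
  have hcε : ε = 4 * c ^ 2 := by
    have := Real.sq_sqrt hε.le
    rw [hc2] at this
    linarith
  clear_value c
  set J := 1 + (1 / c) ^ (2 / η * (1 - 3 * η / 4)) / (2 / η * (1 - 3 * η / 4)) with hJ
  have hJ0 : 0 < J := by
    have : 0 < 2 / η * (1 - 3 * η / 4) := mul_pos (by positivity) (by linarith)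
    positivity
  refine ⟨(2 * c) ^ 3 + (J + 1 / Real.sqrt c + 2 * Real.exp 1), by positivity, ?_⟩
  filter_upwards [self_mem_nhdsWithin, eventually_rpow_le one_pos one_pos,
    eventually_rpow_le (s := η / 2) (θ := 1 / (2 * c * M)) (by linarith) (by positivity),
    eventually_rpow_le (s := 1 - η / 2) (θ := c / M) (by linarith) (by positivity),
    eventually_rpow_le (s := 3 * η / 2 - 1) (θ := 1 / (2 * M * (2 * c) ^ 3)) (by linarith)
      (by positivity),
    eventually_rpow_le (s := 2 - η) (θ := 1 / M) (by linarith) (by positivity),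
    eventually_exp_neg_rpow_le (c := 1 / 2 * c) (d := 2 - 3 * η / 2) (θ := 1 / 2) 1
      (by positivity) (by linarith) (by norm_num),
    eventually_exp_neg_rpow_le (c := 2 / 5 * c) (d := 2 - 3 * η / 2) (θ := 1 / 2) 0
      (by positivity) (by linarith) (by norm_num),
    eventually_exp_neg_rpow_le (c := 3 / 20 * c) (d := 2 - 3 * η / 2) (θ := c) (η / 2)
      (by positivity) (by linarith) hc0,
    eventually_rpow_le (s := b - (2 - η) / 3) (θ := 1 / (3 * C)) (by linarith) (by positivity),
    eventually_rpow_le (s := 2 * b - η / 2) (θ := c / C) (by linarith) (by positivity),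
    eventually_exp_neg_rpow_le (c := c / 100) (d := 1 - η / 2 - b) (θ := 1)
      (1 - η / 4 + (2 - η)) (by positivity) (by linarith) one_pos]
    with L hL e1 e2 e3 e4 e5 e6 e7 e8 e9 e10 e11
  have hL : 0 < L := hL
  rw [Real.rpow_one] at e1 e6
  rw [Real.rpow_zero, mul_one] at e7
  have hM0 : 0 < M := by linarith
  set q := L ^ (η / 2) with hq
  have hq0 : 0 < q := Real.rpow_pos_of_pos hL _
  have hqq : L ^ η = q ^ 2 := by
    rw [hq, ← Real.rpow_natCast, ← Real.rpow_mul hL.le]; congr 1; push_cast; ring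
  have hx : ε * L ^ η = (2 * c * q) ^ 2 := by rw [hqq, hcε]; ring
  have hsqrt : Real.sqrt (ε * L ^ η) = 2 * c * q := by rw [hx, Real.sqrt_sq (by positivity)]
  have hxM : M * (2 * c * q) ≤ 1 := by
    rw [le_div_iff₀ (by positivity)] at e2; linarith
  obtain ⟨κ, hκl, hκu, hκd, hκe⟩ := exists_exp_add_exp_neg_eq (x := 2 * c * q) (by positivity)
    (by
      have := mul_le_mul_of_nonneg_right hM (by positivity : 0 ≤ 2 * c * q)
      linarith only [this, hxM])
  have hκc : c * q ≤ κ := by linarith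
  have hκ0 : 0 < κ := lt_of_lt_of_le (by positivity) hκc
  have hMκ : M * κ ≤ 1 := (mul_le_mul_of_nonneg_left hκu hM0.le).trans hxM
  have hκ1 : κ ≤ 1 / 2 := by
    have := mul_le_mul_of_nonneg_right hM hκ0.le
    linarith only [this, hMκ, hκ0]
  have hq3 : q ^ 3 = L ^ (3 * η / 2) := by
    rw [hq, ← Real.rpow_natCast, ← Real.rpow_mul hL.le]; congr 1; push_cast; ring
  have hx3 : (2 * c * q) ^ 3 = (2 * c) ^ 3 * L ^ (3 * η / 2) := by rw [mul_pow, hq3]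
  set ν := L * Real.exp (-κ) with hν
  have hνl : L / 2 ≤ ν := by
    have := Real.add_one_le_exp (-κ)
    rw [hν, div_eq_mul_one_div]
    exact mul_le_mul_of_nonneg_left (by linarith) hL.le
  have hνu : ν ≤ L := by
    rw [hν]
    exact mul_le_of_le_one_right hL.le (Real.exp_le_one_iff.2 (by linarith))
  have hν0 : 0 < ν := by positivity
  have hw1 : 1 ≤ L ^ (-(2 - η)) :=
    Real.one_le_rpow_of_pos_of_le_one_of_nonpos hL e1 (by linarith)
  have hw0 : 0 < L ^ (-(2 - η)) := by linarith
  have hwM : M ≤ L ^ (-(2 - η)) := by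
    rw [Real.rpow_neg hL.le, ← one_div, le_one_div hM0 (by positivity)]
    exact e5
  set h := ⌈L ^ (-(2 - η))⌉₊ with hh
  have hhl : L ^ (-(2 - η)) ≤ h := Nat.le_ceil _
  have hhu : (h : ℝ) ≤ 2 * L ^ (-(2 - η)) := ceil_le_two_mul hw1
  have hh0 : (0 : ℝ) < h := by linarith
  set z := L ^ (-((2 - η) / 3)) with hz
  have hz1 : 1 ≤ z := Real.one_le_rpow_of_pos_of_le_one_of_nonpos hL e1 (by linarith)
  have hz3 : z ^ 3 = L ^ (-(2 - η)) := by
    rw [hz, ← Real.rpow_natCast, ← Real.rpow_mul hL.le]; congr 1; push_cast; ring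
  set g := ⌈2 * z⌉₊ with hg
  have hgl : 2 * z ≤ g := Nat.le_ceil _
  have hgu : (g : ℝ) ≤ 3 * z := by linarith [Nat.ceil_lt_add_one (by linarith : 0 ≤ 2 * z)]
  have hS : Scale M κ ν h := by
    refine scale_of_le (D := c * L ^ (-(2 - 3 * η / 2))) hκ0 hL hM hMκ hνl hνu ?_ ?_
      (hwM.trans hhl) ?_ ?_ ?_ ?_
    · have : L ^ (1 - η / 2) * q = L := by
        rw [hq, ← Real.rpow_add hL, sub_add_cancel, Real.rpow_one]
      rw [le_div_iff₀ hM0] at e3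
      calc M * L = L ^ (1 - η / 2) * M * q := by rw [mul_right_comm, this, mul_comm]
        _ ≤ c * q := by gcongr
        _ ≤ κ := hκc
    · have : L ^ (3 * η / 2) = L ^ (3 * η / 2 - 1) * L := by
        rw [← Real.rpow_add_one hL.ne', sub_add_cancel]
      rw [le_div_iff₀ (by positivity)] at e4
      calc M * κ ^ 3 ≤ M * (2 * c * q) ^ 3 := by gcongr
        _ = L ^ (3 * η / 2 - 1) * (2 * M * (2 * c) ^ 3) * (L / 2) := by rw [hx3, this]; ring
        _ ≤ 1 * (L / 2) := by gcongr
        _ = L / 2 := one_mul _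
    · calc c * L ^ (-(2 - 3 * η / 2)) = c * q * L ^ (-(2 - η)) := by
            rw [mul_assoc, hq, ← Real.rpow_add hL]; ring_nf
        _ ≤ κ * h := by gcongr
    · rw [← mul_assoc]
      calc _ ≤ 1 * (1 / 2 * L) := by gcongr
        _ = L / 2 := by ring
    · rwa [← mul_assoc]
    · rw [← mul_assoc]
      linarith only [e8, hκc, mul_pos hc0 hq0]
  have ht0 : 0 < L ^ b := Real.rpow_pos_of_pos hL _
  refine ⟨κ, ν, L ^ b, h, g, hS, ?_, ?_, ht0, ?_, ?_, ?_, ?_, ?_⟩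
  · rw [hx, hκe]
  · rw [hν, mul_left_comm, ← Real.exp_add, add_neg_cancel, Real.exp_zero, mul_one]
  · exact_mod_cast (by linarith : (1 : ℝ) ≤ g)
  · have : L ^ (b - (2 - η) / 3) = L ^ b * z := by
      rw [hz, ← Real.rpow_add hL, sub_eq_add_neg]
    rw [this, le_div_iff₀ (by positivity)] at e9
    calc L ^ b * g * C ≤ L ^ b * (3 * z) * C := by gcongr
      _ ≤ 1 := by linarith
  · have : (h : ℝ) + 1 ≤ g ^ 3 := by
      have := pow_le_pow_left₀ (by positivity) hgl 3
      rw [mul_pow, hz3] at this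
      linarith
    exact_mod_cast this
  · rw [hsqrt, abs_sub_comm, abs_of_nonneg (by linarith)]
    have h1 : L ^ (3 * η / 2) ≤ L ^ (7 * η / 4 - 1) :=
      Real.rpow_le_rpow_of_exponent_ge hL e1 (by linarith)
    rw [hx3] at hκd
    calc 2 * c * q - κ ≤ (2 * c) ^ 3 * L ^ (7 * η / 4 - 1) := hκd.trans (by gcongr)
      _ ≤ _ := by gcongr; exact le_add_of_nonneg_right (by positivity)
  · have h1 : (1 - Real.log κ) / h ≤ J * L ^ (1 - η / 4) := by
      have hlog := one_sub_log_le hc0 hL e1 (by linarith) hη₂ hκc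
      rw [← hJ] at hlog
      calc (1 - Real.log κ) / h ≤ J * L ^ (-(1 - 3 * η / 4)) / L ^ (-(2 - η)) := by gcongr
        _ = J * L ^ (1 - η / 4) := by
          rw [mul_div_assoc, ← Real.rpow_sub hL]; ring_nf
    have h2 : ν / Real.sqrt κ ≤ 1 / Real.sqrt c * L ^ (1 - η / 4) := by
      have hr : Real.sqrt c * L ^ (η / 4) ≤ Real.sqrt κ := by
        refine Real.le_sqrt_of_sq_le ?_
        rw [mul_pow, Real.sq_sqrt hc0.le, ← Real.rpow_natCast, ← Real.rpow_mul hL.le,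
          show η / 4 * (2 : ℕ) = η / 2 by push_cast; ring]
        exact hκc
      calc ν / Real.sqrt κ ≤ L / (Real.sqrt c * L ^ (η / 4)) := by gcongr
        _ = _ := by rw [Real.rpow_sub hL, Real.rpow_one]; field_simp
    have h3 : h * Real.exp (C * (L ^ b) ^ 2 / κ - L ^ b * κ / (100 * ν)) ≤
        2 * Real.exp 1 * L ^ (1 - η / 4) := by
      have i1 : C * (L ^ b) ^ 2 / κ ≤ 1 := by
        have : (L ^ b) ^ 2 = L ^ (2 * b - η / 2) * q := by
          rw [hq, ← Real.rpow_add hL, ← Real.rpow_natCast, ← Real.rpow_mul hL.le]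
          congr 1; push_cast; ring
        rw [le_div_iff₀ hC] at e10
        rw [div_le_one hκ0, this]
        calc C * (L ^ (2 * b - η / 2) * q) = L ^ (2 * b - η / 2) * C * q := by ring
          _ ≤ c * q := by gcongr
          _ ≤ κ := hκc
      have i2 : c / 100 * L ^ (-(1 - η / 2 - b)) ≤ L ^ b * κ / (100 * ν) := by
        calc c / 100 * L ^ (-(1 - η / 2 - b)) = L ^ b * (c * q) / (100 * L) := by
              rw [show -(1 - η / 2 - b) = b + η / 2 - 1 by ring, Real.rpow_sub hL,
                Real.rpow_add hL, Real.rpow_one, ← hq]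
              field_simp
          _ ≤ _ := by gcongr
      calc h * Real.exp (C * (L ^ b) ^ 2 / κ - L ^ b * κ / (100 * ν))
          ≤ 2 * L ^ (-(2 - η)) *
            Real.exp (1 + -(c / 100 * L ^ (-(1 - η / 2 - b)))) := by
              gcongr
              linarith
        _ ≤ 2 * L ^ (-(2 - η)) * (Real.exp 1 * (1 * L ^ (1 - η / 4 + (2 - η)))) := by
              rw [Real.exp_add]; gcongr
        _ = 2 * Real.exp 1 * L ^ (1 - η / 4) := by
              have : L ^ (1 - η / 4) = L ^ (-(2 - η)) * L ^ (1 - η / 4 + (2 - η)) := by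
                rw [← Real.rpow_add hL]; ring_nf
              rw [this]; ring
    calc _ ≤ (J + 1 / Real.sqrt c + 2 * Real.exp 1) * L ^ (1 - η / 4) := by linarith
      _ ≤ _ := mul_le_mul_of_nonneg_right (le_add_of_nonneg_left (by positivity)) (by positivity)

/-- Lyapunov exponent above the band edge: `γ_λ(2 + ελ^η) = (ελ^η)^{1/2} + errors`. -/
theorem aboveBandEdge_lyapunov {A : Type*} [Countable A] [MeasurableSpace A]
    (P : Measure (ℤ → A)) [IsProbabilityMeasure P]
    (hinv : MeasurePreserving (shiftn 1) P P)
    (r : ℝ) (hr : 0 < r) (hr1 : r < 1)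
    (V : (ℤ → A) → ℝ) (hVmeas : Measurable V) (hVbdd : ∃ B, ∀ ω, |V ω| ≤ B)
    (hVql : QuasiLocal r V) (hVcent : ∫ ω, V ω ∂P = 0)
    (α : ℝ) (hα : 2 < α) (hmix : PowerMixing P α)
    (ε : ℝ) (hε : 0 < ε) (η : ℝ) (hη₁ : 4/5 < η) (hη₂ : η < 4/3) :
    ∃ C > (0:ℝ), ∃ lam₀ > (0:ℝ), ∀ lam : ℝ, 0 < lam → lam < lam₀ → ∀ γ : ℝ,
      IsLyapunov P lam V ((2 + ε * lam ^ η : ℝ) : ℂ) γ →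
      |γ - Real.sqrt (ε * lam ^ η)| ≤
        C * (lam ^ (1 - η/4) + lam ^ (7*η/4 - 1)
          + lam ^ (η/4 * ((3*α + 2)/(α + 2)))) := by
  obtain ⟨B, Cv, Cm, H⟩ := exists_potHyp hinv hr hr1 hVmeas hVbdd hVql hVcent hα hmix
  obtain ⟨C, hC, M, hM, hbound⟩ := H.exists_lyapunov_bound
  obtain ⟨K, hK, hev⟩ := eventually_scale_error_le hε hη₁ hη₂ hC hM
  obtain ⟨lam₀, hlam₀, hsub⟩ := mem_nhdsGT_iff_exists_Ioo_subset.1 hev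
  refine ⟨(C + 1) * K, by positivity, lam₀, hlam₀, fun lam h0 h1 γ hγ => ?_⟩
  obtain ⟨κ, ν, t, h, g, hS, hE, hlam, ht, hg, htg, hgh, hκ, herr⟩ := hsub ⟨h0, h1⟩
  have hmain := (hbound κ ν h hS lam _ γ hE hlam hγ t ht g hg htg hgh).trans
    (mul_le_mul_of_nonneg_left herr hC.le)
  have p1 : 0 ≤ lam ^ (1 - η / 4) := Real.rpow_nonneg h0.le _
  have p2 : 0 ≤ lam ^ (7 * η / 4 - 1) := Real.rpow_nonneg h0.le _
  have p3 : 0 ≤ lam ^ (η / 4 * ((3 * α + 2) / (α + 2))) := Real.rpow_nonneg h0.le _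
  calc _ ≤ |γ - κ| + |κ - Real.sqrt (ε * lam ^ η)| := abs_sub_le _ _ _
    _ ≤ C * (K * lam ^ (1 - η / 4)) + K * lam ^ (7 * η / 4 - 1) := add_le_add hmain hκ
    _ ≤ _ := by
      nlinarith [mul_nonneg hK.le p1, mul_nonneg hK.le p2, mul_nonneg hK.le p3,
        mul_nonneg (mul_nonneg hC.le hK.le) p2, mul_nonneg (mul_nonneg hC.le hK.le) p3]
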